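/- For every ε > 0 there exists a constant C = C(ε) > 0 such that the following holds. Let p ≥ 5 be a prime, let j, k be positive integers with 2j ≤ k ≤ 3j, set q = p^k and q₀ = p^j, and let χ be an even primitive Dirichlet character of conductor q. Let a_χ be the unique integer with |a_χ| < p^{k−j}/2 such that χ(1 + p^j x) = e_{p^{k−j}}(a_χ(x − b p^j x²)) for all integers x, where b is an integer with 2b ≡ 1 (mod p^{k−j}); then p ∤ a_χ. Let b_χ be the unique integer with |b_χ| < p^j/2 and b_χ ≡ a_χ (mod p^j), and let c be an integer with 2 a_χ c ≡ 1 (mod q). Define D = (φ(q₀)/2)·(φ(q)/q)·(log q + 2γ + Γ'(1/4)/Γ(1/4) − log π + 2 log p/(p−1)) and A' = (2a_χ | q)·φ(q₀)·(d(|b_χ|)/√|b_χ|)·F, where (· | q) is the Jacobi symbol and F = cos(2π c (a_χ − b_χ)²/q) if q ≡ 1 (mod 4) and F = sin(2π c (a_χ − b_χ)²/q) if q ≡ 3 (mod 4). Then | Σ_{ψ mod q₀, ψ(−1)=1} |L(1/2, χ·ψ)|² − D − A' | ≤ C q₀^{−1/4} q^{1/2+ε}, where the sum runs over all even Dirichlet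 characters ψ modulo q₀. -/

import Mathlib

open Complex

/-- `eN q x = e^{2πix/q}`. -/
noncomputable def eN (q : ℕ) (x : ℤ) : ℂ := Complex.exp (2 * Real.pi * Complex.I * x / q)

/-! ### A Stepanov-type count of square values over a finite field -/

open Polynomial in
theorem eq_zero_of_sq_eq_mul_squarefree {F : Type*} [Field F] {E A B : F[X]} (hE : Squarefree E)
    (hdeg : 0 < E.natDegree) {e : F} (he : e ≠ 0) (h : A ^ 2 = C e * (B ^ 2 * E)) :
    A = 0 ∧ B = 0 := by
  by_cases hB : B = 0
  · subst hB
    simpa using h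
  exfalso
  classical
  have hA : A ≠ 0 := by
    rintro rfl
    have hE0 : E ≠ 0 := hE.ne_zero
    have : C e * (B ^ 2 * E) ≠ 0 := by simp [he, hB, hE0]
    exact this (by simpa using h.symm)
  obtain ⟨P, hP, hPE⟩ := WfDvdMonoid.exists_irreducible_factor
    (a := E) (fun hu => by rw [natDegree_eq_zero_of_isUnit hu] at hdeg; omega) hE.ne_zero
  have hPp : Prime P := hP.prime
  have h1 := congrArg (emultiplicity P) h
  have hEm : emultiplicity P E = 1 := by
    apply le_antisymm
    · exact (squarefree_iff_emultiplicity_le_one E).1 hE P |>.resolve_right hP.not_isUnit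
    · exact_mod_cast pow_dvd_iff_le_emultiplicity.1 (show P ^ 1 ∣ E by simpa using hPE)
  have hfA : FiniteMultiplicity P A := FiniteMultiplicity.of_prime_left hPp hA
  have hfB : FiniteMultiplicity P B := FiniteMultiplicity.of_prime_left hPp hB
  have hC : emultiplicity P (C e) = 0 :=
    emultiplicity_of_isUnit_right hP.not_isUnit (isUnit_C.2 he.isUnit)
  rw [emultiplicity_mul hPp, emultiplicity_mul hPp, emultiplicity_pow hPp, emultiplicity_pow hPp,
    hC, hEm, hfA.emultiplicity_eq_multiplicity, hfB.emultiplicity_eq_multiplicity] at h1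
  norm_cast at h1
  omega

open Polynomial in
theorem X_pow_dvd_pow_sub_C {F : Type*} [Field F] {p : ℕ} [hp : Fact p.Prime] [CharP F p]
    (n : ℕ) (E : F[X]) : X ^ p ^ n ∣ E ^ p ^ n - C (E.eval 0 ^ p ^ n) := by
  have : E ^ p ^ n - C (E.eval 0 ^ p ^ n) = (E - C (E.eval 0)) ^ p ^ n := by
    rw [sub_pow_char_pow, map_pow]
  rw [this]
  apply pow_dvd_pow_of_dvd
  rw [X_dvd_iff]
  simp [coeff_zero_eq_eval_zero]

open Polynomial in
/-- Non-vanishing of the auxiliary polynomial in the Stepanov argument. -/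
theorem stepanov_ne_zero {F : Type*} [Field F] {p : ℕ} [hp : Fact p.Prime] [CharP F p]
    (n : ℕ) (hr2 : Odd (p ^ n)) {E : F[X]} (hE : Squarefree E) (hdeg : 0 < E.natDegree)
    (hE0 : E.eval 0 ≠ 0) (a J : ℕ) (hsmall : 2 * a + E.natDegree ≤ p ^ n)
    (A B : ℕ → F[X]) (hA : ∀ j, (A j).degree < a) (hB : ∀ j, (B j).degree < a)
    (h : ∑ j ∈ Finset.range J, (A j + B j * E ^ ((p ^ n + 1) / 2)) * X ^ (j * p ^ n) = 0) :
    ∀ j < J, A j = 0 ∧ B j = 0 := by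
  intro j
  induction j using Nat.strong_induction_on with
  | _ j ih =>
  intro hj
  have hdvd : X ^ p ^ n ∣ A j + B j * E ^ ((p ^ n + 1) / 2) := by
    have h1 : X ^ ((j + 1) * p ^ n) ∣ (A j + B j * E ^ ((p ^ n + 1) / 2)) * X ^ (j * p ^ n) := by
      have h2 : (A j + B j * E ^ ((p ^ n + 1) / 2)) * X ^ (j * p ^ n) =
          - ∑ i ∈ (Finset.range J).erase j,
            (A i + B i * E ^ ((p ^ n + 1) / 2)) * X ^ (i * p ^ n) := by
        rw [← Finset.add_sum_erase _ _ (Finset.mem_range.2 hj)] at h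
        exact eq_neg_of_add_eq_zero_left h
      rw [h2, dvd_neg]
      apply Finset.dvd_sum
      intro i hi
      simp only [Finset.mem_erase, Finset.mem_range] at hi
      rcases lt_or_gt_of_ne hi.1 with h3 | h3
      · rw [(ih i h3 hi.2).1, (ih i h3 hi.2).2]; simp
      · exact dvd_mul_of_dvd_right (pow_dvd_pow _ (Nat.mul_le_mul_right _ h3)) _
    rw [add_mul, one_mul, pow_add, mul_comm] at h1
    exact (mul_dvd_mul_iff_right (pow_ne_zero _ X_ne_zero)).1 h1
  set r := p ^ n with hr
  have hEr : E ^ ((r + 1) / 2) * E ^ ((r + 1) / 2) = E * E ^ r := by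
    rw [← pow_add, ← pow_succ']
    congr 1
    obtain ⟨t, ht⟩ := hr2
    omega
  have hd2 : X ^ r ∣ A j ^ 2 - C (E.eval 0 ^ r) * (B j ^ 2 * E) := by
    have h1 : A j ^ 2 - C (E.eval 0 ^ r) * (B j ^ 2 * E) =
        (A j + B j * E ^ ((r + 1) / 2)) * (A j - B j * E ^ ((r + 1) / 2)) +
        (B j ^ 2 * E) * (E ^ r - C (E.eval 0 ^ r)) := by
      linear_combination (B j)^2 * hEr
    rw [h1]
    exact dvd_add (dvd_mul_of_dvd_left hdvd _)
      (dvd_mul_of_dvd_right (X_pow_dvd_pow_sub_C n E) _)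
  have hAj : A j = 0 ∨ (A j).natDegree < a := by
    by_cases h0 : A j = 0
    · exact Or.inl h0
    · exact Or.inr ((natDegree_lt_iff_degree_lt h0).2 (hA j))
  have hBj : B j = 0 ∨ (B j).natDegree < a := by
    by_cases h0 : B j = 0
    · exact Or.inl h0
    · exact Or.inr ((natDegree_lt_iff_degree_lt h0).2 (hB j))
  have hr0 : 0 < r := pow_pos hp.out.pos _
  have hz : A j ^ 2 - C (E.eval 0 ^ r) * (B j ^ 2 * E) = 0 := by
    by_contra hne
    have h1 := natDegree_le_of_dvd hd2 hne
    rw [natDegree_X_pow] at h1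
    have h2 : (A j ^ 2).natDegree < r := by
      rcases hAj with h | h
      · simp [h, hr0]
      · have := natDegree_pow_le (p := A j) (n := 2); omega
    have h3 : (C (E.eval 0 ^ r) * (B j ^ 2 * E)).natDegree < r := by
      rcases hBj with h | h
      · simp [h, hr0]
      · refine (natDegree_C_mul_le _ _).trans_lt (natDegree_mul_le.trans_lt ?_)
        have := natDegree_pow_le (p := B j) (n := 2)
        omega
    have := natDegree_sub_le (A j ^ 2) (C (E.eval 0 ^ r) * (B j ^ 2 * E))
    omega
  exact eq_zero_of_sq_eq_mul_squarefree hE hdeg (pow_ne_zero r hE0) (sub_eq_zero.1 hz)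

open Polynomial in
/-- Stepanov's argument with auxiliary parameters. -/
theorem card_isSquare_eval_le_aux {F : Type*} [Field F] [Fintype F] [DecidableEq F] {p : ℕ}
    [hp : Fact p.Prime] [CharP F p]
    (n : ℕ) (hr2 : Odd (p ^ n)) (hcard : Fintype.card F = (p ^ n) ^ 2)
    {E : F[X]} (hE : Squarefree E) (hdeg : 0 < E.natDegree)
    (hE0 : E.eval 0 ≠ 0) (a J : ℕ) (hsmall : 2 * a + E.natDegree ≤ p ^ n)
    (hpar : a * p ^ n + E.natDegree * ((p ^ n + 1) / 2) + J < 2 * (J * a)) (S : Finset F)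
    (hS : ∀ x ∈ S, IsSquare (E.eval x)) :
    S.card ≤ a + E.natDegree * ((p ^ n + 1) / 2) + J * p ^ n := by
  set r := p ^ n with hr
  set t := (r + 1) / 2 with ht
  set D := a * r + E.natDegree * t + J with hD
  have hr0 : 0 < r := pow_pos hp.out.pos _
  -- the linear system
  let T : (Bool × Fin J × Fin a → F) →ₗ[F] F[X] :=
    { toFun := fun v => ∑ i : Bool × Fin J × Fin a,
        v i • (X ^ ((i.2.2 : ℕ) * r) * (if i.1 then E ^ t else 1) * X ^ (i.2.1 : ℕ))
      map_add' := by intro v w; simp only [Pi.add_apply, add_smul, Finset.sum_add_distrib]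
      map_smul' := by
        intro c v
        simp only [Pi.smul_apply, smul_eq_mul, mul_smul, Finset.smul_sum, RingHom.id_apply] }
  have hTmem : ∀ v, T v ∈ degreeLT F D := by
    intro v
    refine Submodule.sum_mem _ fun i _ => Submodule.smul_mem _ _ ?_
    rw [mem_degreeLT]
    refine (degree_le_natDegree).trans_lt ?_
    norm_cast
    have h1 : (X ^ ((i.2.2 : ℕ) * r) * (if i.1 then E ^ t else 1) * X ^ (i.2.1 : ℕ) : F[X]).natDegree
        ≤ (i.2.2 : ℕ) * r + E.natDegree * t + i.2.1 := by
      refine natDegree_mul_le.trans (add_le_add (natDegree_mul_le.trans (add_le_add ?_ ?_)) ?_)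
      · simp
      · split_ifs
        · rw [mul_comm]; exact natDegree_pow_le
        · simp
      · simp
    have h2 : (i.2.2 : ℕ) * r ≤ a * r := Nat.mul_le_mul_right _ i.2.2.2.le
    have h3 := i.2.1.2
    omega
  let T' := T.codRestrict (degreeLT F D) hTmem
  have hker : LinearMap.ker T' ≠ ⊥ := by
    apply LinearMap.ker_ne_bot_of_finrank_lt
    have h1 : Module.finrank F (degreeLT F D) = D := by
      rw [(degreeLTEquiv F D).finrank_eq]; simp
    rw [h1]
    simpa using hpar
  obtain ⟨v, hvker, hv0⟩ := Submodule.exists_mem_ne_zero_of_ne_bot hker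
  have hTv : T v = 0 := by
    have := congrArg Subtype.val (LinearMap.mem_ker.1 hvker)
    simpa [T'] using this
  -- extract Frobenius roots
  have hsurj : Function.Surjective (fun x : F => x ^ r) := by
    have : Function.Injective (fun x : F => x ^ r) := by
      intro x y hxy
      exact iterateFrobenius_inj F p n (by simpa [iterateFrobenius_def] using hxy)
    exact Finite.surjective_of_injective this
  choose ρ hρ using hsurj
  have hρ' : ∀ b, ρ b ^ r = b := hρ
  let P : Bool → ℕ → F[X] := fun b j => if h : j < J then
    ∑ i : Fin a, C (ρ (v (b, ⟨j, h⟩, i))) * X ^ (i : ℕ) else 0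
  have hPdeg : ∀ b j, (P b j).degree < a := by
    intro b j
    simp only [P]
    split_ifs with h
    · refine (degree_sum_le _ _).trans_lt ?_
      rw [Finset.sup_lt_iff (by exact_mod_cast WithBot.bot_lt_coe a)]
      intro i _
      refine (degree_C_mul_X_pow_le _ _).trans_lt ?_
      exact_mod_cast i.2
    · simp
  let H : F[X] := ∑ j ∈ Finset.range J, (P false j + P true j * E ^ t) * X ^ (j * r)
  have hH : H ≠ 0 := by
    intro h0
    have hall := stepanov_ne_zero n hr2 hE hdeg hE0 a J hsmall (P false) (P true)
      (hPdeg _) (hPdeg _) h0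
    apply hv0
    funext i
    obtain ⟨b, j, i⟩ := i
    have hb : P b j = 0 := by
      cases b
      · exact (hall j j.2).1
      · exact (hall j j.2).2
    have hc := congrArg (fun q => q.coeff (i : ℕ)) hb
    simp only [P, Fin.is_lt, dif_pos, finsetSum_coeff, coeff_C_mul, coeff_X_pow, coeff_zero] at hc
    rw [Finset.sum_eq_single i] at hc
    · have := hρ' (v (b, j, i))
      simp only [if_true, mul_one] at hc
      rw [← this]
      simp [hc, hr0.ne']
    · intro b _ hbi
      rw [if_neg, mul_zero]
      exact fun h => hbi (Fin.ext h.symm)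
    · simp
  have hHdeg : H.natDegree ≤ a + E.natDegree * t + J * r := by
    refine natDegree_sum_le_of_forall_le _ _ fun j hj => ?_
    have hj := Finset.mem_range.1 hj
    have hPn : ∀ b, (P b j).natDegree ≤ a := fun b => natDegree_le_of_degree_le (hPdeg b j).le
    refine natDegree_mul_le.trans (add_le_add ((natDegree_add_le _ _).trans (max_le ?_ ?_)) ?_)
    · exact (hPn _).trans (Nat.le_add_right _ _)
    · refine natDegree_mul_le.trans (add_le_add (hPn _) ?_)
      rw [mul_comm]; exact natDegree_pow_le
    · rw [natDegree_X_pow]; exact Nat.mul_le_mul_right _ hj.le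
  have hroots : ∀ x ∈ S, H.eval x = 0 := by
    intro x hx
    obtain ⟨y, hy⟩ := hS x hx
    have hQ : ∀ z : F, z ^ (r * r) = z := by
      intro z
      have := FiniteField.pow_card z
      rwa [hcard, sq] at this
    have hEt : (E.eval x ^ t) ^ r = E.eval x ^ t := by
      have h2t : 2 * t = r + 1 := by obtain ⟨s, hs⟩ := hr2; omega
      have h3 : E.eval x ^ t = y ^ (r + 1) := by rw [hy, ← sq, ← pow_mul, h2t]
      rw [h3, ← pow_mul, add_mul, pow_add, hQ, one_mul, ← pow_succ']
    have hPr : ∀ b j (h : j < J), (P b j).eval x ^ r =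
        ∑ i : Fin a, v (b, ⟨j, h⟩, i) * x ^ ((i : ℕ) * r) := by
      intro b j h
      simp only [P, dif_pos h, eval_finsetSum, eval_mul, eval_C, eval_pow, eval_X]
      rw [hr, sum_pow_char_pow]
      refine Finset.sum_congr rfl fun i _ => ?_
      rw [mul_pow, ← hr, hρ', ← pow_mul]
    have h0 : (H.eval x) ^ r = 0 := by
      have hT2 := congrArg (fun q => q.eval x) hTv
      simp only [T, LinearMap.coe_mk, AddHom.coe_mk, eval_finsetSum, eval_zero, smul_eq_C_mul,
        eval_mul, eval_C, eval_pow, eval_X] at hT2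
      rw [Fintype.sum_prod_type, Fintype.sum_bool] at hT2
      simp only [Fintype.sum_prod_type, if_true, eval_pow, Bool.false_eq_true, if_false, eval_one,
        mul_one] at hT2
      rw [← hT2, add_comm, ← Finset.sum_add_distrib]
      simp only [H, eval_finsetSum]
      rw [hr, sum_pow_char_pow, ← hr, Finset.sum_range]
      refine Finset.sum_congr rfl fun j _ => ?_
      have hxj : (x ^ ((j : ℕ) * r)) ^ r = x ^ (j : ℕ) := by
        rw [← pow_mul, mul_assoc, mul_comm, pow_mul, hQ]
      simp only [eval_mul, eval_add, eval_pow, eval_X]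
      rw [mul_pow, hr, add_pow_char_pow, ← hr, mul_pow, hEt, hPr false j j.2, hPr true j j.2,
        hxj, add_mul, Finset.sum_mul, Finset.sum_mul,
        Finset.sum_mul]
      congr 1
      · refine Finset.sum_congr rfl fun i _ => by ring
      · refine Finset.sum_congr rfl fun i _ => by ring
    exact pow_eq_zero_iff hr0.ne' |>.1 h0
  calc S.card ≤ H.roots.toFinset.card := by
        apply Finset.card_le_card
        intro x hx
        simp [hH, hroots x hx]
    _ ≤ H.natDegree := (Multiset.toFinset_card_le _).trans (card_roots' _)
    _ ≤ _ := hHdeg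

open Polynomial in
/-- Stepanov's bound: a squarefree polynomial takes square values at about half the points at most. -/
theorem card_isSquare_eval_le {F : Type*} [Field F] [Fintype F] [DecidableEq F] {p : ℕ}
    [hp : Fact p.Prime] [CharP F p]
    (n : ℕ) (hr2 : Odd (p ^ n)) (hcard : Fintype.card F = (p ^ n) ^ 2)
    {E : F[X]} (hE : Squarefree E) (hdeg : 0 < E.natDegree)
    (hE0 : E.eval 0 ≠ 0) (S : Finset F) (hS : ∀ x ∈ S, IsSquare (E.eval x)) :
    2 * S.card ≤ (p ^ n) ^ 2 + (4 * E.natDegree + 8) * p ^ n := by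
  have key := card_isSquare_eval_le_aux n hr2 hcard hE hdeg hE0
  have hS' := Finset.card_le_univ S
  rw [hcard] at hS'
  revert hr2 key hS'
  generalize p ^ n = r
  generalize E.natDegree = m at *
  intro hr2 key hS'
  rcases lt_or_ge r (2 * m + 4) with h | h
  · nlinarith
  · obtain ⟨s, rfl⟩ := hr2
    obtain ⟨a, ha1, ha2⟩ : ∃ a, 2 * a + m ≤ 2 * s + 1 ∧ 2 * s ≤ 2 * a + m :=
      ⟨(2 * s + 1 - m) / 2, by omega, by omega⟩
    have h3 : (2 * s + 1 + 1) / 2 = s + 1 := by omega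
    rw [h3] at key
    have := key a (s + 1 + (m + 2)) ha1 ?_ S hS
    · nlinarith
    · zify at *
      nlinarith

/-! ### Kloosterman sums over a tower of quadratic extensions -/

/-- The Kloosterman sum of `x + b / x` over a finite field. -/
noncomputable def klSum {E : Type*} [Field E] [Fintype E] [DecidableEq E] (ψ : AddChar E ℂ)
    (b : E) : ℂ := ∑ x : E, if x = 0 then 0 else ψ (x + b * x⁻¹)

theorem sum_sq_add_sum_nonsquare_mul_sq {E : Type*} [Field E] [Fintype E] [DecidableEq E]
    (h2 : (2 : E) ≠ 0) {d : E} (hd : ¬ IsSquare d) (g : E → ℂ) :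
    ∑ v, g (d * v ^ 2) + ∑ v, g (v ^ 2) = 2 * ∑ s, g s := by
  have hd0 : d ≠ 0 := fun h => hd (h ▸ IsSquare.zero)
  have hchar : ringChar E ≠ 2 := fun h => h2 (by
    have := ringChar.Nat.cast_ringChar (R := E)
    rw [h] at this
    exact_mod_cast this)
  have key : ∀ (e : E), e ≠ 0 → ∑ v, g (e * v ^ 2) = ∑ s, ((quadraticChar E (e⁻¹ * s) + 1 : ℤ) : ℂ) * g s := by
    intro e he
    rw [← Finset.sum_fiberwise (s := Finset.univ) (g := fun v => e * v ^ 2)]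
    refine Finset.sum_congr rfl fun s _ => ?_
    rw [Finset.sum_congr rfl (g := fun _ => g s) (fun v hv => by
      rw [(Finset.mem_filter.1 hv).2]), Finset.sum_const, nsmul_eq_mul]
    congr 1
    have := quadraticChar_card_sqrts hchar (e⁻¹ * s)
    rw [← this]
    norm_cast
    congr 1
    ext v
    simp only [Finset.mem_filter, Finset.mem_univ, true_and, Set.mem_toFinset, Set.mem_ofPred_eq]
    constructor
    · rintro rfl; field_simp
    · intro h; rw [h]; field_simp
  have h1 := key 1 one_ne_zero
  simp only [one_mul, inv_one] at h1
  rw [h1, key d hd0, ← Finset.sum_add_distrib, Finset.mul_sum]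
  refine Finset.sum_congr rfl fun s _ => ?_
  have h3 : quadraticChar E (d⁻¹ * s) = - quadraticChar E s := by
    rw [map_mul]
    have : quadraticChar E d⁻¹ = -1 := by
      rw [quadraticChar_neg_one_iff_not_isSquare]
      rwa [isSquare_inv]
    rw [this, neg_one_mul]
  rw [h3]; push_cast; ring

theorem klSum_quadratic {E : Type*} [Field E] [Fintype E] [DecidableEq E]
    (h2 : (2 : E) ≠ 0) {d : E} (hd : ¬ IsSquare d) {ψ : AddChar E ℂ} (hψ : ψ ≠ 1) {b : E}
    (hb : b ≠ 0) {E' : Type*} [Field E'] [Fintype E'] [DecidableEq E'] (ψ' : AddChar E' ℂ) (b' : E')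
    (e : E' ≃ E × E)
    (he0 : e 0 = 0) (hnorm : ∀ z, (e z).1 ^ 2 - d * (e z).2 ^ 2 = 0 → z = 0)
    (hψ' : ∀ z, z ≠ 0 → ψ' (z + b' * z⁻¹) =
      ψ (2 * (e z).1 * (1 + b * ((e z).1 ^ 2 - d * (e z).2 ^ 2)⁻¹))) :
    klSum ψ' b' = 2 * Fintype.card E - klSum ψ b ^ 2 := by
  rw [eq_sub_iff_add_eq]
  let G : E → E → ℂ := fun u s => if s = 0 then 0 else ψ (2 * u * (1 + b * s⁻¹))
  have h1 : klSum ψ' b' = ∑ u, ∑ v, G u (u ^ 2 - d * v ^ 2) := by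
    rw [klSum, ← Fintype.sum_prod_type', ← e.sum_comp]
    refine Finset.sum_congr rfl fun z _ => ?_
    by_cases hz : z = 0
    · subst hz; simp [he0, G]
    · have : (e z).1 ^ 2 - d * (e z).2 ^ 2 ≠ 0 := fun h => hz (hnorm z h)
      simp only [G, if_neg hz, if_neg this, hψ' z hz]
  have h2' : klSum ψ b ^ 2 = ∑ u, ∑ v, G u (u ^ 2 - v ^ 2) := by
    rw [sq, klSum, Finset.sum_mul_sum, ← Fintype.sum_prod_type', ← Fintype.sum_prod_type']
    symm
    let φ : E × E ≃ E × E :=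
      { toFun := fun w => (w.1 + w.2, w.1 - w.2)
        invFun := fun w => ((w.1 + w.2) / 2, (w.1 - w.2) / 2)
        left_inv := fun w => by ext <;> simp <;> field_simp <;> ring
        right_inv := fun w => by ext <;> simp <;> field_simp <;> ring }
    refine Fintype.sum_equiv φ _ _ fun w => ?_
    obtain ⟨u, v⟩ := w
    simp only [φ, Equiv.coe_fn_mk, G]
    by_cases hx : u + v = 0
    · rw [if_pos hx, zero_mul, if_pos (by linear_combination (u - v) * hx)]
    by_cases hy : u - v = 0
    · rw [if_pos hy, mul_zero, if_pos (by linear_combination (u + v) * hy)]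
    have hxy : u ^ 2 - v ^ 2 ≠ 0 := by
      rw [show u ^ 2 - v ^ 2 = (u + v) * (u - v) by ring]; exact mul_ne_zero hx hy
    rw [if_neg hx, if_neg hy, if_neg hxy, ← AddChar.map_add_eq_mul]
    congr 1
    rw [show u ^ 2 - v ^ 2 = (u + v) * (u - v) by ring]
    field_simp
    ring
  rw [h1, h2', ← Finset.sum_add_distrib]
  simp_rw [fun u => sum_sq_add_sum_nonsquare_mul_sq h2 hd (fun s => G u (u ^ 2 - s))]
  rw [← Finset.mul_sum]
  congr 1
  have h3 : ∀ u, ∑ s, G u (u ^ 2 - s) = ∑ s, G u s := fun u =>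
    Fintype.sum_equiv (Equiv.subLeft (u ^ 2)) _ _ (fun s => rfl)
  simp_rw [h3]
  rw [Finset.sum_comm, Finset.sum_eq_single (-b)]
  · have : ∀ u, G u (-b) = 1 := by
      intro u
      simp only [G, neg_eq_zero, if_neg hb]
      rw [inv_neg, mul_neg, mul_inv_cancel₀ hb]; simp
    simp [this]
  · intro s _ hs
    by_cases hs0 : s = 0
    · simp [G, hs0]
    simp only [G, if_neg hs0]
    have h4 : 2 * (1 + b * s⁻¹) ≠ 0 := by
      refine mul_ne_zero h2 fun h => hs ?_
      field_simp at h
      linear_combination h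
    have := AddChar.sum_mulShift (R := E) (2 * (1 + b * s⁻¹)) (ψ := ψ)
      (AddChar.IsPrimitive.of_ne_one hψ)
    rw [if_neg h4] at this
    refine Eq.trans ?_ (this.trans Nat.cast_zero)
    refine Finset.sum_congr rfl fun u _ => ?_
    congr 1; ring
  · simp

open Polynomial in
theorem card_nonsquare_artinSchreier_le {F : Type*} [Field F] [Fintype F] [DecidableEq F] {p : ℕ}
    [hp : Fact p.Prime] [CharP F p] (hp2 : p ≠ 2)
    (n : ℕ) (hcard : Fintype.card F = (p ^ n) ^ 2) {b : F} (hb : b ≠ 0) :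
    2 * (Finset.univ.filter fun y : F => ¬ IsSquare ((y ^ p - y) ^ 2 - 4 * b)).card
      ≤ (p ^ n) ^ 2 + (8 * p + 8) * p ^ n := by
  have hpodd : Odd p := hp.out.odd_of_ne_two hp2
  have h2 : (2 : F) ≠ 0 := by
    have := CharP.cast_eq_zero_iff F p 2
    intro h
    have h' := this.1 (by exact_mod_cast h)
    exact hp2 ((Nat.prime_dvd_prime_iff_eq hp.out Nat.prime_two).1 h')
  have hchar : ringChar F ≠ 2 := by rw [ringChar.eq F p]; exact hp2
  obtain ⟨d, hd⟩ := FiniteField.exists_nonsquare hchar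
  have hd0 : d ≠ 0 := fun h => hd (h ▸ IsSquare.zero)
  let g : F[X] := X ^ p - X
  have hg1 : g.natDegree = p := FiniteField.X_pow_card_sub_X_natDegree_eq F hp.out.one_lt
  have hdeg : (C d * (g ^ 2 - C (4 * b))).natDegree = 2 * p := by
    rw [natDegree_C_mul hd0, natDegree_sub_C, natDegree_pow, hg1]
  have h4b : 4 * b ≠ 0 := mul_ne_zero (by
    rw [show (4 : F) = 2 * 2 by norm_num]; exact mul_ne_zero h2 h2) hb
  have hsep : (C d * (g ^ 2 - C (4 * b))).Separable := by
    have hder : derivative (C d * (g ^ 2 - C (4 * b))) = C (-2 * d) * g := by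
      simp only [g, derivative_mul, derivative_C, zero_mul, zero_add, derivative_sub,
        derivative_pow, derivative_X, CharP.cast_eq_zero, Nat.cast_ofNat, map_mul, map_neg]
      simp
      ring
    refine ⟨C (-(d * (4 * b))⁻¹), C (-2 * d)⁻¹ * C (d * (d * (4 * b))⁻¹) * g, ?_⟩
    rw [hder]
    have e1 : C (-2 * d)⁻¹ * C (-2 * d) = (1 : F[X]) := by
      rw [← C_mul, inv_mul_cancel₀ (mul_ne_zero (neg_ne_zero.2 h2) hd0), C_1]
    have e2 : C (d * (d * (4 * b))⁻¹) * C (4 * b) = (1 : F[X]) := by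
      rw [← C_mul, show d * (d * (4 * b))⁻¹ * (4 * b) = d * (4 * b) * (d * (4 * b))⁻¹ by ring,
        mul_inv_cancel₀ (mul_ne_zero hd0 h4b), C_1]
    rw [C_neg, C_mul (a := d)] at *
    linear_combination (C d * C ((d * (4 * b))⁻¹) * g * g) * e1 + e2
  have key := card_isSquare_eval_le n hpodd.pow hcard hsep.squarefree (by
      rw [hdeg]; exact Nat.mul_pos two_pos hp.out.pos)
    ?_ (Finset.univ.filter fun y : F => ¬ IsSquare ((y ^ p - y) ^ 2 - 4 * b)) ?_
  · rw [hdeg] at key; linarith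
  · simpa [g, hp.out.ne_zero, hd0] using h4b
  · intro x hx
    have hx := (Finset.mem_filter.1 hx).2
    simp only [g, eval_mul, eval_C, eval_sub, eval_pow, eval_X]
    have hx0 : (x ^ p - x) ^ 2 - 4 * b ≠ 0 := fun h => hx (h ▸ IsSquare.zero)
    rw [← quadraticChar_one_iff_isSquare (mul_ne_zero hd0 hx0), map_mul,
      quadraticChar_neg_one_iff_not_isSquare.2 hx, quadraticChar_neg_one_iff_not_isSquare.2 hd]
    norm_num

open Polynomial in
theorem card_artinSchreier_fiber {E : Type*} [Field E] [Fintype E] [DecidableEq E] {p : ℕ}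
    [hp : Fact p.Prime] [CharP E p] (τ : E →+ ZMod p) (hτ0 : τ ≠ 0) (hτ : ∀ x, τ (x ^ p) = τ x)
    (w : E) : (Finset.univ.filter fun y : E => y ^ p - y = w).card = if τ w = 0 then p else 0 := by
  let L : E →+ E := (frobenius E p : E →+ E) - AddMonoidHom.id E
  have hL : ∀ y, L y = y ^ p - y := fun y => rfl
  have hle : L.range ≤ τ.ker := by
    rintro _ ⟨y, rfl⟩
    rw [AddMonoidHom.mem_ker, hL, map_sub, hτ, sub_self]
  have hker : Nat.card L.ker ≤ p := by
    have h1 := FiniteField.X_pow_card_sub_X_natDegree_eq E hp.out.one_lt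
    have h0 := FiniteField.X_pow_card_sub_X_ne_zero E hp.out.one_lt
    rw [Nat.card_eq_fintype_card, Fintype.card_subtype]
    refine le_trans (Finset.card_le_card (t := (X ^ p - X : E[X]).roots.toFinset) ?_)
      ((Multiset.toFinset_card_le _).trans ((card_roots' _).trans h1.le))
    intro y hy
    have hy : y ^ p - y = 0 := (Finset.mem_filter.1 hy).2
    simp [h0, hy]
  have hτr : τ.range = ⊤ := by
    obtain ⟨x, hx⟩ := DFunLike.ne_iff.1 hτ0
    simp only [AddMonoidHom.zero_apply] at hx
    rw [AddMonoidHom.range_eq_top]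
    intro y
    refine ⟨((y * (τ x)⁻¹).val : ℕ) • x, ?_⟩
    rw [map_nsmul, nsmul_eq_mul, ZMod.natCast_zmod_val, mul_assoc, inv_mul_cancel₀ hx, mul_one]
  have c1 : Nat.card L.range * Nat.card L.ker = Nat.card E := by
    rw [mul_comm, ← AddSubgroup.index_ker, AddSubgroup.card_mul_index]
  have c2 : p * Nat.card τ.ker = Nat.card E := by
    rw [← AddSubgroup.card_mul_index τ.ker, AddSubgroup.index_ker, hτr, mul_comm]
    simp
  have hpos : 0 < Nat.card E := Nat.card_pos
  have c3 : Nat.card L.range ≤ Nat.card τ.ker := AddSubgroup.card_le_of_le hle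
  have hkp : Nat.card L.ker = p := by
    refine le_antisymm hker ?_
    have : Nat.card τ.ker * p ≤ Nat.card τ.ker * Nat.card L.ker := by
      rw [mul_comm, c2, ← c1]; exact Nat.mul_le_mul_right _ c3
    exact Nat.le_of_mul_le_mul_left this Nat.card_pos
  have hrange : L.range = τ.ker := by
    refine AddSubgroup.eq_of_le_of_card_ge hle ?_
    rw [hkp, ← c2, mul_comm] at c1
    exact (Nat.eq_of_mul_eq_mul_left hp.out.pos c1).ge
  split_ifs with h
  · have hw : w ∈ L.range := by rw [hrange]; exact h
    obtain ⟨y0, rfl⟩ := hw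
    refine Eq.trans ?_ hkp
    rw [Nat.card_eq_fintype_card, Fintype.card_subtype]
    refine Finset.card_bij' (fun y _ => y - y0) (fun y _ => y + y0) ?_ ?_ ?_ ?_
    · intro y hy
      have hy : L y = L y0 := (Finset.mem_filter.1 hy).2
      simp [AddMonoidHom.mem_ker, hy]
    · intro y hy
      have hy : L y = 0 := (Finset.mem_filter.1 hy).2
      simp only [Finset.mem_filter, Finset.mem_univ, true_and]
      rw [← hL, map_add, hy, zero_add]
    · simp
    · simp
  · rw [Finset.card_eq_zero, Finset.filter_eq_empty_iff]
    rintro y - rfl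
    exact h (hle ⟨y, rfl⟩)

/-- The additive character `x ↦ e(t τ(x) / p)`. -/
noncomputable def traceChar {E : Type*} [Field E] {p : ℕ} [NeZero p] (τ : E →+ ZMod p)
    (t : ZMod p) : AddChar E ℂ := ((ZMod.stdAddChar (N := p)).mulShift t).compAddMonoidHom τ

theorem traceChar_apply {E : Type*} [Field E] {p : ℕ} [NeZero p] (τ : E →+ ZMod p)
    (t : ZMod p) (x : E) : traceChar τ t x = ZMod.stdAddChar (t * τ x) := rfl

theorem exists_le_sum_klSum {E : Type*} [Field E] [Fintype E] [DecidableEq E] {p : ℕ}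
    [hp : Fact p.Prime] [CharP E p] (hp2 : p ≠ 2) (n : ℕ) (hcard : Fintype.card E = (p ^ n) ^ 2)
    (τ : E →+ ZMod p) (hτ0 : τ ≠ 0) (hτ : ∀ x, τ (x ^ p) = τ x) {b : E} (hb : b ≠ 0) :
    ∃ M : ℕ, ∑ t, klSum (traceChar τ t) b = M ∧
      (p ^ n) ^ 2 ≤ M + (8 * p + 8) * p ^ n + 4 * p := by
  have h2 : (2 : E) ≠ 0 := by
    have := CharP.cast_eq_zero_iff E p 2
    intro h
    have h' := this.1 (by exact_mod_cast h)
    exact hp2 ((Nat.prime_dvd_prime_iff_eq hp.out Nat.prime_two).1 h')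
  let N : E → ℕ := fun y => (Finset.univ.filter fun x : E => x ≠ 0 ∧ y ^ p - y = x + b * x⁻¹).card
  refine ⟨∑ y, N y, ?_, ?_⟩
  · simp only [klSum]
    rw [Finset.sum_comm]
    have h1 : ∀ x : E, (∑ t : ZMod p, if x = 0 then (0 : ℂ) else traceChar τ t (x + b * x⁻¹)) =
        ∑ y : E, if x ≠ 0 ∧ y ^ p - y = x + b * x⁻¹ then 1 else 0 := by
      intro x
      by_cases hx : x = 0
      · simp [hx]
      have h3 := card_artinSchreier_fiber τ hτ0 hτ (x + b * x⁻¹)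
      simp only [hx, if_false, ne_eq, not_false_eq_true, true_and, traceChar_apply]
      rw [AddChar.sum_mulShift (τ (x + b * x⁻¹)) (ZMod.isPrimitive_stdAddChar p),
        Finset.sum_boole, h3]
      simp
    simp_rw [h1]
    rw [Finset.sum_comm]
    push_cast [N]
    simp_rw [Finset.sum_boole]
  · have hS := card_nonsquare_artinSchreier_le (F := E) hp2 n hcard hb
    set S := Finset.univ.filter fun y : E => ¬ IsSquare ((y ^ p - y) ^ 2 - 4 * b) with hSdef
    set Z := Finset.univ.filter fun y : E => (y ^ p - y) ^ 2 - 4 * b = 0 with hZdef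
    have hfib : ∀ w : E, (Finset.univ.filter fun y : E => y ^ p - y = w).card ≤ p := by
      intro w
      rw [card_artinSchreier_fiber τ hτ0 hτ w]; split_ifs <;> simp
    have hZ : Z.card ≤ 2 * p := by
      rcases Z.eq_empty_or_nonempty with h | ⟨y0, hy0⟩
      · simp [h]
      have hy0 : (y0 ^ p - y0) ^ 2 - 4 * b = 0 := (Finset.mem_filter.1 hy0).2
      refine (Finset.card_le_card (t := (Finset.univ.filter fun y : E => y ^ p - y = y0 ^ p - y0) ∪
        (Finset.univ.filter fun y : E => y ^ p - y = -(y0 ^ p - y0))) ?_).trans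
        ((Finset.card_union_le _ _).trans ?_)
      · intro y hy
        have hy : (y ^ p - y) ^ 2 - 4 * b = 0 := (Finset.mem_filter.1 hy).2
        have : (y ^ p - y) ^ 2 = (y0 ^ p - y0) ^ 2 := by linear_combination hy - hy0
        simpa using sq_eq_sq_iff_eq_or_eq_neg.1 this
      · rw [two_mul]; exact add_le_add (hfib _) (hfib _)
    have hN : ∀ y, y ∉ S ∪ Z → 2 ≤ N y := by
      intro y hy
      simp only [hSdef, hZdef, Finset.mem_union, Finset.mem_filter, Finset.mem_univ, true_and,
        not_or, not_not] at hy
      obtain ⟨⟨s, hs⟩, h0⟩ := hy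
      have hs0 : s ≠ 0 := by rintro rfl; apply h0; rw [hs]; ring
      set w := y ^ p - y with hw
      have hx : ∀ e : E, e ^ 2 = 1 → (w + e * s) / 2 ≠ 0 ∧
          w = (w + e * s) / 2 + b * ((w + e * s) / 2)⁻¹ := by
        intro e he
        have hm : (w + e * s) * (w - e * s) = 4 * b := by linear_combination hs - s ^ 2 * he
        have hne : w + e * s ≠ 0 := by
          intro h
          rw [h, zero_mul] at hm
          have : (2 : E) * 2 * b = 0 := by linear_combination -hm
          simp [h2, hb] at this
        refine ⟨div_ne_zero hne h2, ?_⟩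
        field_simp
        linear_combination hm
      have h1 := hx 1 (by ring)
      have h3 := hx (-1) (by ring)
      have hne : (w + 1 * s) / 2 ≠ (w + -1 * s) / 2 := by
        intro h
        field_simp at h
        have : 2 * s = 0 := by linear_combination h
        simp [h2, hs0] at this
      rw [← Finset.card_pair hne]
      apply Finset.card_le_card
      intro x hx
      simp only [Finset.mem_insert, Finset.mem_singleton] at hx
      simp only [Finset.mem_filter, Finset.mem_univ, true_and]
      rcases hx with rfl | rfl
      · exact h1
      · exact h3
    have h5 : 2 * (Finset.univ \ (S ∪ Z)).card ≤ ∑ y, N y := by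
      rw [mul_comm, ← smul_eq_mul]
      refine (Finset.card_nsmul_le_sum _ _ _ fun y hy => hN y (Finset.mem_sdiff.1 hy).2).trans ?_
      exact Finset.sum_le_sum_of_subset (Finset.subset_univ _)
    have h6 : (Finset.univ \ (S ∪ Z)).card + (S ∪ Z).card = (p ^ n) ^ 2 := by
      rw [Finset.card_sdiff_add_card_eq_card (Finset.subset_univ _), Finset.card_univ, hcard]
    have h7 := Finset.card_union_le S Z
    linarith

theorem klSum_traceChar_zero {E : Type*} [Field E] [Fintype E] [DecidableEq E] {p : ℕ}
    [NeZero p] (τ : E →+ ZMod p) (b : E) : klSum (traceChar τ 0) b = Fintype.card E - 1 := by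
  simp only [klSum, traceChar_apply, zero_mul, AddChar.map_zero_eq_one]
  rw [← Finset.sum_erase_add _ _ (Finset.mem_univ (0 : E)), if_pos rfl, add_zero,
    Finset.sum_congr rfl (g := fun _ => (1 : ℂ)) (fun x hx => if_neg (Finset.ne_of_mem_erase hx))]
  rw [Finset.sum_const, Finset.card_erase_of_mem (Finset.mem_univ _), Finset.card_univ,
    nsmul_eq_mul, mul_one, Nat.cast_sub Fintype.card_pos, Nat.cast_one]

theorem traceChar_ne_one {E : Type*} [Field E] {p : ℕ} [hp : Fact p.Prime] {τ : E →+ ZMod p}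
    (hτ : τ ≠ 0) {t : ZMod p} (ht : t ≠ 0) : traceChar τ t ≠ 1 := by
  obtain ⟨x, hx⟩ := DFunLike.ne_iff.1 hτ
  intro h
  have := DFunLike.congr_fun h x
  rw [traceChar_apply, AddChar.one_apply, ← AddChar.map_zero_eq_one (ZMod.stdAddChar (N := p))] at this
  exact mul_ne_zero ht hx (ZMod.injective_stdAddChar this)

/-- Finite fields of order `p ^ 2 ^ k` with a Frobenius-invariant functional whose Kloosterman
sums evolve under `r ↦ r ^ 2 - 2`. -/
theorem exists_klSum_tower (p : ℕ) [hp : Fact p.Prime] (hp2 : p ≠ 2) (b : ℕ) (hb : ¬ p ∣ b)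
    (R : ZMod p → ℝ)
    (hR : ∀ t, t ≠ 0 → klSum (traceChar (AddMonoidHom.id (ZMod p)) t) (b : ZMod p) =
      -(√p * R t : ℝ)) (k : ℕ) :
    ∃ (E : Type) (_ : Field E) (_ : Fintype E) (_ : DecidableEq E) (τ : E →+ ZMod p),
      CharP E p ∧ Fintype.card E = p ^ 2 ^ k ∧ τ ≠ 0 ∧ (∀ x, τ (x ^ p) = τ x) ∧
      ∀ t, t ≠ 0 → klSum (traceChar τ t) (b : E) =
        -(√(p ^ 2 ^ k) * (fun r : ℝ => r ^ 2 - 2)^[k] (R t) : ℝ) := by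
  induction k with
  | zero =>
    refine ⟨ZMod p, inferInstance, inferInstance, inferInstance, AddMonoidHom.id _, inferInstance,
      by simp [ZMod.card], ?_, by simp [ZMod.pow_card], by simpa using hR⟩
    intro h
    have := DFunLike.congr_fun h 1
    simp at this
  | succ k ih =>
    obtain ⟨E, _, _, _, τ, hchar, hcard, hτ0, hτ, hK⟩ := ih
    have hpodd : Odd p := hp.out.odd_of_ne_two hp2
    have h2 : (2 : E) ≠ 0 := by
      have := CharP.cast_eq_zero_iff E p 2
      intro h
      have h' := this.1 (by exact_mod_cast h)
      exact hp2 ((Nat.prime_dvd_prime_iff_eq hp.out Nat.prime_two).1 h')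
    have hbE : (b : E) ≠ 0 := fun h => hb ((CharP.cast_eq_zero_iff E p b).1 h)
    obtain ⟨d, hd⟩ := FiniteField.exists_nonsquare (F := E) (by rw [ringChar.eq E p]; exact hp2)
    have : Fact (∀ r : E, r ^ 2 ≠ d + 0 * r) := ⟨fun r h => hd ⟨r, by
      rw [← sq, h]; ring⟩⟩
    let e : QuadraticAlgebra E d 0 ≃ E × E := QuadraticAlgebra.equivProd d 0
    have he : ∀ z, e z = (z.re, z.im) := fun z => rfl
    let _ : Fintype (QuadraticAlgebra E d 0) := Fintype.ofEquiv _ e.symm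
    let _ : DecidableEq (QuadraticAlgebra E d 0) := Classical.decEq _
    let τ' : QuadraticAlgebra E d 0 →+ ZMod p :=
      { toFun := fun z => τ (2 * z.re)
        map_zero' := by simp
        map_add' := fun x y => by simp [mul_add] }
    have hchar' : CharP (QuadraticAlgebra E d 0) p :=
      charP_of_injective_algebraMap (algebraMap E (QuadraticAlgebra E d 0)).injective p
    have hcard' : Fintype.card (QuadraticAlgebra E d 0) = p ^ 2 ^ (k + 1) := by
      rw [Fintype.ofEquiv_card, Fintype.card_prod, hcard, ← pow_add, ← two_mul, pow_succ']
    refine ⟨QuadraticAlgebra E d 0, inferInstance, inferInstance, inferInstance, τ', hchar',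
      hcard', ?_, ?_, ?_⟩
    · obtain ⟨x, hx⟩ := DFunLike.ne_iff.1 hτ0
      refine DFunLike.ne_iff.2 ⟨⟨x / 2, 0⟩, ?_⟩
      simp only [τ', AddMonoidHom.coe_mk, ZeroHom.coe_mk]
      rwa [mul_div_cancel₀ _ h2]
    · intro z
      simp only [τ', AddMonoidHom.coe_mk, ZeroHom.coe_mk]
      have h3 : (z ^ p).re = z.re ^ p := by
        obtain ⟨m, hm⟩ := hpodd
        have hz : z = algebraMap E _ z.re + algebraMap E _ z.im * ⟨0, 1⟩ := by
          ext <;> simp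
        have hω : (⟨0, 1⟩ : QuadraticAlgebra E d 0) ^ p = algebraMap E _ (d ^ m) * ⟨0, 1⟩ := by
          rw [hm, pow_succ, pow_mul, map_pow]
          congr 2
          ext <;> simp [sq]
        have hzp : z ^ p = algebraMap E _ (z.re ^ p) +
            algebraMap E _ (z.im ^ p) * (algebraMap E _ (d ^ m) * ⟨0, 1⟩) := by
          conv_lhs => rw [hz, add_pow_char, mul_pow, hω, ← map_pow, ← map_pow]
        rw [hzp]
        simp [-map_pow]
      rw [h3, ← hτ (2 * z.re), mul_pow]
      congr 2
      simpa [frobenius_def] using (map_natCast (frobenius E p) 2).symm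
    · intro t ht
      have key := klSum_quadratic h2 hd (traceChar_ne_one hτ0 ht) hbE (traceChar τ' t)
        (b : QuadraticAlgebra E d 0) e rfl ?_ ?_
      · rw [key, hK t ht, hcard, Function.iterate_succ_apply']
        have hs : √((p : ℝ) ^ 2 ^ (k + 1)) = (p : ℝ) ^ 2 ^ k := by
          rw [pow_succ, pow_mul, Real.sqrt_sq (by positivity)]
        have hs2 : √((p : ℝ) ^ 2 ^ k) ^ 2 = (p : ℝ) ^ 2 ^ k := Real.sq_sqrt (by positivity)
        rw [hs]
        have hs3 : ((√((p : ℝ) ^ 2 ^ k) : ℝ) : ℂ) ^ 2 = (p : ℂ) ^ 2 ^ k := by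
          exact_mod_cast congrArg (fun r : ℝ => (r : ℂ)) hs2
        push_cast
        linear_combination -((((fun r : ℝ => r ^ 2 - 2)^[k] (R t) : ℝ) : ℂ)) ^ 2 * hs3
      · intro z hz
        rw [← QuadraticAlgebra.norm_eq_zero_iff_eq_zero, QuadraticAlgebra.norm_def]
        simp only [he] at hz
        linear_combination hz
      · intro z hz
        simp only [traceChar_apply, τ', AddMonoidHom.coe_mk, ZeroHom.coe_mk, he]
        congr 3
        have : z.re ^ 2 - d * z.im ^ 2 = QuadraticAlgebra.norm z := by
          rw [QuadraticAlgebra.norm_def]; ring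
        rw [this]
        simp [QuadraticAlgebra.inv_def]
        ring

/-! ### Weil's bound for Kloosterman sums modulo a prime -/

theorem norm_klSum_le {p : ℕ} [hp : Fact p.Prime] (hp2 : p ≠ 2) {b t : ZMod p} (hb : b ≠ 0)
    (ht : t ≠ 0) : ‖klSum (traceChar (AddMonoidHom.id (ZMod p)) t) b‖ ≤ 2 * √p := by
  obtain ⟨b, rfl⟩ := ZMod.natCast_zmod_surjective b
  have hb : ¬ p ∣ b := fun h => hb ((CharP.cast_eq_zero_iff (ZMod p) p b).2 h)
  have hp0 : (0 : ℝ) < p := by exact_mod_cast hp.out.pos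
  have hsp : (√p : ℝ) ≠ 0 := (Real.sqrt_pos.2 hp0).ne'
  set K := fun t => klSum (traceChar (AddMonoidHom.id (ZMod p)) t) (b : ZMod p) with hKdef
  have hreal : ∀ t, ((K t).re : ℂ) = K t := by
    intro t
    rw [← Complex.conj_eq_iff_re]
    simp only [hKdef, klSum, map_sum]
    refine Fintype.sum_equiv (Equiv.neg (ZMod p)) _ _ fun x => ?_
    by_cases hx : x = 0
    · simp [hx]
    · simp only [Equiv.neg_apply, neg_eq_zero, hx, if_false, inv_neg, mul_neg, ← neg_add]
      rw [AddChar.map_neg_eq_conj]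
  let R : ZMod p → ℝ := fun t => -(K t).re / √p
  have hR : ∀ t, K t = -(√p * R t : ℝ) := by
    intro t
    rw [← hreal t, ← Complex.ofReal_neg]
    congr 1
    simp only [R]; field_simp
  have htower := exists_klSum_tower p hp2 b hb R (fun t _ => hR t)
  have hbound : ∀ k, (fun r : ℝ => r ^ 2 - 2)^[k + 1] (R t) ≤ 14 * p + 8 := by
    intro k
    obtain ⟨E, _, _, _, τ, hchar, hcard, hτ0, hτ, hK⟩ := htower (k + 1)
    have hbE : (b : E) ≠ 0 := fun h => hb ((CharP.cast_eq_zero_iff E p b).1 h)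
    obtain ⟨M, hM1, hM2⟩ := exists_le_sum_klSum hp2 (2 ^ k)
      (by rw [hcard, ← pow_mul, pow_succ]) τ hτ0 hτ hbE
    set y := fun t => (fun r : ℝ => r ^ 2 - 2)^[k + 1] (R t) with hy
    have hs : √((p : ℝ) ^ 2 ^ (k + 1)) = (p : ℝ) ^ 2 ^ k := by
      rw [pow_succ, pow_mul, Real.sqrt_sq (by positivity)]
    have hpk : p ≤ p ^ 2 ^ k := Nat.le_self_pow (by positivity) p
    set r := p ^ 2 ^ k with hr
    have hrr : ((p : ℝ) ^ 2 ^ k) = (r : ℝ) := by rw [hr]; push_cast; rfl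
    rw [hs, hrr] at hK
    have hr0 : (0 : ℝ) < r := by rw [← hrr]; positivity
    rw [← Finset.sum_erase_add _ _ (Finset.mem_univ (0 : ZMod p)), klSum_traceChar_zero,
      Finset.sum_congr rfl (fun t ht => hK t (Finset.ne_of_mem_erase ht)), hcard, pow_succ, pow_mul,
      ← hr] at hM1
    have hM3 : (∑ t ∈ Finset.univ.erase 0, -((r : ℝ) * y t)) + ((r : ℝ) ^ 2 - 1) = M := by
      exact_mod_cast hM1
    have hM2' : ((r : ℝ)) ^ 2 ≤ M + (8 * p + 8) * r + 4 * p := by exact_mod_cast hM2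
    have hylow : ∀ t, -2 ≤ y t := by
      intro t
      simp only [hy, Function.iterate_succ_apply']
      nlinarith [sq_nonneg ((fun r : ℝ => r ^ 2 - 2)^[k] (R t))]
    have hsum : y t + (-2) * ((p : ℝ) - 1) ≤ ∑ t ∈ Finset.univ.erase 0, y t + 2 * 1 := by
      rw [← Finset.add_sum_erase _ _ (Finset.mem_erase.2 ⟨ht, Finset.mem_univ t⟩)]
      have h1 := Finset.card_nsmul_le_sum ((Finset.univ.erase (0 : ZMod p)).erase t) y (-2)
        (fun t _ => hylow t)
      rw [Finset.card_erase_of_mem (Finset.mem_erase.2 ⟨ht, Finset.mem_univ t⟩),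
        Finset.card_erase_of_mem (Finset.mem_univ _), Finset.card_univ, ZMod.card, nsmul_eq_mul] at h1
      have h2 : ((p - 1 - 1 : ℕ) : ℝ) = (p : ℝ) - 2 := by
        have := hp.out.two_le
        rw [Nat.sub_sub, Nat.cast_sub this]; norm_num
      rw [h2] at h1
      linarith
    rw [Finset.sum_neg_distrib, ← Finset.mul_sum] at hM3
    have hpr : (p : ℝ) ≤ r := by exact_mod_cast hpk
    change y t ≤ _
    have h1 : (r : ℝ) * (∑ t ∈ Finset.univ.erase 0, y t) ≤ r * (12 * p + 8) := by
      have : (4 : ℝ) * p ≤ 4 * p * r := by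
        have : (1 : ℝ) ≤ r := by exact_mod_cast (Nat.one_le_pow _ _ hp.out.pos)
        nlinarith
      nlinarith
    have h2 := le_of_mul_le_mul_left h1 hr0
    linarith
  have habs : |R t| ≤ 2 := by
    by_contra! hcon
    set δ := R t ^ 2 - 4 with hδ
    have hδ0 : 0 < δ := by
      have := sq_abs (R t)
      nlinarith
    have hgrow : ∀ k : ℕ, 2 + (k + 1) * δ ≤ (fun r : ℝ => r ^ 2 - 2)^[k + 1] (R t) := by
      intro k
      induction k with
      | zero => simp [hδ]; linarith
      | succ k ih =>
        rw [Function.iterate_succ_apply']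
        push_cast
        have : 0 ≤ (k : ℝ) * δ := by positivity
        nlinarith
    obtain ⟨k, hk⟩ := exists_nat_gt ((14 * p + 8) / δ)
    rw [div_lt_iff₀ hδ0] at hk
    have := hgrow k
    have := hbound k
    nlinarith
  change ‖K t‖ ≤ _
  rw [hR t, norm_neg, Complex.norm_real, norm_mul, Real.norm_eq_abs, Real.norm_eq_abs,
    abs_of_nonneg (Real.sqrt_nonneg _), mul_comm]
  gcongr

/-! ### Poisson summation for periodic weights -/

theorem summable_gaussian_int {a : ℂ} (ha : 0 < a.re) (b : ℂ) :
    Summable fun n : ℤ => cexp (-Real.pi * a * n ^ 2 + 2 * Real.pi * b * n) := by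
  have h := (summable_jacobiTheta₂_term_iff (-I * b) (I * a)).2 (by simpa using ha)
  refine h.congr fun n => ?_
  rw [jacobiTheta₂_term]
  congr 1
  ring_nf
  rw [I_sq]
  ring

theorem summable_mul_of_finite_left {ι α : Type*} [Finite ι] (g : ι → ℂ) (u : α → ι) {f : α → ℂ}
    (hf : Summable f) : Summable fun n => g (u n) * f n := by
  obtain ⟨C, hC⟩ := Set.finite_range (fun i => ‖g i‖) |>.bddAbove
  refine Summable.of_norm_bounded (hf.norm.mul_left C) fun n => ?_
  rw [norm_mul]
  exact mul_le_mul_of_nonneg_right (hC ⟨u n, rfl⟩) (norm_nonneg _)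

theorem summable_zmod_gaussian {N : ℕ} [NeZero N] (g : ZMod N → ℂ) {a : ℂ} (ha : 0 < a.re)
    (b : ℂ) : Summable fun n : ℤ => g n * cexp (-Real.pi * a * n ^ 2 + 2 * Real.pi * b * n) :=
  summable_mul_of_finite_left g (fun n : ℤ => (n : ZMod N)) (summable_gaussian_int ha b)

theorem sum_fin_natCast_zmod {N : ℕ} [NeZero N] {M : Type*} [AddCommMonoid M] (F : ZMod N → M) :
    ∑ r : Fin N, F ((r : ℕ) : ZMod N) = ∑ r, F r := by
  obtain _ | n := N
  · exact absurd rfl (NeZero.ne 0)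
  · refine Fintype.sum_congr _ _ fun r => ?_
    congr 1
    exact Fin.cast_val_eq_self r

theorem tsum_int_eq_sum_residue {N : ℕ} [NeZero N] {f : ℤ → ℂ} (hf : Summable f) :
    ∑' n, f n = ∑ r : Fin N, ∑' m : ℤ, f (m * N + r) := by
  rw [← (Int.divModEquiv N).symm.tsum_eq, ← (Equiv.prodComm (Fin N) ℤ).tsum_eq]
  have h := (Equiv.prodComm (Fin N) ℤ).summable_iff.2 ((Int.divModEquiv N).symm.summable_iff.2 hf)
  refine (Summable.tsum_prod h).trans ?_
  rw [tsum_fintype]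
  rfl

/-- The discrete Fourier transform with positive sign. -/
noncomputable def zmodFourier {N : ℕ} [NeZero N] (g : ZMod N → ℂ) (h : ZMod N) : ℂ :=
  ∑ r, g r * ZMod.stdAddChar (r * h)

theorem summable_gaussian_shift {a : ℂ} (ha : 0 < a.re) (b : ℂ) :
    Summable fun n : ℤ => cexp (-Real.pi / a * (n + I * b) ^ 2) := by
  have ha' : 0 < (1 / a).re := by
    have h0 : a ≠ 0 := by rintro rfl; simp at ha
    rw [one_div, inv_re]
    exact div_pos ha (normSq_pos.2 h0)
  have h := (summable_gaussian_int ha' (-I * b / a)).mul_left (cexp (Real.pi * b ^ 2 / a))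
  refine h.congr fun n => ?_
  rw [← Complex.exp_add]
  congr 1
  ring_nf
  rw [I_sq]
  ring

/-- Poisson summation for a Gaussian twisted by a periodic function. -/
theorem tsum_zmod_gaussian {N : ℕ} [NeZero N] (g : ZMod N → ℂ) {a : ℂ} (ha : 0 < a.re) (b : ℂ) :
    ∑' n : ℤ, g n * cexp (-Real.pi * a * n ^ 2 + 2 * Real.pi * b * n) =
      1 / (N * a ^ (1 / 2 : ℂ)) *
        ∑' h : ℤ, zmodFourier g h * cexp (-Real.pi / (a * N ^ 2) * (h + I * (b * N)) ^ 2) := by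
  have hN : (0 : ℝ) < N := by exact_mod_cast NeZero.pos N
  have hNc : (N : ℂ) ≠ 0 := by exact_mod_cast hN.ne'
  have ha0 : a ≠ 0 := by rintro rfl; simp at ha
  have haN : 0 < (a * N ^ 2).re := by
    have : (a * N ^ 2) = ((N ^ 2 : ℝ) : ℂ) * a := by push_cast; ring
    rw [this, re_ofReal_mul]; positivity
  have hsum := summable_zmod_gaussian g ha b
  rw [tsum_int_eq_sum_residue (N := N) hsum]
  have hterm : ∀ r : Fin N, ∑' m : ℤ, g ((m * N + r : ℤ) : ZMod N) *
      cexp (-Real.pi * a * (m * N + r : ℤ) ^ 2 + 2 * Real.pi * b * (m * N + r : ℤ)) =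
      1 / (N * a ^ (1 / 2 : ℂ)) * ∑' h : ℤ, (g ((r : ℕ) : ZMod N) * ZMod.stdAddChar (((r : ℕ) : ZMod N) * (h : ZMod N))) *
        cexp (-Real.pi / (a * N ^ 2) * (h + I * (b * N)) ^ 2) := by
    intro r
    have h1 : ∀ m : ℤ, g ((m * N + r : ℤ) : ZMod N) *
      cexp (-Real.pi * a * (m * N + r : ℤ) ^ 2 + 2 * Real.pi * b * (m * N + r : ℤ)) =
        (g ((r : ℕ) : ZMod N) * cexp (-Real.pi * a * r ^ 2 + 2 * Real.pi * b * r)) *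
        cexp (-Real.pi * (a * N ^ 2) * m ^ 2 + 2 * Real.pi * (b * N - a * N * r) * m) := by
      intro m
      push_cast
      rw [ZMod.natCast_self, mul_zero, zero_add, mul_assoc (g _), ← Complex.exp_add]
      congr 2
      ring
    simp_rw [h1]
    rw [tsum_mul_left, Complex.tsum_exp_neg_quadratic haN]
    have hpow : (a * N ^ 2) ^ (1 / 2 : ℂ) = N * a ^ (1 / 2 : ℂ) := by
      have h3 : (a * N ^ 2) = ((N ^ 2 : ℝ) : ℂ) * a := by push_cast; ring
      rw [h3, cpow_def_of_ne_zero (by rw [← h3]; exact mul_ne_zero ha0 (pow_ne_zero 2 hNc)), cpow_def_of_ne_zero ha0,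
        log_ofReal_mul (by positivity) ha0, add_mul, Complex.exp_add, Real.log_pow]
      congr 1
      rw [show (((2 : ℕ) * Real.log N : ℝ) : ℂ) * (1 / 2) = (Real.log N : ℝ) by push_cast; ring,
        ← ofReal_exp, Real.exp_log hN, ofReal_natCast]
    rw [hpow, mul_left_comm, ← tsum_mul_left]
    congr 1
    refine tsum_congr fun h => ?_
    have h2 : ZMod.stdAddChar (((r : ℕ) : ZMod N) * (h : ZMod N)) = cexp (2 * Real.pi * I * (r * h) / N) := by
      have := ZMod.stdAddChar_coe (N := N) ((r : ℕ) * h)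
      push_cast at this ⊢
      exact this
    rw [h2, mul_assoc (g _), mul_assoc (g _), ← Complex.exp_add, ← Complex.exp_add]
    congr 2
    field_simp
    ring_nf
    simp only [I_sq]
    ring
  rw [Finset.sum_congr rfl fun r _ => hterm r, ← Finset.mul_sum]
  congr 1
  have hs : ∀ r : Fin N, Summable fun h : ℤ => (g ((r : ℕ) : ZMod N) * ZMod.stdAddChar (((r : ℕ) : ZMod N) * (h : ZMod N))) *
        cexp (-Real.pi / (a * N ^ 2) * (h + I * (b * N)) ^ 2) := fun r =>
    summable_mul_of_finite_left (fun h : ZMod N => g ((r : ℕ) : ZMod N) * ZMod.stdAddChar (((r : ℕ) : ZMod N) * h))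
      (fun h : ℤ => (h : ZMod N)) (summable_gaussian_shift haN (b * N))
  rw [← Summable.tsum_finsetSum fun r _ => hs r]
  refine tsum_congr fun h => ?_
  rw [← Finset.sum_mul, sum_fin_natCast_zmod (fun r : ZMod N => g r * ZMod.stdAddChar (r * (h : ZMod N)))]
  rfl

open Filter Topology in
theorem tendsto_sqrt_mul_tsum_gaussian {N : ℕ} [NeZero N] (g : ZMod N → ℂ) {ι : Type*}
    {l : Filter ι} [l.IsCountablyGenerated] {a : ι → ℂ} (ha : ∀ᶠ i in l, 0 < (a i).re)
    (hlim : Tendsto (fun i => (1 / a i).re) l atTop) :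
    Tendsto (fun i => a i ^ (1 / 2 : ℂ) * ∑' n : ℤ, g n * cexp (-Real.pi * a i * n ^ 2)) l
      (𝓝 (1 / N * ∑ r, g r)) := by
  have hN : (0 : ℝ) < N := by exact_mod_cast NeZero.pos N
  have h1 : Tendsto (fun i => 1 / (N : ℂ) * ∑' h : ℤ, zmodFourier g h *
      cexp (-Real.pi / N ^ 2 * h ^ 2 * (1 / a i))) l
      (𝓝 (1 / N * ∑' h : ℤ, if h = 0 then zmodFourier g 0 else 0)) := by
    refine Tendsto.const_mul _ ?_
    have hnorm : ∀ (i : ι) (h : ℤ), ‖zmodFourier g h * cexp (-Real.pi / N ^ 2 * h ^ 2 * (1 / a i))‖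
        = ‖zmodFourier g h‖ * Real.exp (-Real.pi / N ^ 2 * h ^ 2 * (1 / a i).re) := by
      intro i h
      rw [norm_mul, Complex.norm_exp]
      congr 2
      rw [show (-Real.pi / N ^ 2 * h ^ 2 : ℂ) = ((-Real.pi / N ^ 2 * h ^ 2 : ℝ) : ℂ) by push_cast; ring,
        re_ofReal_mul]
    refine tendsto_tsum_of_dominated_convergence
      (bound := fun h : ℤ => ‖zmodFourier g h * cexp (-Real.pi / N ^ 2 * h ^ 2)‖) ?_ ?_ ?_
    · have := (summable_zmod_gaussian (zmodFourier g) (a := ((1 / N ^ 2 : ℝ) : ℂ)) (by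
        rw [ofReal_re]; positivity) 0).norm
      refine this.congr fun h => ?_
      congr 3
      push_cast
      ring
    · intro h
      by_cases h0 : h = 0
      · subst h0
        simpa using tendsto_const_nhds
      · rw [if_neg h0]
        rw [tendsto_zero_iff_norm_tendsto_zero]
        simp_rw [hnorm]
        rw [← mul_zero ‖zmodFourier g h‖]
        refine Tendsto.const_mul _ (Real.tendsto_exp_atBot.comp ?_)
        refine hlim.const_mul_atTop_of_neg ?_
        have : (0 : ℝ) < (h : ℝ) ^ 2 := by positivity
        have hpi := Real.pi_pos
        rw [neg_div, neg_mul, neg_lt_zero]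
        positivity
    · filter_upwards [hlim.eventually_ge_atTop 1] with i hi h
      rw [hnorm, norm_mul, Complex.norm_exp]
      refine mul_le_mul_of_nonneg_left (Real.exp_le_exp.2 ?_) (norm_nonneg _)
      rw [show (-Real.pi / N ^ 2 * h ^ 2 : ℂ) = ((-Real.pi / N ^ 2 * h ^ 2 : ℝ) : ℂ) by push_cast; ring,
        ofReal_re]
      have : 0 ≤ Real.pi / N ^ 2 * h ^ 2 := by positivity
      rw [neg_div, neg_mul]
      nlinarith
  rw [tsum_ite_eq] at h1
  have h2 : zmodFourier g 0 = ∑ r, g r := by simp [zmodFourier]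
  rw [h2] at h1
  refine h1.congr' ?_
  filter_upwards [ha] with i hi
  have ha0 : a i ≠ 0 := by intro h; simp [h] at hi
  have := tsum_zmod_gaussian g hi 0
  simp only [mul_zero, zero_mul, add_zero] at this
  rw [this, ← mul_assoc]
  congr 1
  · rw [← div_eq_mul_one_div, div_mul_eq_div_div_swap, div_self (by simp [cpow_eq_zero_iff, ha0])]
  · refine tsum_congr fun h => ?_
    congr 2
    field_simp

open Filter Topology in
/-- The sign of the quadratic Gauss sum, for odd modulus. -/
theorem sum_stdAddChar_sq {N : ℕ} [NeZero N] (hodd : Odd N) :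
    ∑ r : ZMod N, ZMod.stdAddChar (r ^ 2) = (√N : ℝ) * (if N % 4 = 1 then 1 else I) := by
  have hN : (0 : ℝ) < N := by exact_mod_cast NeZero.pos N
  have hNc : (N : ℂ) ≠ 0 := by exact_mod_cast hN.ne'
  set G := ∑ r : ZMod N, ZMod.stdAddChar (r ^ 2) with hG
  have hpos : ∀ᶠ ε : ℝ in 𝓝[>] 0, 0 < ε := eventually_mem_nhdsWithin
  have L1 : Tendsto (fun ε : ℝ => (ε : ℂ) ^ (1 / 2 : ℂ) * ∑' n : ℤ, (ZMod.stdAddChar ((n : ZMod N) ^ 2)) *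
      cexp (-Real.pi * (ε : ℂ) * n ^ 2)) (𝓝[>] 0) (𝓝 (1 / N * G)) := by
    refine tendsto_sqrt_mul_tsum_gaussian (fun r : ZMod N => ZMod.stdAddChar (r ^ 2)) ?_ ?_
    · filter_upwards [hpos] with ε hε; simpa using hε
    · refine tendsto_inv_nhdsGT_zero.congr' ?_
      filter_upwards with ε
      rw [one_div, ← ofReal_inv, ofReal_re]
  let a : ℝ → ℂ := fun ε => ε - 2 * I / N
  let δ : ℝ → ℂ := fun ε => -(I * N * ε / 2) / a ε
  have hare : ∀ ε, (a ε).re = ε := by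
    intro ε
    have : a ε = (ε : ℂ) + ((-2 / N : ℝ) : ℂ) * I := by simp only [a]; push_cast; ring
    rw [this]; simp
  have ha0 : ∀ ε, 0 < ε → a ε ≠ 0 := fun ε hε h => by
    have := hare ε; rw [h] at this; simp at this; linarith
  have hδinv : ∀ ε, 0 < ε → 1 / δ ε = 2 * I / N + 4 / (N ^ 2 * ε) := by
    intro ε hε
    have := ha0 ε hε
    have hε' : (ε : ℂ) ≠ 0 := by exact_mod_cast hε.ne'
    simp only [δ]
    field_simp
    simp only [a]
    field_simp
    ring_nf
    simp only [I_sq]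
    ring
  have hδre : ∀ ε, 0 < ε → (1 / δ ε).re = 4 / (N ^ 2 * ε) := by
    intro ε hε
    rw [hδinv ε hε]
    have : (2 * I / N + 4 / (N ^ 2 * ε) : ℂ) = ((2 / N : ℝ) : ℂ) * I + ((4 / (N ^ 2 * ε) : ℝ) : ℂ) := by
      push_cast; ring
    rw [this, add_re, ofReal_re, re_ofReal_mul, I_re, mul_zero, zero_add]
  have hδpos : ∀ ε, 0 < ε → 0 < (δ ε).re := by
    intro ε hε
    have h1 := hδre ε hε
    rw [one_div, inv_re] at h1
    by_contra! hcon
    have : (δ ε).re / normSq (δ ε) ≤ 0 := div_nonpos_of_nonpos_of_nonneg hcon (normSq_nonneg _)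
    rw [h1] at this
    have : 0 < 4 / ((N : ℝ) ^ 2 * ε) := by positivity
    linarith
  let g2 : ZMod 2 → ℂ := fun r => if r = 0 then 1 else (-I) ^ N
  have L2 : Tendsto (fun ε : ℝ => δ ε ^ (1 / 2 : ℂ) * ∑' n : ℤ, g2 n *
      cexp (-Real.pi * δ ε * n ^ 2)) (𝓝[>] 0) (𝓝 (1 / (2 : ℕ) * ∑ r, g2 r)) := by
    refine tendsto_sqrt_mul_tsum_gaussian g2 ?_ ?_
    · filter_upwards [hpos] with ε hε using hδpos ε hε
    · have : Tendsto (fun ε : ℝ => 4 / (N : ℝ) ^ 2 * ε⁻¹) (𝓝[>] 0) atTop :=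
        tendsto_inv_nhdsGT_zero.const_mul_atTop (by positivity)
      refine this.congr' ?_
      filter_upwards [hpos] with ε hε
      rw [hδre ε hε]; field_simp
  have hg2 : ∑ r, g2 r = 1 + (-I) ^ N := by
    rw [show (Finset.univ : Finset (ZMod 2)) = {0, 1} from rfl, Finset.sum_pair (by decide)]
    simp [g2]
  have hcont : Tendsto a (𝓝[>] 0) (𝓝 (-(2 * I / N))) := by
    have : Continuous a := by fun_prop
    have h := this.tendsto 0
    simp only [a, ofReal_zero, zero_sub] at h
    exact h.mono_left nhdsWithin_le_nhds
  have hratio : Tendsto (fun ε => -(I * N / 2) / a ε) (𝓝[>] 0) (𝓝 (((N : ℝ) ^ 2 / 4 : ℝ) : ℂ)) := by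
    have h := (tendsto_const_nhds (x := -(I * N / 2))).div hcont (by simp [hNc])
    have e : (-(I * N / 2)) / (-(2 * I / N)) = (((N : ℝ) ^ 2 / 4 : ℝ) : ℂ) := by
      push_cast
      field_simp
      norm_num
    rw [e] at h
    exact h
  have hs1 : Tendsto (fun ε => (-(I * N / 2) / a ε) ^ (1 / 2 : ℂ)) (𝓝[>] 0) (𝓝 (N / 2)) := by
    have h := hratio.cpow (tendsto_const_nhds (x := (1 / 2 : ℂ))) (Or.inl (by
      rw [ofReal_re]; positivity))
    have e : (((N : ℝ) ^ 2 / 4 : ℝ) : ℂ) ^ (1 / 2 : ℂ) = N / 2 := by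
      rw [show (1 / 2 : ℂ) = ((1 / 2 : ℝ) : ℂ) by push_cast; ring, ← ofReal_cpow (by positivity),
        ← Real.sqrt_eq_rpow, show (N : ℝ) ^ 2 / 4 = (N / 2) ^ 2 by ring, Real.sqrt_sq (by positivity)]
      push_cast; ring
    rwa [e] at h
  have hs2 : Tendsto (fun ε => (a ε) ^ (1 / 2 : ℂ)) (𝓝[>] 0) (𝓝 ((√(2 / N) : ℝ) * ((1 - I) / (√2 : ℝ)))) := by
    have h := hcont.cpow (tendsto_const_nhds (x := (1 / 2 : ℂ))) (Or.inr (by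
      have : -(2 * I / N) = ((-(2 / N) : ℝ) : ℂ) * I := by push_cast; ring
      rw [this]; simp [hN.ne']))
    have e : (-(2 * I / N)) ^ (1 / 2 : ℂ) = (√(2 / N) : ℝ) * ((1 - I) / (√2 : ℝ)) := by
      have e1 : -(2 * I / N) = ((2 / N : ℝ) : ℂ) * (-I) := by push_cast; ring
      rw [e1, cpow_def_of_ne_zero (by rw [← e1]; simp [hNc]), log_ofReal_mul (by positivity) (by simp),
        add_mul, Complex.exp_add, log_neg_I]
      congr 1
      · rw [Real.sqrt_eq_rpow, Real.rpow_def_of_pos (by positivity)]; push_cast; rfl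
      · rw [show (-(Real.pi / 2) * I * (1 / 2) : ℂ) = ((-(Real.pi / 4) : ℝ) : ℂ) * I by push_cast; ring,
          exp_mul_I, ← ofReal_cos, ← ofReal_sin, Real.cos_neg, Real.sin_neg, Real.cos_pi_div_four,
          Real.sin_pi_div_four]
        have : ((√2 : ℝ) : ℂ) * (√2 : ℝ) = 2 := by
          rw [← ofReal_mul, Real.mul_self_sqrt (by norm_num)]; norm_num
        have h20 : ((√2 : ℝ) : ℂ) ≠ 0 := by
          intro h0; rw [h0] at this; simp at this
        push_cast
        field_simp
        linear_combination (1 - I) * this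
    rwa [e] at h
  -- the modular transformation
  have key : ∀ ε : ℝ, 0 < ε → (a ε) ^ (1 / 2 : ℂ) * ((-(I * N / 2) / a ε) ^ (1 / 2 : ℂ) *
      ((ε : ℂ) ^ (1 / 2 : ℂ) * ∑' n : ℤ, (ZMod.stdAddChar ((n : ZMod N) ^ 2)) *
      cexp (-Real.pi * (ε : ℂ) * n ^ 2))) = δ ε ^ (1 / 2 : ℂ) * ∑' n : ℤ, g2 n *
      cexp (-Real.pi * δ ε * n ^ 2) := by
    intro ε hε
    have h0 := ha0 ε hε
    have hb0 : -(I * N / 2) / a ε ≠ 0 := div_ne_zero (by simp [hNc]) h0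
    have e1 : δ ε ^ (1 / 2 : ℂ) = (-(I * N / 2) / a ε) ^ (1 / 2 : ℂ) * (ε : ℂ) ^ (1 / 2 : ℂ) := by
      have : δ ε = (ε : ℂ) * (-(I * N / 2) / a ε) := by simp only [δ]; ring
      have hε' : (ε : ℂ) ≠ 0 := by exact_mod_cast hε.ne'
      rw [cpow_def_of_ne_zero (by rw [this]; exact mul_ne_zero hε' hb0), cpow_def_of_ne_zero hb0,
        cpow_def_of_ne_zero hε', this, log_ofReal_mul hε hb0, add_mul, Complex.exp_add,
        ofReal_log hε.le, mul_comm]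
    have e2 : ∑' n : ℤ, (ZMod.stdAddChar ((n : ZMod N) ^ 2)) * cexp (-Real.pi * (ε : ℂ) * n ^ 2) =
        ∑' n : ℤ, cexp (-Real.pi * a ε * n ^ 2) := by
      refine tsum_congr fun n => ?_
      have h2 : ZMod.stdAddChar ((n : ZMod N) ^ 2) = cexp (2 * Real.pi * I * (n ^ 2) / N) := by
        have := ZMod.stdAddChar_coe (N := N) (n ^ 2)
        push_cast at this ⊢
        exact this
      rw [h2, ← Complex.exp_add]
      congr 1
      simp only [a]
      ring
    have e3 : ∑' n : ℤ, cexp (-Real.pi / a ε * n ^ 2) = ∑' n : ℤ, g2 n * cexp (-Real.pi * δ ε * n ^ 2) := by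
      refine tsum_congr fun n => ?_
      have h3 : -Real.pi / a ε * n ^ 2 = -(Real.pi * I * N / 2 * n ^ 2) + (-Real.pi * δ ε * n ^ 2) := by
        simp only [δ]
        field_simp
        simp only [a]
        field_simp
        ring_nf
        simp only [I_sq]
        ring
      rw [h3, Complex.exp_add]
      congr 1
      simp only [g2]
      rcases Int.even_or_odd' n with ⟨m, rfl | rfl⟩
      · have : ((2 * m : ℤ) : ZMod 2) = 0 := by
          push_cast; rw [show (2 : ZMod 2) = 0 from rfl, zero_mul]
        rw [if_pos this, Complex.exp_eq_one_iff]
        exact ⟨-(N * m ^ 2), by push_cast; ring⟩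
      · have : ((2 * m + 1 : ℤ) : ZMod 2) ≠ 0 := by
          push_cast; rw [show (2 : ZMod 2) = 0 from rfl, zero_mul]; decide
        rw [if_neg this]
        have h4 : cexp (-(Real.pi / 2 * I)) = -I := by
          rw [Complex.exp_neg, exp_pi_div_two_mul_I, inv_I]
        rw [← h4, ← Complex.exp_nat_mul, Complex.exp_eq_exp_iff_exists_int]
        exact ⟨-(N * (m ^ 2 + m)), by push_cast; ring⟩
    have h5 := Complex.tsum_exp_neg_quadratic (a := a ε) (by rw [hare]; exact hε) 0
    simp only [mul_zero, zero_mul, add_zero] at h5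
    rw [e2, h5, e3, e1]
    have : a ε ^ (1 / 2 : ℂ) ≠ 0 := by simp [cpow_eq_zero_iff, h0]
    field_simp
  have hlim := tendsto_nhds_unique ((hs2.mul (hs1.mul L1)).congr' (by
    filter_upwards [hpos] with ε hε using key ε hε)) L2
  rw [hg2] at hlim
  have hsN : √(2 / (N : ℝ)) = √2 / √N := Real.sqrt_div (by norm_num) _
  rw [hsN] at hlim
  have hs20 : ((√2 : ℝ) : ℂ) ≠ 0 := by exact_mod_cast (Real.sqrt_pos.2 two_pos).ne'
  have hsN0 : ((√(N : ℝ) : ℝ) : ℂ) ≠ 0 := by exact_mod_cast (Real.sqrt_pos.2 hN).ne'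
  have hmain : (1 - I) * G = (1 + (-I) ^ N) * (√(N : ℝ) : ℝ) := by
    push_cast at hlim
    field_simp at hlim
    linear_combination hlim
  have h1I : (1 - I) ≠ 0 := fun h => by
    have := congrArg Complex.re h; simp at this
  apply mul_left_cancel₀ h1I
  rw [hmain]
  have hI4 : (-I) ^ 4 = (1 : ℂ) := by rw [neg_pow, I_pow_four]; norm_num
  have hNd := Nat.div_add_mod N 4
  have hmod : N % 4 = 1 ∨ N % 4 = 3 := by obtain ⟨m, rfl⟩ := hodd; omega
  rw [← hNd, pow_add, pow_mul, hI4, one_pow, one_mul, hNd]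
  rcases hmod with h | h
  · rw [h, if_pos rfl]; ring
  · rw [h, if_neg (by norm_num), show (-I) ^ 3 = I by rw [neg_pow, I_pow_three]; ring]
    ring_nf
    simp only [I_sq]
    ring

/-! ### Additive characters -/

theorem eN_eq_stdAddChar (N : ℕ) [NeZero N] (x : ℤ) : eN N x = ZMod.stdAddChar (x : ZMod N) :=
  (ZMod.stdAddChar_coe x).symm

theorem eN_add (N : ℕ) (x y : ℤ) : eN N (x + y) = eN N x * eN N y := by
  rw [eN, eN, eN, ← Complex.exp_add]
  congr 1
  push_cast
  ring

theorem eN_zero (N : ℕ) : eN N 0 = 1 := by simp [eN]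

theorem norm_eN (N : ℕ) (x : ℤ) : ‖eN N x‖ = 1 := by
  rw [eN, show (2 * Real.pi * I * x / N : ℂ) = ((2 * Real.pi * x / N : ℝ) : ℂ) * I by push_cast; ring,
    norm_exp_ofReal_mul_I]

theorem eN_mul_left {c : ℕ} (hc : c ≠ 0) (N : ℕ) (x : ℤ) : eN (c * N) (c * x) = eN N x := by
  rw [eN, eN]
  have : (c : ℂ) ≠ 0 := by exact_mod_cast hc
  congr 1
  push_cast
  rw [show (2 * Real.pi * I * (c * x) : ℂ) = c * (2 * Real.pi * I * x) by ring,
    mul_div_mul_left _ _ this]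

theorem eN_congr {N : ℕ} [NeZero N] {x y : ℤ} (h : x ≡ y [ZMOD N]) : eN N x = eN N y := by
  rw [eN_eq_stdAddChar, eN_eq_stdAddChar, (ZMod.intCast_eq_intCast_iff x y N).2 h]

theorem sum_zmod_eq_sum_range {N : ℕ} [NeZero N] {M : Type*} [AddCommMonoid M] (F : ZMod N → M) :
    ∑ r, F r = ∑ i ∈ Finset.range N, F (i : ZMod N) := by
  rw [← sum_fin_natCast_zmod, Fin.sum_univ_eq_sum_range (fun i => F (i : ZMod N))]

theorem sum_range_mul_eq {M : Type*} [AddCommMonoid M] (f : ℕ → M) (m n : ℕ) :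
    ∑ i ∈ Finset.range (m * n), f i = ∑ s ∈ Finset.range m, ∑ t ∈ Finset.range n, f (s + m * t) := by
  rw [Finset.sum_comm]
  induction n with
  | zero => simp
  | succ n ih =>
    rw [Finset.sum_range_succ, ← ih, mul_add, mul_one, Finset.sum_range_add]
    simp [add_comm]

theorem sum_stdAddChar_mul {N : ℕ} [NeZero N] (x : ZMod N) :
    ∑ z : ZMod N, ZMod.stdAddChar (z * x) = if x = 0 then (N : ℂ) else 0 := by
  rw [AddChar.sum_mulShift _ (ZMod.isPrimitive_stdAddChar N), ZMod.card]
  split_ifs <;> simp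

theorem sum_range_eN {N : ℕ} [NeZero N] (x : ℤ) :
    ∑ t ∈ Finset.range N, eN N (x * t) = if (N : ℤ) ∣ x then (N : ℂ) else 0 := by
  have := sum_stdAddChar_mul (x : ZMod N)
  rw [sum_zmod_eq_sum_range] at this
  simp only [← ZMod.intCast_zmod_eq_zero_iff_dvd]
  rw [← this]
  refine Finset.sum_congr rfl fun t _ => ?_
  rw [eN_eq_stdAddChar]
  push_cast
  rw [mul_comm]

/-! ### Quadratic Gauss sums to prime power moduli -/

/-- The quadratic Gauss sum `∑_{y mod N} e_N(A y²)`. -/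
noncomputable def quadGauss (A : ℤ) (N : ℕ) : ℂ := ∑ y ∈ Finset.range N, eN N (A * y ^ 2)

theorem quadGauss_eq (A : ℤ) (N : ℕ) [NeZero N] :
    quadGauss A N = ∑ r : ZMod N, ZMod.stdAddChar ((A : ZMod N) * r ^ 2) := by
  rw [sum_zmod_eq_sum_range, quadGauss]
  refine Finset.sum_congr rfl fun t _ => ?_
  rw [eN_eq_stdAddChar]
  push_cast
  rfl

theorem quadGauss_pow_add_two {p : ℕ} (hp : p.Prime) (hp2 : p ≠ 2) {A : ℤ} (hA : ¬ (p : ℤ) ∣ A)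
    (w : ℕ) : quadGauss A (p ^ (w + 2)) = p * quadGauss A (p ^ w) := by
  have hp0 : p ≠ 0 := hp.ne_zero
  have : NeZero p := ⟨hp0⟩
  have hn (n : ℕ) : NeZero (p ^ n) := ⟨pow_ne_zero n hp0⟩
  have hn2 := hn (w + 2)
  have hpr : Prime (p : ℤ) := Nat.prime_iff_prime_int.1 hp
  have hdvd (s : ℕ) : (p : ℤ) ∣ 2 * A * s ↔ p ∣ s := by
    constructor
    · intro h
      rcases hpr.dvd_or_dvd h with h | h
      · rcases hpr.dvd_or_dvd h with h | h
        · have : p ∣ 2 := by exact_mod_cast h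
          exact absurd ((Nat.prime_dvd_prime_iff_eq hp Nat.prime_two).1 this) hp2
        · exact absurd h hA
      · exact_mod_cast h
    · intro h
      exact Dvd.dvd.mul_left (by exact_mod_cast h) _
  have key (s t : ℕ) : eN (p ^ (w + 2)) (A * ((s + p ^ (w + 1) * t : ℕ) : ℤ) ^ 2) =
      eN (p ^ (w + 2)) (A * s ^ 2) * eN p (2 * A * s * t) := by
    rw [← eN_mul_left (pow_ne_zero (w + 1) hp0) p, ← pow_succ, ← eN_add]
    refine eN_congr ((Int.modEq_iff_dvd).2 ⟨-(A * p ^ w * t ^ 2), ?_⟩)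
    push_cast
    ring
  rw [quadGauss, pow_succ p (w + 1), sum_range_mul_eq, ← pow_succ]
  simp_rw [key, ← Finset.mul_sum, sum_range_eN, hdvd]
  rw [pow_succ' p w, sum_range_mul_eq, quadGauss, Finset.mul_sum]
  rw [Finset.sum_eq_single_of_mem 0 (Finset.mem_range.2 hp.pos)]
  · refine Finset.sum_congr rfl fun t _ => ?_
    rw [zero_add, if_pos (dvd_mul_right p t), mul_comm, ← eN_mul_left (pow_ne_zero 2 hp0) (p ^ w)]
    congr 2
    · ring
    · push_cast; ring
  · intro s hs hs0
    refine Finset.sum_eq_zero fun t _ => ?_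
    rw [if_neg, mul_zero]
    intro h
    rw [Nat.dvd_add_left (dvd_mul_right p t)] at h
    exact hs0 (Nat.eq_zero_of_dvd_of_lt h (Finset.mem_range.1 hs))

theorem quadGauss_prime {p : ℕ} [hp : Fact p.Prime] (hp2 : p ≠ 2) {A : ℤ} (hA : ¬ (p : ℤ) ∣ A) :
    quadGauss A p = legendreSym p A * ((√p : ℝ) * if p % 4 = 1 then 1 else I) := by
  have hA' : (A : ZMod p) ≠ 0 := by rwa [Ne, ZMod.intCast_zmod_eq_zero_iff_dvd]
  have hchar : ringChar (ZMod p) ≠ 2 := by rwa [ZMod.ringChar_zmod_n]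
  have hs (B : ZMod p) (hB : B ≠ 0) : ∑ r : ZMod p, ZMod.stdAddChar (B * r ^ 2) =
      ∑ x : ZMod p, ((quadraticChar (ZMod p) x : ℤ) : ℂ) * ZMod.stdAddChar (B * x) := by
    classical
    have h1 : ∑ r : ZMod p, ZMod.stdAddChar (B * r ^ 2) =
        ∑ x : ZMod p, ((quadraticChar (ZMod p) x + 1 : ℤ) : ℂ) * ZMod.stdAddChar (B * x) := by
      rw [← Finset.sum_fiberwise_of_maps_to (s := Finset.univ) (t := Finset.univ)
        (g := fun r : ZMod p => r ^ 2) (fun _ _ => Finset.mem_univ _)]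
      refine Finset.sum_congr rfl fun x _ => ?_
      rw [Finset.sum_congr rfl (g := fun _ => ZMod.stdAddChar (B * x)), Finset.sum_const,
        nsmul_eq_mul]
      · congr 1
        rw [← quadraticChar_card_sqrts hchar]
        norm_cast
        congr 1
        ext r
        simp
      · intro r hr
        rw [(Finset.mem_filter.1 hr).2]
    rw [h1]
    push_cast
    simp_rw [add_mul, one_mul, Finset.sum_add_distrib]
    rw [add_eq_left]
    simp_rw [mul_comm B]
    rw [sum_stdAddChar_mul, if_neg hB]
  have hG := hs 1 one_ne_zero
  simp only [one_mul] at hG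
  rw [sum_stdAddChar_sq (hp.1.odd_of_ne_two hp2)] at hG
  rw [quadGauss_eq, hs _ hA', hG, Finset.mul_sum]
  conv_rhs => rw [← Equiv.sum_comp (Equiv.mulLeft₀ _ hA')]
  refine Finset.sum_congr rfl fun x _ => ?_
  rw [Equiv.mulLeft₀_apply, map_mul (quadraticChar (ZMod p)), legendreSym]
  have : ((quadraticChar (ZMod p) A : ℤ) : ℂ) * (quadraticChar (ZMod p) A : ℤ) = 1 := by
    have := quadraticChar_sq_one hA'
    exact_mod_cast (by rw [← sq]; exact this)
  push_cast
  linear_combination (-((quadraticChar (ZMod p) x : ℤ) : ℂ) * ZMod.stdAddChar ((A : ZMod p) * x)) * this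

theorem quadGauss_primePow {p : ℕ} (hp : p.Prime) (hp2 : p ≠ 2) {A : ℤ} (hA : ¬ (p : ℤ) ∣ A)
    (w : ℕ) : quadGauss A (p ^ w) =
      jacobiSym A (p ^ w) * ((√((p : ℝ) ^ w) : ℝ) * if p ^ w % 4 = 1 then 1 else I) := by
  have : Fact p.Prime := ⟨hp⟩
  have hodd := hp.odd_of_ne_two hp2
  induction w using Nat.strong_induction_on with
  | _ w ih =>
    match w with
    | 0 => simp [quadGauss, eN_zero]
    | 1 =>
      rw [pow_one, pow_one, quadGauss_prime hp2 hA, jacobiSym.legendreSym.to_jacobiSym]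
    | w + 2 =>
      rw [quadGauss_pow_add_two hp hp2 hA, ih w (by omega)]
      have h1 : jacobiSym A (p ^ (w + 2)) = jacobiSym A (p ^ w) := by
        rw [jacobiSym.pow_right, jacobiSym.pow_right, pow_add, ← jacobiSym.legendreSym.to_jacobiSym,
          legendreSym.sq_one p (by rwa [Ne, ZMod.intCast_zmod_eq_zero_iff_dvd]), mul_one]
      have h2 : p ^ (w + 2) % 4 = p ^ w % 4 := by
        have : p ^ 2 % 4 = 1 := by
          have : p % 4 = 1 ∨ p % 4 = 3 := by obtain ⟨m, rfl⟩ := hodd; omega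
          rcases this with h | h <;> rw [Nat.pow_mod, h]
        rw [pow_add, Nat.mul_mod, this, mul_one, Nat.mod_mod]
      have h3 : √((p : ℝ) ^ (w + 2)) = p * √((p : ℝ) ^ w) := by
        rw [pow_add, mul_comm, Real.sqrt_mul (by positivity), Real.sqrt_sq (by positivity)]
      rw [h1, h2, h3]
      push_cast
      ring

/-! ### Complete exponential sums with inverses -/

theorem zmod_primePow_isUnit_iff {p w : ℕ} [hp : Fact p.Prime] (hw : w ≠ 0) (x : ZMod (p ^ w)) :
    IsUnit x ↔ ZMod.castHom (dvd_pow_self p hw) (ZMod p) x ≠ 0 := by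
  have : NeZero (p ^ w) := ⟨pow_ne_zero w hp.1.ne_zero⟩
  obtain ⟨n, rfl⟩ := ZMod.natCast_zmod_surjective x
  rw [ZMod.isUnit_iff_coprime, map_natCast, Ne, ZMod.natCast_eq_zero_iff,
    Nat.coprime_pow_right_iff (Nat.pos_of_ne_zero hw), Nat.coprime_comm, hp.1.coprime_iff_not_dvd]

theorem zmod_primePow_cast_pow_eq_zero {p w n : ℕ} (h : w ≤ n) : (p : ZMod (p ^ w)) ^ n = 0 := by
  rw [← Nat.cast_pow, ZMod.natCast_eq_zero_iff]
  exact pow_dvd_pow p h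

theorem zmod_primePow_cast_pow_ne_zero {p w n : ℕ} (hp : p.Prime) (h : n < w) :
    (p : ZMod (p ^ w)) ^ n ≠ 0 := by
  rw [← Nat.cast_pow, Ne, ZMod.natCast_eq_zero_iff, Nat.pow_dvd_pow_iff_le_right hp.one_lt]
  omega

open Finset in
theorem card_pow_mul_eq_zero_le {p w m : ℕ} [hp : Fact p.Prime] [NeZero (p ^ w)] (h : m ≤ w) :
    #{d : ZMod (p ^ w) | (p : ZMod (p ^ w)) ^ m * d = 0} ≤ p ^ m := by
  classical
  have hd (d : ZMod (p ^ w)) (h0 : (p : ZMod (p ^ w)) ^ m * d = 0) : p ^ (w - m) ∣ d.val := by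
    rw [← ZMod.natCast_zmod_val d, ← Nat.cast_pow, ← Nat.cast_mul, ZMod.natCast_eq_zero_iff] at h0
    have h1 : p ^ m * p ^ (w - m) ∣ p ^ m * d.val := by
      rwa [← pow_add, Nat.add_sub_cancel' h]
    exact Nat.dvd_of_mul_dvd_mul_left (pow_pos hp.1.pos m) h1
  calc _ ≤ #(range (p ^ m)) := by
        refine card_le_card_of_injOn (fun d => d.val / p ^ (w - m)) ?_ ?_
        · intro d _
          simp only [coe_range, Set.mem_Iio]
          rw [Nat.div_lt_iff_lt_mul (pow_pos hp.1.pos _), ← pow_add, Nat.add_sub_cancel' h]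
          exact ZMod.val_lt d
        · intro d hd1 e he h1
          simp only [coe_filter, mem_univ, true_and, Set.mem_ofPred_eq] at hd1 he
          have h2 := hd d hd1
          have h3 := hd e he
          apply ZMod.val_injective
          rw [← Nat.div_mul_cancel h2, ← Nat.div_mul_cancel h3]
          exact congrArg (· * p ^ (w - m)) h1
    _ = p ^ m := card_range _

open Finset in
theorem card_stationary_le {p w t : ℕ} [hp : Fact p.Prime] [NeZero (p ^ w)] (hp2 : p ≠ 2)
    (htw : t < w) (α : (ZMod (p ^ w))ˣ) (β h : ZMod (p ^ w)) :
    #{u : (ZMod (p ^ w))ˣ | (p : ZMod (p ^ w)) ^ t *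
      (α * u + 2 * p * β * u ^ 2 - h * ↑u⁻¹) = 0} ≤ 2 * p ^ t := by
  classical
  have hw : w ≠ 0 := by omega
  set π := ZMod.castHom (dvd_pow_self p hw) (ZMod p) with hπ
  have hπp : π p = 0 := by simp
  have hunit (x : (ZMod (p ^ w))ˣ) : π x ≠ 0 := (zmod_primePow_isUnit_iff hw _).1 x.isUnit
  have hcancel (x y : ZMod (p ^ w)) (hx : π x ≠ 0) (h0 : (p : ZMod (p ^ w)) ^ t * (y * x) = 0) :
      (p : ZMod (p ^ w)) ^ t * y = 0 := by
    rw [← mul_assoc] at h0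
    exact ((zmod_primePow_isUnit_iff hw x).2 hx).mul_left_eq_zero.1 h0
  set S := ({u : (ZMod (p ^ w))ˣ | (p : ZMod (p ^ w)) ^ t *
      (α * u + 2 * p * β * u ^ 2 - h * ↑u⁻¹) = 0} : Finset (ZMod (p ^ w))ˣ) with hS
  have hdiff (u v : (ZMod (p ^ w))ˣ) (hu : u ∈ S) (hv : v ∈ S) : (p : ZMod (p ^ w)) ^ t *
      ((u - v) * (α * (u + v) + 2 * p * β * (u ^ 2 + u * v + v ^ 2))) = 0 := by
    rw [hS, mem_filter] at hu hv
    have h1 : (u : ZMod (p ^ w)) * ↑u⁻¹ = 1 := u.mul_inv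
    have h2 : (v : ZMod (p ^ w)) * ↑v⁻¹ = 1 := v.mul_inv
    linear_combination (u : ZMod (p ^ w)) * hu.2 - (v : ZMod (p ^ w)) * hv.2 +
      (p : ZMod (p ^ w)) ^ t * h * h1 - (p : ZMod (p ^ w)) ^ t * h * h2
  have hA (u v : (ZMod (p ^ w))ˣ) (hu : u ∈ S) (hv : v ∈ S) (huv : π u = π v) :
      (p : ZMod (p ^ w)) ^ t * (u - v) = 0 := by
    refine hcancel _ _ ?_ (hdiff u v hu hv)
    simp only [map_add, map_mul, hπp, mul_zero, zero_mul, add_zero, huv]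
    rw [← two_mul]
    refine mul_ne_zero (hunit α) (mul_ne_zero ?_ (hunit v))
    exact Ring.two_ne_zero (by rwa [ZMod.ringChar_zmod_n])
  have hB (u v : (ZMod (p ^ w))ˣ) (hu : u ∈ S) (hv : v ∈ S) (huv : π u ≠ π v) : π v = - π u := by
    have h1 := hdiff u v hu hv
    rw [mul_comm (_ - _)] at h1
    have h2 := hcancel _ _ (by rw [map_sub]; exact sub_ne_zero.2 huv) h1
    by_contra hcon
    have h3 := hcancel (α * (u + v) + 2 * p * β * (u ^ 2 + u * v + v ^ 2)) 1 (by
      simp only [map_add, map_mul, hπp, mul_zero, zero_mul, add_zero]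
      refine mul_ne_zero (hunit α) fun h0 => hcon ?_
      linear_combination h0) (by rw [one_mul]; exact h2)
    rw [mul_one] at h3
    exact zmod_primePow_cast_pow_ne_zero hp.1 htw h3
  have hC (c : ZMod p) : #(S.filter fun u : (ZMod (p ^ w))ˣ => π u = c) ≤ p ^ t := by
    rcases (S.filter fun u : (ZMod (p ^ w))ˣ => π u = c).eq_empty_or_nonempty with he | ⟨v, hv⟩
    · rw [he]; simp
    · rw [mem_filter] at hv
      refine (card_le_card_of_injOn (fun u : (ZMod (p ^ w))ˣ => (u : ZMod (p ^ w)) - v) ?_ ?_).trans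
        (card_pow_mul_eq_zero_le (m := t) htw.le)
      · intro u hu
        rw [mem_coe, mem_filter] at hu ⊢
        exact ⟨mem_univ _, hA u v hu.1 hv.1 (hu.2.trans hv.2.symm)⟩
      · intro u _ u' _ h
        exact Units.ext (sub_left_injective (b := (v : ZMod (p ^ w))) h)
  rcases S.eq_empty_or_nonempty with he | ⟨v, hv⟩
  · rw [he]; simp
  · calc S.card ≤ ((S.filter fun u : (ZMod (p ^ w))ˣ => π u = π v) ∪
        (S.filter fun u : (ZMod (p ^ w))ˣ => π u = -π v)).card := by
          refine card_le_card fun u hu => ?_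
          by_cases h : π u = π v
          · exact mem_union.2 (Or.inl (mem_filter.2 ⟨hu, h⟩))
          · exact mem_union.2 (Or.inr (mem_filter.2 ⟨hu, hB v u hv hu (Ne.symm h)⟩))
      _ ≤ _ := (card_union_le _ _).trans (by linarith [hC (π v), hC (-π v)])

theorem norm_zmod_stdAddChar {N : ℕ} [NeZero N] (x : ZMod N) : ‖ZMod.stdAddChar x‖ = 1 :=
  AddChar.norm_apply _ _

open Finset in
theorem norm_sum_quadratic_sq_le {N : ℕ} [NeZero N] (X V : ZMod N) :
    ‖∑ z : ZMod N, ZMod.stdAddChar (z * X + z ^ 2 * V)‖ ^ 2 ≤ N * #{d : ZMod N | 2 * d * V = 0} := by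
  classical
  set c := ∑ z : ZMod N, ZMod.stdAddChar (z * X + z ^ 2 * V)
  have h1 : ((‖c‖ ^ 2 : ℝ) : ℂ) = ∑ d : ZMod N, ZMod.stdAddChar (d * X + d ^ 2 * V) *
      ∑ z : ZMod N, ZMod.stdAddChar (z * (2 * d * V)) := by
    rw [← normSq_eq_norm_sq, ← mul_conj]
    simp only [c, map_sum, Finset.sum_mul_sum]
    rw [Finset.sum_comm]
    simp_rw [Finset.mul_sum]
    rw [Finset.sum_comm (s := univ) (t := univ) (f := fun d z => ZMod.stdAddChar (d * X + d ^ 2 * V) *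
      ZMod.stdAddChar (z * (2 * d * V)))]
    refine Finset.sum_congr rfl fun z _ => ?_
    rw [← Equiv.sum_comp (Equiv.addLeft z)]
    refine Finset.sum_congr rfl fun d _ => ?_
    rw [← AddChar.map_neg_eq_conj, ← AddChar.map_add_eq_mul, ← AddChar.map_add_eq_mul]
    congr 1
    simp only [Equiv.coe_addLeft]
    ring
  have h2 : ‖((‖c‖ ^ 2 : ℝ) : ℂ)‖ ≤ N * #{d : ZMod N | 2 * d * V = 0} := by
    rw [h1]
    simp_rw [sum_stdAddChar_mul, mul_ite, mul_zero]
    rw [← Finset.sum_filter]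
    refine (norm_sum_le _ _).trans ?_
    simp_rw [norm_mul, norm_zmod_stdAddChar, one_mul, norm_natCast]
    rw [Finset.sum_const, nsmul_eq_mul, mul_comm]
  rwa [norm_real, Real.norm_of_nonneg (by positivity)] at h2

theorem sum_quadratic_eq_zero {N : ℕ} [NeZero N] {X V v : ZMod N} (hv : v * V = 0) (hX : v * X ≠ 0) :
    ∑ z : ZMod N, ZMod.stdAddChar (z * X + z ^ 2 * V) = 0 := by
  set c := ∑ z : ZMod N, ZMod.stdAddChar (z * X + z ^ 2 * V) with hc
  have h1 (y : ZMod N) : c = ZMod.stdAddChar (y * (v * X)) * c := by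
    rw [hc, Finset.mul_sum]
    conv_lhs => rw [← Equiv.sum_comp (Equiv.addLeft (y * v))]
    refine Finset.sum_congr rfl fun z _ => ?_
    rw [← AddChar.map_add_eq_mul]
    congr 1
    simp only [Equiv.coe_addLeft]
    linear_combination (2 * y * z + y ^ 2 * v) * hv
  have h2 : ∑ y : ZMod N, c = (∑ y : ZMod N, ZMod.stdAddChar (y * (v * X))) * c := by
    rw [Finset.sum_mul]
    exact Finset.sum_congr rfl fun y _ => h1 y
  rw [sum_stdAddChar_mul, if_neg hX, zero_mul, Finset.sum_const, Finset.card_univ, ZMod.card,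
    nsmul_eq_mul] at h2
  have : (N : ℂ) ≠ 0 := by exact_mod_cast NeZero.ne N
  exact (mul_eq_zero.1 h2).resolve_left this

open Finset in
theorem norm_unitSum_le_of_inner {p w s t : ℕ} [hp : Fact p.Prime] [NeZero (p ^ w)] (hp2 : p ≠ 2)
    (hsw : w ≤ 3 * s) (htw : t < w) (α : (ZMod (p ^ w))ˣ) (β h : ZMod (p ^ w)) {B : ℝ}
    (hB0 : 0 ≤ B)
    (hB : ∀ u : (ZMod (p ^ w))ˣ, ‖∑ z : ZMod (p ^ w), ZMod.stdAddChar
      (z * (p ^ s * (α * u + 2 * p * β * u ^ 2 - h * ↑u⁻¹)) +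
        z ^ 2 * (p ^ (2 * s) * (h * ↑u⁻¹ + p * β * u ^ 2)) : ZMod (p ^ w))‖ ≤
      if (p : ZMod (p ^ w)) ^ t * (α * u + 2 * p * β * u ^ 2 - h * ↑u⁻¹) = 0 then B else 0) :
    (p : ℝ) ^ w * ‖∑ u : (ZMod (p ^ w))ˣ, ZMod.stdAddChar
      (α * u + p * β * (u : ZMod (p ^ w)) ^ 2 + h * ↑u⁻¹ : ZMod (p ^ w))‖ ≤ 2 * p ^ t * B := by
  classical
  have h3 : (p : ZMod (p ^ w)) ^ (3 * s) = 0 := zmod_primePow_cast_pow_eq_zero hsw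
  let v (z : ZMod (p ^ w)) : (ZMod (p ^ w))ˣ :=
    ⟨1 + p ^ s * z, 1 - p ^ s * z + p ^ (2 * s) * z ^ 2, by
      linear_combination z ^ 3 * h3, by linear_combination z ^ 3 * h3⟩
  set Φ : (ZMod (p ^ w))ˣ → ℂ := fun u => ZMod.stdAddChar
      (α * u + p * β * (u : ZMod (p ^ w)) ^ 2 + h * ↑u⁻¹ : ZMod (p ^ w)) with hΦ
  have hv (u : (ZMod (p ^ w))ˣ) (z : ZMod (p ^ w)) : Φ (u * v z) = Φ u * ZMod.stdAddChar
      (z * (p ^ s * (α * u + 2 * p * β * u ^ 2 - h * ↑u⁻¹)) +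
        z ^ 2 * (p ^ (2 * s) * (h * ↑u⁻¹ + p * β * u ^ 2)) : ZMod (p ^ w)) := by
    simp only [hΦ]
    rw [← AddChar.map_add_eq_mul]
    congr 1
    rw [mul_inv_rev]
    push_cast
    have e1 : ((v z : (ZMod (p ^ w))ˣ) : ZMod (p ^ w)) = 1 + p ^ s * z := rfl
    have e2 : (((v z)⁻¹ : (ZMod (p ^ w))ˣ) : ZMod (p ^ w)) = 1 - p ^ s * z + p ^ (2 * s) * z ^ 2 := rfl
    rw [e1, e2]
    ring
  have key : (p : ℂ) ^ w * ∑ u, Φ u = ∑ u, Φ u * ∑ z : ZMod (p ^ w), ZMod.stdAddChar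
      (z * (p ^ s * (α * u + 2 * p * β * u ^ 2 - h * ↑u⁻¹)) +
        z ^ 2 * (p ^ (2 * s) * (h * ↑u⁻¹ + p * β * u ^ 2)) : ZMod (p ^ w)) := by
    simp_rw [Finset.mul_sum, ← hv]
    rw [Finset.sum_comm]
    have (z : ZMod (p ^ w)) : ∑ u, Φ (u * v z) = ∑ u, Φ u := Equiv.sum_comp (Equiv.mulRight (v z)) Φ
    simp_rw [this]
    rw [Finset.sum_const, Finset.card_univ, ZMod.card, nsmul_eq_mul]
    push_cast
    rw [← Finset.mul_sum]
  have h4 : (p : ℝ) ^ w * ‖∑ u, Φ u‖ = ‖(p : ℂ) ^ w * ∑ u, Φ u‖ := by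
    rw [norm_mul, norm_pow, Complex.norm_natCast]
  rw [h4, key]
  refine (norm_sum_le _ _).trans ?_
  calc _ ≤ ∑ u : (ZMod (p ^ w))ˣ, if (p : ZMod (p ^ w)) ^ t *
        (α * u + 2 * p * β * u ^ 2 - h * ↑u⁻¹) = 0 then B else 0 := by
        refine Finset.sum_le_sum fun u _ => ?_
        rw [norm_mul, hΦ, norm_zmod_stdAddChar, one_mul]
        exact hB u
    _ ≤ 2 * p ^ t * B := by
        rw [← Finset.sum_filter, Finset.sum_const, nsmul_eq_mul]
        refine mul_le_mul_of_nonneg_right ?_ hB0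
        exact_mod_cast card_stationary_le hp2 htw α β h

open Finset in
theorem norm_unitSum_le {p w : ℕ} [hp : Fact p.Prime] [NeZero (p ^ w)] (hp2 : p ≠ 2)
    (hw : 2 ≤ w) (α : (ZMod (p ^ w))ˣ) (β h : ZMod (p ^ w)) :
    ‖∑ u : (ZMod (p ^ w))ˣ, ZMod.stdAddChar
      (α * u + p * β * (u : ZMod (p ^ w)) ^ 2 + h * ↑u⁻¹ : ZMod (p ^ w))‖ ≤ 2 * √(p ^ w) := by
  have hp0 : (0 : ℝ) < p := by exact_mod_cast hp.1.pos
  have hw0 : w ≠ 0 := by omega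
  rcases Nat.even_or_odd' w with ⟨s, hs | hs⟩
  · have h0 : (p : ZMod (p ^ w)) ^ (2 * s) = 0 := zmod_primePow_cast_pow_eq_zero hs.le
    have := norm_unitSum_le_of_inner hp2 (s := s) (t := s) (by omega) (by omega) α β h
      (B := p ^ w) (by positivity) (fun u => by
        rw [h0]
        simp only [zero_mul, mul_zero, add_zero]
        rw [sum_stdAddChar_mul]
        split_ifs <;> simp)
    have e : √((p : ℝ) ^ w) = p ^ s := by
      rw [hs, mul_comm, pow_mul, Real.sqrt_sq (by positivity)]
    rw [e]
    have h1 : (0 : ℝ) < p ^ w := by positivity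
    nlinarith
  · have h0 : (p : ZMod (p ^ w)) ^ (2 * s + 1) = 0 := zmod_primePow_cast_pow_eq_zero hs.le
    have := norm_unitSum_le_of_inner hp2 (s := s) (t := s + 1) (by omega) (by omega) α β h
      (B := p ^ (2 * s) * √p) (by positivity) (fun u => by
        split_ifs with hT
        · have hTn : ¬ IsUnit (α * u + 2 * p * β * u ^ 2 - h * ↑u⁻¹ : ZMod (p ^ w)) := by
            intro hu
            exact zmod_primePow_cast_pow_ne_zero hp.1 (w := w) (n := s + 1) (by omega)
              (hu.mul_left_eq_zero.1 hT)
          have hU : IsUnit (h * ↑u⁻¹ + p * β * u ^ 2 : ZMod (p ^ w)) := by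
            rw [zmod_primePow_isUnit_iff hw0] at hTn ⊢
            rw [not_not] at hTn
            have hp' : ZMod.castHom (dvd_pow_self p hw0) (ZMod p) p = 0 := by simp
            simp only [map_add, map_sub, map_mul, hp', mul_zero, zero_mul, add_zero] at hTn ⊢
            rw [← sub_eq_zero.1 hTn, ← map_mul]
            exact (zmod_primePow_isUnit_iff hw0 _).1 (α * u).isUnit
          have h2 : IsUnit (2 : ZMod (p ^ w)) := by
            have : ((2 : ℕ) : ZMod (p ^ w)) = 2 := by norm_cast
            rw [← this, ZMod.isUnit_iff_coprime]
            exact Nat.Coprime.pow_right _ ((Nat.coprime_primes Nat.prime_two hp.1).2 (Ne.symm hp2))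
          have h3 := norm_sum_quadratic_sq_le (p ^ s * (α * u + 2 * p * β * u ^ 2 - h * ↑u⁻¹) : ZMod (p ^ w))
            (p ^ (2 * s) * (h * ↑u⁻¹ + p * β * u ^ 2) : ZMod (p ^ w))
          have h4 : #{d : ZMod (p ^ w) | 2 * d * (p ^ (2 * s) * (h * ↑u⁻¹ + p * β * u ^ 2)) = 0} ≤
              p ^ (2 * s) := by
            refine le_trans (card_le_card fun d hd => ?_)
              (card_pow_mul_eq_zero_le (p := p) (w := w) (m := 2 * s) (by omega))
            rw [mem_filter] at hd ⊢
            refine ⟨mem_univ _, ?_⟩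
            have : (p ^ (2 * s) * d : ZMod (p ^ w)) * (2 * (h * ↑u⁻¹ + p * β * u ^ 2)) = 0 := by
              rw [← hd.2]; ring
            exact (h2.mul hU).mul_left_eq_zero.1 this
          refine abs_le_of_sq_le_sq' ?_ (by positivity) |>.2
          refine h3.trans ?_
          rw [mul_pow, Real.sq_sqrt hp0.le]
          calc ((p ^ w : ℕ) : ℝ) * (#{d : ZMod (p ^ w) |
                  2 * d * (p ^ (2 * s) * (h * ↑u⁻¹ + p * β * u ^ 2)) = 0} : ℝ)
              ≤ (p ^ w : ℕ) * (p ^ (2 * s) : ℕ) := by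
                gcongr
            _ = _ := by rw [hs]; push_cast; ring
        · rw [sum_quadratic_eq_zero (v := p), norm_zero]
          · rw [← mul_assoc, ← pow_succ', h0, zero_mul]
          · rw [← mul_assoc, ← pow_succ']; exact hT)
    have e : √((p : ℝ) ^ w) = p ^ s * √p := by
      rw [hs, pow_succ, mul_comm 2, pow_mul, Real.sqrt_mul (by positivity), Real.sqrt_sq (by positivity)]
    rw [e]
    have h1 : (0 : ℝ) < p ^ w := by positivity
    refine le_of_mul_le_mul_left (this.trans (le_of_eq ?_)) h1
    rw [hs]
    ring

open Classical in
theorem norm_invSum_prime_le {p : ℕ} [hp : Fact p.Prime] (hp2 : p ≠ 2) {α : ZMod p} (hα : α ≠ 0)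
    (h : ZMod p) :
    ‖∑ r : ZMod p, (if IsUnit r then ZMod.stdAddChar (α * r⁻¹) else 0) * ZMod.stdAddChar (r * h)‖ ≤
      2 * √p := by
  have hp1 : (1 : ℝ) ≤ √p := by
    rw [Real.one_le_sqrt]; exact_mod_cast hp.1.one_le
  by_cases hh : h = 0
  · subst hh
    have h1 : ∑ r : ZMod p, (if IsUnit r then ZMod.stdAddChar (α * r⁻¹) else 0) *
        ZMod.stdAddChar (r * 0) = -1 := by
      have h2 := sum_stdAddChar_mul α
      rw [if_neg hα, ← Equiv.sum_comp (Equiv.inv (ZMod p))] at h2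
      have h3 : ∀ r : ZMod p, (if IsUnit r then ZMod.stdAddChar (α * r⁻¹) else 0) *
          ZMod.stdAddChar (r * 0) = ZMod.stdAddChar (r⁻¹ * α) - if r = 0 then 1 else 0 := by
        intro r
        by_cases hr : r = 0
        · simp [hr]
        · simp [hr, mul_comm]
      simp_rw [h3, Finset.sum_sub_distrib]
      have h4 : ∑ r : ZMod p, ZMod.stdAddChar (r⁻¹ * α) = 0 := h2
      rw [h4]
      simp
    rw [h1, norm_neg, norm_one]
    linarith
  · have := norm_klSum_le hp2 (b := α / h) (t := h) (div_ne_zero hα hh) hh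
    rw [klSum] at this
    refine le_trans (le_of_eq ?_) this
    congr 1
    refine Finset.sum_congr rfl fun r _ => ?_
    by_cases hr : r = 0
    · simp [hr]
    · rw [if_pos (isUnit_iff_ne_zero.2 hr), if_neg hr, traceChar_apply, ← AddChar.map_add_eq_mul]
      congr 1
      simp only [AddMonoidHom.id_apply]
      field_simp
      ring

open Classical in
theorem norm_invSum_prime_le' {p N : ℕ} [hp : Fact p.Prime] [NeZero N] (hp2 : p ≠ 2) (hN : N = p)
    {α : ZMod N} (hα : IsUnit α) (β h : ZMod N) :
    ‖∑ r : ZMod N, (if IsUnit r then ZMod.stdAddChar (α * r⁻¹ + p * β * r⁻¹ ^ 2 : ZMod N) else 0) *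
      ZMod.stdAddChar (r * h)‖ ≤ 2 * √p := by
  subst hN
  simp only [CharP.cast_eq_zero, zero_mul, add_zero]
  convert norm_invSum_prime_le hp2 hα.ne_zero h

open Classical in
/-- Square root cancellation for Kloosterman-type sums to prime power moduli. -/
theorem norm_invSum_le {p w : ℕ} [hp : Fact p.Prime] [NeZero (p ^ w)] (hp2 : p ≠ 2)
    (hw : w ≠ 0) {α : ZMod (p ^ w)} (hα : IsUnit α) (β h : ZMod (p ^ w)) :
    ‖∑ r : ZMod (p ^ w), (if IsUnit r then ZMod.stdAddChar (α * r⁻¹ + p * β * r⁻¹ ^ 2 : ZMod (p ^ w)) else 0) *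
      ZMod.stdAddChar (r * h)‖ ≤ 2 * √((p : ℝ) ^ w) := by
  obtain rfl | hw1 := eq_or_ne w 1
  · have e : √((p : ℝ) ^ 1) = √p := by rw [pow_one]
    rw [e]
    exact norm_invSum_prime_le' hp2 (pow_one p) hα β h
  · obtain ⟨α, rfl⟩ := hα
    refine le_trans (le_of_eq ?_) (norm_unitSum_le hp2 (by omega) α β h)
    congr 1
    rw [← Equiv.sum_comp (Equiv.inv (ZMod (p ^ w))ˣ)]
    have h1 : ∑ r : ZMod (p ^ w), (if IsUnit r then
        ZMod.stdAddChar ((α : ZMod (p ^ w)) * r⁻¹ + p * β * r⁻¹ ^ 2 : ZMod (p ^ w)) else 0) * ZMod.stdAddChar (r * h) =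
        ∑ r ∈ Finset.univ.filter (fun r : ZMod (p ^ w) => IsUnit r),
        ZMod.stdAddChar ((α : ZMod (p ^ w)) * r⁻¹ + p * β * r⁻¹ ^ 2 : ZMod (p ^ w)) * ZMod.stdAddChar (r * h) := by
      rw [Finset.sum_filter]
      simp_rw [ite_mul, zero_mul]
    rw [h1]
    symm
    refine Finset.sum_bij (fun u _ => (u : ZMod (p ^ w))) (fun u _ => by simp) (fun u _ v _ h => Units.ext h)
      (fun r hr => ?_) (fun u _ => ?_)
    · obtain ⟨u, rfl⟩ := (Finset.mem_filter.1 hr).2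
      exact ⟨u, Finset.mem_univ _, rfl⟩
    · rw [← AddChar.map_add_eq_mul]
      congr 1
      simp only [Equiv.inv_apply, inv_inv]
      have : ((u⁻¹ : (ZMod (p ^ w))ˣ) : ZMod (p ^ w)) = (u : ZMod (p ^ w))⁻¹ := (ZMod.inv_coe_unit u).symm
      rw [this]
      ring

/-! ### The divisor bound -/

theorem card_divisors_le_rpow {ε : ℝ} (hε : 0 < ε) :
    ∃ C : ℝ, 0 < C ∧ ∀ n : ℕ, n ≠ 0 → (n.divisors.card : ℝ) ≤ C * (n : ℝ) ^ ε := by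
  set c : ℝ := min 1 (ε * Real.log 2) with hc
  have hlog : 0 < Real.log 2 := Real.log_pos one_lt_two
  have hc0 : 0 < c := lt_min one_pos (by positivity)
  have hc1 : c ≤ 1 := min_le_left _ _
  obtain ⟨M, hM⟩ := exists_nat_ge ((2 : ℝ) ^ (1 / ε))
  refine ⟨c⁻¹ ^ M, by positivity, fun n hn => ?_⟩
  have hloc (p v : ℕ) (hp : p.Prime) : ((v + 1 : ℕ) : ℝ) ≤
      (if p < M then c⁻¹ else 1) * ((p : ℝ) ^ v) ^ ε := by
    have hp0 : (0 : ℝ) < p := by exact_mod_cast hp.pos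
    have hp2 : (2 : ℝ) ≤ p := by exact_mod_cast hp.two_le
    split_ifs with h
    · rw [inv_mul_eq_div, le_div_iff₀ hc0]
      have h1 : ((2 : ℝ) ^ v) ^ ε ≤ ((p : ℝ) ^ v) ^ ε := by gcongr
      have h2 : ((2 : ℝ) ^ v) ^ ε = Real.exp (v * (ε * Real.log 2)) := by
        rw [Real.rpow_def_of_pos (by positivity), Real.log_pow]
        ring_nf
      have h3 := Real.add_one_le_exp (v * (ε * Real.log 2))
      have h4 : c ≤ ε * Real.log 2 := min_le_right _ _
      have h5 : (v : ℝ) * c ≤ v * (ε * Real.log 2) := by gcongr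
      push_cast
      linarith
    · rw [one_mul]
      have h1 : (2 : ℝ) ≤ (p : ℝ) ^ ε := by
        have : (2 : ℝ) ^ (1 / ε) ≤ p := hM.trans (by exact_mod_cast not_lt.1 h)
        calc (2 : ℝ) = ((2 : ℝ) ^ (1 / ε)) ^ ε := by
              rw [← Real.rpow_mul two_pos.le, one_div_mul_cancel hε.ne', Real.rpow_one]
          _ ≤ _ := by gcongr
      have h2 : ((p : ℝ) ^ v) ^ ε = ((p : ℝ) ^ ε) ^ v := by
        rw [← Real.rpow_natCast, ← Real.rpow_natCast, ← Real.rpow_mul hp0.le, ← Real.rpow_mul hp0.le,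
          mul_comm]
      rw [h2]
      calc ((v + 1 : ℕ) : ℝ) ≤ (2 : ℝ) ^ v := by exact_mod_cast Nat.lt_two_pow_self
        _ ≤ _ := by gcongr
  have hn' : (n : ℝ) ^ ε = ∏ p ∈ n.primeFactors, ((p : ℝ) ^ n.factorization p) ^ ε := by
    rw [Real.finsetProd_rpow _ _ (fun p _ => by positivity)]
    congr 1
    conv_lhs => rw [← Nat.prod_factorization_pow_eq_self hn]
    rw [Finsupp.prod, Nat.support_factorization]
    push_cast
    rfl
  rw [Nat.card_divisors hn, hn']
  push_cast
  calc ∏ p ∈ n.primeFactors, ((n.factorization p : ℝ) + 1)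
      ≤ ∏ p ∈ n.primeFactors, ((if p < M then c⁻¹ else 1) * ((p : ℝ) ^ n.factorization p) ^ ε) := by
        refine Finset.prod_le_prod (fun p _ => by positivity) fun p hp => ?_
        have := hloc p (n.factorization p) (Nat.prime_of_mem_primeFactors hp)
        exact_mod_cast this
    _ = (∏ p ∈ n.primeFactors, if p < M then c⁻¹ else 1) *
        ∏ p ∈ n.primeFactors, ((p : ℝ) ^ n.factorization p) ^ ε := Finset.prod_mul_distrib
    _ ≤ _ := by
        refine mul_le_mul_of_nonneg_right ?_ (Finset.prod_nonneg fun p _ => by positivity)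
        rw [← Finset.prod_filter, Finset.prod_const]
        refine pow_le_pow_right₀ ((one_le_inv₀ hc0).2 hc1) ?_
        calc _ ≤ (Finset.range M).card := Finset.card_le_card fun p hp => by
              rw [Finset.mem_filter] at hp
              exact Finset.mem_range.2 hp.2
          _ = M := Finset.card_range M

/-! ### Theta functions of Dirichlet characters and the central value -/

open MeasureTheory

/-- The linear automorphism `(ξ, η) ↦ (ξ + η, ξ - η)` of the plane. -/
noncomputable def addSubEquiv : (ℝ × ℝ) ≃L[ℝ] (ℝ × ℝ) :=
  LinearEquiv.toContinuousLinearEquiv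
    { toFun := fun z => (z.1 + z.2, z.1 - z.2)
      invFun := fun z => ((z.1 + z.2) / 2, (z.1 - z.2) / 2)
      map_add' := fun x y => by ext <;> simp <;> ring
      map_smul' := fun c x => by ext <;> simp <;> ring
      left_inv := fun z => by ext <;> simp
      right_inv := fun z => by ext <;> simp <;> ring }

theorem addSubEquiv_apply (z : ℝ × ℝ) : addSubEquiv z = (z.1 + z.2, z.1 - z.2) := rfl

theorem det_addSubEquiv : LinearMap.det (addSubEquiv : (ℝ × ℝ) →ₗ[ℝ] (ℝ × ℝ)) = -2 := by
  rw [← LinearMap.det_toMatrix (Module.Basis.finTwoProd ℝ), Matrix.det_fin_two]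
  simp [LinearMap.toMatrix_apply, addSubEquiv_apply]
  norm_num

theorem map_addSubEquiv : Measure.map addSubEquiv (volume : Measure (ℝ × ℝ)) =
    ENNReal.ofReal 2⁻¹ • volume := by
  have := Measure.map_linearMap_addHaar_eq_smul_addHaar (volume : Measure (ℝ × ℝ))
    (f := (addSubEquiv : (ℝ × ℝ) →ₗ[ℝ] (ℝ × ℝ))) (by rw [det_addSubEquiv]; norm_num)
  rw [det_addSubEquiv, show |(-2 : ℝ)⁻¹| = 2⁻¹ by norm_num [abs_of_neg]] at this
  exact this

theorem integrable_comp_addSub {f : ℝ × ℝ → ℂ} (hf : Integrable f) :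
    Integrable fun z : ℝ × ℝ => f (z.1 + z.2, z.1 - z.2) := by
  have h : Integrable f (Measure.map addSubEquiv (volume : Measure (ℝ × ℝ))) := by
    rw [map_addSubEquiv]
    exact hf.smul_measure ENNReal.ofReal_ne_top
  exact h.comp_measurable addSubEquiv.continuous.measurable

theorem integral_comp_addSub (f : ℝ × ℝ → ℂ) :
    ∫ z : ℝ × ℝ, f (z.1 + z.2, z.1 - z.2) = 1 / 2 * ∫ z, f z := by
  have h := addSubEquiv.toHomeomorph.measurableEmbedding.integral_map (μ := volume) f
  have h2 : (⇑addSubEquiv.toHomeomorph : ℝ × ℝ → ℝ × ℝ) = addSubEquiv := rfl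
  rw [h2, map_addSubEquiv, integral_smul_measure] at h
  simp only [addSubEquiv_apply] at h
  rw [← h, ENNReal.toReal_ofReal (by norm_num), Complex.real_smul]
  norm_num

/-- The theta series of a Dirichlet character. -/
noncomputable def charTheta {N : ℕ} (χ : DirichletCharacter ℂ N) (t : ℝ) : ℂ :=
  ∑' n : ℤ, χ n * Real.exp (-Real.pi * (t / N) * n ^ 2)

theorem summable_real_gaussian {c : ℝ} (hc : 0 < c) :
    Summable fun n : ℤ => Real.exp (-Real.pi * c * n ^ 2) := by
  have h := (summable_gaussian_int (a := c) (by simpa using hc) 0).norm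
  refine h.congr fun n => ?_
  rw [mul_zero, zero_mul, add_zero, Complex.norm_exp]
  congr 1
  norm_cast

theorem summable_charTheta {N : ℕ} [NeZero N] (χ : DirichletCharacter ℂ N) {t : ℝ} (ht : 0 < t) :
    Summable fun n : ℤ => χ n * (Real.exp (-Real.pi * (t / N) * n ^ 2) : ℂ) := by
  have hN : (0 : ℝ) < N := by exact_mod_cast NeZero.pos N
  refine Summable.of_norm_bounded (summable_real_gaussian (div_pos ht hN)) fun n => ?_
  rw [norm_mul, norm_real, Real.norm_eq_abs, Real.abs_exp]
  exact mul_le_of_le_one_left (Real.exp_pos _).le (χ.norm_le_one _)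

theorem star_dirichlet {N : ℕ} [NeZero N] (χ : DirichletCharacter ℂ N) (n : ZMod N) :
    (starRingEnd ℂ) (χ n) = χ⁻¹ n := MulChar.star_apply' χ n

/-- The normalised Gauss sum. -/
noncomputable def rootNum {N : ℕ} [NeZero N] (χ : DirichletCharacter ℂ N) : ℂ :=
  gaussSum χ ZMod.stdAddChar / (√N : ℝ)

theorem charTheta_functional {N : ℕ} [NeZero N] {χ : DirichletCharacter ℂ N} (hχ : χ.IsPrimitive)
    {t : ℝ} (ht : 0 < t) :
    charTheta χ t = rootNum χ * (t ^ (-(1 / 2) : ℝ) : ℝ) * (starRingEnd ℂ) (charTheta χ (1 / t)) := by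
  have hN : (0 : ℝ) < N := by exact_mod_cast NeZero.pos N
  have hP := tsum_zmod_gaussian (fun n : ZMod N => χ n) (a := ((t / N : ℝ) : ℂ))
    (by rw [ofReal_re]; positivity) 0
  have h1 : charTheta χ t = ∑' n : ℤ, χ n * cexp (-Real.pi * (t / N : ℝ) * n ^ 2 + 2 * Real.pi * 0 * n) := by
    refine tsum_congr fun n => ?_
    push_cast
    congr 2
    ring
  rw [h1, hP, charTheta, Complex.conj_tsum, ← tsum_mul_left, ← tsum_mul_left]
  refine tsum_congr fun h => ?_
  have h2 : zmodFourier (fun n : ZMod N => χ n) h = χ⁻¹ h * gaussSum χ ZMod.stdAddChar := by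
    rw [← gaussSum_mulShift_of_isPrimitive _ hχ, gaussSum, zmodFourier]
    refine Finset.sum_congr rfl fun r _ => ?_
    rw [AddChar.mulShift_apply, mul_comm r]
  rw [h2, map_mul, star_dirichlet, conj_ofReal, rootNum]
  have h3 : cexp (-Real.pi / ((t / N : ℝ) * N ^ 2) * (h + I * (0 * N)) ^ 2) =
      (Real.exp (-Real.pi * (1 / t / N) * h ^ 2) : ℝ) := by
    push_cast
    congr 1
    have : (t : ℂ) ≠ 0 := by exact_mod_cast ht.ne'
    have : (N : ℂ) ≠ 0 := by exact_mod_cast hN.ne'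
    field_simp
    ring
  have h4 : (1 : ℂ) / (N * ((t / N : ℝ) : ℂ) ^ (1 / 2 : ℂ)) = 1 / (√N : ℝ) * (t ^ (-(1 / 2) : ℝ) : ℝ) := by
    rw [show (1 / 2 : ℂ) = ((1 / 2 : ℝ) : ℂ) by norm_num, ← ofReal_cpow (by positivity)]
    norm_cast
    rw [Real.div_rpow ht.le hN.le, ← Real.sqrt_eq_rpow N, Real.rpow_neg ht.le]
    have h5 := Real.mul_self_sqrt hN.le
    have h6 : 0 < √(N : ℝ) := Real.sqrt_pos.2 hN
    have h7 : 0 < t ^ (1 / 2 : ℝ) := by positivity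
    field_simp
    nlinarith
  rw [h3, h4]
  ring

theorem norm_charTheta_le {N : ℕ} (hN : 1 < N) (χ : DirichletCharacter ℂ N) :
    ∃ C : ℝ, ∀ t : ℝ, 1 ≤ t → ‖charTheta χ t‖ ≤ C * Real.exp (-(Real.pi / N) * t) := by
  have hN0 : (0 : ℝ) < N := by positivity
  let _ : NeZero N := ⟨by omega⟩
  have : Fact (1 < N) := ⟨hN⟩
  set K := ∑' n : ℤ, Real.exp (-Real.pi * (1 / N) * n ^ 2) with hK
  have hs : Summable fun n : ℤ => Real.exp (-Real.pi * (1 / N) * n ^ 2) :=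
    summable_real_gaussian (by positivity)
  refine ⟨Real.exp (Real.pi / N) * K, fun t ht => ?_⟩
  have hb (n : ℤ) : ‖χ n * (Real.exp (-Real.pi * (t / N) * n ^ 2) : ℂ)‖ ≤
      Real.exp (Real.pi / N) * Real.exp (-(Real.pi / N) * t) * Real.exp (-Real.pi * (1 / N) * n ^ 2) := by
    rcases eq_or_ne n 0 with rfl | hn
    · simp only [Int.cast_zero, MulChar.map_zero, zero_mul, norm_zero]
      positivity
    · rw [norm_mul, norm_real, Real.norm_eq_abs, Real.abs_exp, ← Real.exp_add, ← Real.exp_add]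
      refine (mul_le_of_le_one_left (Real.exp_pos _).le (χ.norm_le_one _)).trans
        (Real.exp_le_exp.2 ?_)
      have h1 : (1 : ℝ) ≤ (n : ℝ) ^ 2 := by
        have : (1 : ℤ) ≤ n ^ 2 := Int.add_one_le_iff.2 (sq_pos_of_ne_zero hn)
        exact_mod_cast this
      have h2 : 0 ≤ Real.pi / N * ((t - 1) * ((n : ℝ) ^ 2 - 1)) :=
        mul_nonneg (by positivity) (mul_nonneg (by linarith) (by linarith))
      have h3 : -Real.pi * (t / N) * (n : ℝ) ^ 2 = -(Real.pi / N) * (t * n ^ 2) := by ring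
      have h4 : -Real.pi * (1 / N) * (n : ℝ) ^ 2 = -(Real.pi / N) * n ^ 2 := by ring
      rw [h3, h4]
      nlinarith
  have := tsum_of_norm_bounded (hs.hasSum.mul_left
    (Real.exp (Real.pi / N) * Real.exp (-(Real.pi / N) * t))) hb
  rw [charTheta]
  refine this.trans (le_of_eq ?_)
  rw [hK]
  ring

theorem continuousOn_charTheta {N : ℕ} [NeZero N] (χ : DirichletCharacter ℂ N) :
    ContinuousOn (charTheta χ) (Set.Ioi 0) := by
  have hN : (0 : ℝ) < N := by exact_mod_cast NeZero.pos N
  refine continuousOn_of_forall_continuousAt fun t ht => ?_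
  have ht' : (0 : ℝ) < t := ht
  have hn : Set.Ioi (t / 2) ∈ nhds t := Ioi_mem_nhds (by linarith)
  refine ContinuousOn.continuousAt (s := Set.Ioi (t / 2)) ?_ hn
  have hs : Summable fun n : ℤ => Real.exp (-Real.pi * (t / 2 / N) * n ^ 2) :=
    summable_real_gaussian (by positivity)
  refine continuousOn_tsum (fun n => by fun_prop) hs fun n y hy => ?_
  rw [norm_mul, norm_real, Real.norm_eq_abs, Real.abs_exp]
  refine (mul_le_of_le_one_left (Real.exp_pos _).le (χ.norm_le_one _)).trans
        (Real.exp_le_exp.2 ?_)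
  have : t / 2 / N ≤ y / N := by
    have : t / 2 < y := hy
    gcongr
  have h2 := mul_le_mul_of_nonneg_left this (mul_nonneg Real.pi_pos.le (sq_nonneg (n : ℝ)))
  nlinarith

theorem norm_rootNum_sq_mul_charTheta {N : ℕ} [NeZero N] {χ : DirichletCharacter ℂ N}
    (hχ : χ.IsPrimitive) {t : ℝ} (ht : 0 < t) :
    rootNum χ * (starRingEnd ℂ) (rootNum χ) * charTheta χ t = charTheta χ t := by
  have h1 := charTheta_functional hχ ht
  have h2 := charTheta_functional hχ (one_div_pos.2 ht)
  rw [one_div_one_div] at h2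
  rw [h2, map_mul, map_mul, conj_ofReal, conj_conj, ← mul_assoc] at h1
  conv_rhs => rw [h1]
  have h3 : ((t ^ (-(1 / 2) : ℝ) : ℝ) : ℂ) * (((1 / t) ^ (-(1 / 2) : ℝ) : ℝ) : ℂ) = 1 := by
    rw [← ofReal_mul, ← Real.mul_rpow ht.le (by positivity), mul_one_div_cancel ht.ne',
      Real.one_rpow, ofReal_one]
  linear_combination (-(rootNum χ * (starRingEnd ℂ) (rootNum χ) * charTheta χ t)) * h3

theorem charTheta_isBigO_atTop {N : ℕ} (hN : 1 < N) (χ : DirichletCharacter ℂ N) (r : ℝ) :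
    charTheta χ =O[Filter.atTop] fun t : ℝ => t ^ r := by
  obtain ⟨C, hC⟩ := norm_charTheta_le hN χ
  have hN0 : (0 : ℝ) < N := by positivity
  have h1 : charTheta χ =O[Filter.atTop] fun t : ℝ => Real.exp (-(Real.pi / N) * t) := by
    refine Asymptotics.IsBigO.of_bound C ?_
    filter_upwards [Filter.eventually_ge_atTop 1] with t ht
    rw [Real.norm_eq_abs, Real.abs_exp]
    exact hC t ht
  exact h1.trans (isLittleO_exp_neg_mul_rpow_atTop (by positivity) r).isBigO

theorem charTheta_isBigO_zero {N : ℕ} (hN : 1 < N) {χ : DirichletCharacter ℂ N}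
    (hχ : χ.IsPrimitive) (r : ℝ) :
    charTheta χ =O[nhdsWithin 0 (Set.Ioi 0)] fun t : ℝ => t ^ r := by
  let _ : NeZero N := ⟨by omega⟩
  have h1 := (charTheta_isBigO_atTop hN χ (-(r + 1 / 2))).comp_tendsto tendsto_inv_nhdsGT_zero
  obtain ⟨C, hC⟩ := h1.bound
  refine Asymptotics.IsBigO.of_bound (‖rootNum χ‖ * C) ?_
  filter_upwards [hC, self_mem_nhdsWithin] with t ht ht0
  have ht0 : 0 < t := ht0
  rw [charTheta_functional hχ ht0, norm_mul, norm_mul, RCLike.norm_conj, norm_real, mul_assoc,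
    mul_assoc, one_div t]
  refine mul_le_mul_of_nonneg_left ?_ (norm_nonneg _)
  simp only [Function.comp] at ht
  calc _ ≤ ‖t ^ (-(1 / 2) : ℝ)‖ * (C * ‖t⁻¹ ^ (-(r + 1 / 2))‖) :=
        mul_le_mul_of_nonneg_left ht (norm_nonneg _)
    _ = C * ‖t ^ (-(1 / 2) : ℝ) * t⁻¹ ^ (-(r + 1 / 2))‖ := by rw [norm_mul]; ring
    _ = _ := by
      rw [Real.inv_rpow ht0.le, Real.rpow_neg ht0.le (r + 1 / 2), inv_inv, ← Real.rpow_add ht0,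
        show -(1 / 2) + (r + 1 / 2) = r by ring]

theorem mellinConvergent_charTheta {N : ℕ} (hN : 1 < N) {χ : DirichletCharacter ℂ N}
    (hχ : χ.IsPrimitive) (s : ℂ) : MellinConvergent (charTheta χ) s := by
  let _ : NeZero N := ⟨by omega⟩
  exact mellinConvergent_of_isBigO_rpow
    ((continuousOn_charTheta χ).locallyIntegrableOn measurableSet_Ioi)
    (charTheta_isBigO_atTop hN χ (-(s.re + 1))) (lt_add_one _)
    (charTheta_isBigO_zero hN hχ (-(s.re - 1))) (by linarith)

theorem differentiable_mellin_charTheta {N : ℕ} (hN : 1 < N) {χ : DirichletCharacter ℂ N}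
    (hχ : χ.IsPrimitive) : Differentiable ℂ (mellin (charTheta χ)) := by
  let _ : NeZero N := ⟨by omega⟩
  exact fun s => mellin_differentiableAt_of_isBigO_rpow
    ((continuousOn_charTheta χ).locallyIntegrableOn measurableSet_Ioi)
    (charTheta_isBigO_atTop hN χ (-(s.re + 1))) (lt_add_one _)
    (charTheta_isBigO_zero hN hχ (-(s.re - 1))) (by linarith)

theorem mellin_charTheta_eq_of_one_lt {N : ℕ} (hN : 1 < N) {χ : DirichletCharacter ℂ N}
    (hev : χ.Even) {s : ℂ} (hs : 1 < s.re) :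
    mellin (charTheta χ) (s / 2) = (N : ℂ) ^ (s / 2) * (Gammaℝ s * (2 * LSeries (fun n => χ n) s)) := by
  let _ : NeZero N := ⟨by omega⟩
  have : Fact (1 < N) := ⟨hN⟩
  have hN0 : (0 : ℝ) < N := by positivity
  have hs0 : s ≠ 0 := by rintro rfl; simp at hs; linarith
  have hχ0 : χ 0 = 0 := MulChar.map_zero χ
  have h1 := mellin_comp_mul_left (charTheta χ) (s / 2) hN0
  have h2 : HasSum (fun n : ℤ => Gammaℝ s * χ n / ((|(n : ℝ)| : ℝ) : ℂ) ^ s)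
      (mellin (fun t => charTheta χ (N * t)) (s / 2)) := by
    refine hasSum_mellin_pi_mul_sq (by linarith) (fun t ht => ?_) ?_
    · have ht : 0 < t := ht
      refine (summable_charTheta χ (t := N * t) (by positivity)).hasSum.congr_fun fun n => ?_
      rcases eq_or_ne n 0 with rfl | hn
      · simp [hχ0]
      · rw [if_neg (by exact_mod_cast hn), mul_div_cancel_left₀ _ hN0.ne']
        congr 3
        ring
    · refine Summable.of_nonneg_of_le (fun n => by positivity) (fun n => ?_)
        (Real.summable_abs_int_rpow hs)
      rw [Real.rpow_neg (abs_nonneg _), ← one_div]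
      gcongr
      exact χ.norm_le_one _
  have h4 := h2.nat_add_neg
  have h5 : HasSum (LSeries.term (fun n => χ n) s) (LSeries (fun n => χ n) s) :=
    (χ.LSeriesSummable_of_one_lt_re hs).hasSum
  have h6 := h5.mul_left (Gammaℝ s * 2)
  have h7 := h4.unique (h6.congr_fun fun n => ?_)
  · rw [h1, smul_eq_mul] at h7
    simp only [Int.cast_zero, MulChar.map_zero, mul_zero, zero_div, add_zero] at h7
    rw [mul_assoc] at h7
    rw [← h7, ofReal_natCast, ← mul_assoc, ← cpow_add _ _ (by exact_mod_cast hN0.ne'), add_neg_cancel, cpow_zero, one_mul]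
  · rcases eq_or_ne n 0 with rfl | hn
    · simp [hχ0]
    · rw [LSeries.term_of_ne_zero hn]
      have h8 : χ (((-(n : ℤ) : ℤ)) : ZMod N) = χ n := by
        push_cast
        rw [hev.eval_neg]
      rw [h8]
      push_cast
      rw [abs_neg, Nat.abs_cast, ofReal_natCast]
      ring

theorem mellin_charTheta_eq {N : ℕ} [NeZero N] (hN : 1 < N) {χ : DirichletCharacter ℂ N}
    (hχ : χ.IsPrimitive) (hev : χ.Even) {s : ℂ} (hs : 0 < s.re) :
    mellin (charTheta χ) (s / 2) = (N : ℂ) ^ (s / 2) * (Gammaℝ s * (2 * χ.LFunction s)) := by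
  have hN0 : (N : ℂ) ≠ 0 := by exact_mod_cast (NeZero.ne N)
  have hχ1 : χ ≠ 1 := by
    rintro rfl
    rw [DirichletCharacter.isPrimitive_def, DirichletCharacter.conductor_one] at hχ
    omega
  have hf : Differentiable ℂ fun s => mellin (charTheta χ) (s / 2) * (Gammaℝ s)⁻¹ := by
    refine Differentiable.mul ?_ differentiable_Gammaℝ_inv
    exact (differentiable_mellin_charTheta hN hχ).comp (by fun_prop)
  have hg : Differentiable ℂ fun s : ℂ => (N : ℂ) ^ (s / 2) * (2 * χ.LFunction s) := by
    refine Differentiable.mul ?_ ((χ.differentiable_LFunction hχ1).const_mul 2)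
    exact fun s => (DifferentiableAt.const_cpow (by fun_prop) (Or.inl hN0))
  have heq : (fun s => mellin (charTheta χ) (s / 2) * (Gammaℝ s)⁻¹) =
      fun s : ℂ => (N : ℂ) ^ (s / 2) * (2 * χ.LFunction s) := by
    refine AnalyticOnNhd.eq_of_eventuallyEq (z₀ := 2) (fun z _ => hf.analyticAt z)
      (fun z _ => hg.analyticAt z) ?_
    have hopen : {s : ℂ | 1 < s.re} ∈ nhds (2 : ℂ) :=
      (isOpen_lt continuous_const continuous_re).mem_nhds (by simp)
    filter_upwards [hopen] with s hs
    have hs : 1 < s.re := hs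
    have : Gammaℝ s ≠ 0 := Gammaℝ_ne_zero_of_re_pos (by linarith)
    rw [mellin_charTheta_eq_of_one_lt hN hev hs, χ.LFunction_eq_LSeries hs]
    field_simp
  have h := congrFun heq s
  have : Gammaℝ s ≠ 0 := Gammaℝ_ne_zero_of_re_pos hs
  rw [← div_eq_mul_inv, div_eq_iff this] at h
  rw [h]
  ring

theorem cpow_ofReal_sub_one_exp (s α : ℝ) :
    (Real.exp α : ℂ) * (Real.exp α : ℂ) ^ ((s : ℂ) - 1) = (Real.exp (s * α) : ℝ) := by
  rw [show (s : ℂ) - 1 = ((s - 1 : ℝ) : ℂ) by push_cast; rfl, ← ofReal_cpow (Real.exp_pos _).le,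
    ← Real.exp_mul, ← ofReal_mul, ← Real.exp_add]
  ring_nf

theorem mellin_eq_integral_exp (f : ℝ → ℂ) (s : ℝ) :
    mellin f s = ∫ α : ℝ, (Real.exp (s * α) : ℂ) * f (Real.exp α) := by
  rw [mellin, ← Real.range_exp, ← Set.image_univ, integral_image_eq_integral_abs_deriv_smul
    MeasurableSet.univ (fun x _ => (Real.hasDerivAt_exp x).hasDerivWithinAt)
    Real.exp_injective.injOn, setIntegral_univ]
  refine integral_congr_ae (Filter.Eventually.of_forall fun α => ?_)
  simp only [Real.abs_exp]
  rw [← cpow_ofReal_sub_one_exp, Complex.real_smul, smul_eq_mul, mul_assoc]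

theorem mellinConvergent_iff_integrable_exp (f : ℝ → ℂ) (s : ℝ) :
    MellinConvergent f s ↔ Integrable fun α : ℝ => (Real.exp (s * α) : ℂ) * f (Real.exp α) := by
  rw [MellinConvergent, ← Real.range_exp, ← Set.image_univ,
    integrableOn_image_iff_integrableOn_abs_deriv_smul
    MeasurableSet.univ (fun x _ => (Real.hasDerivAt_exp x).hasDerivWithinAt)
    Real.exp_injective.injOn, integrableOn_univ]
  refine integrable_congr (Filter.Eventually.of_forall fun α => ?_)
  simp only [Real.abs_exp]
  rw [← cpow_ofReal_sub_one_exp, Complex.real_smul, smul_eq_mul, mul_assoc]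

/-- The integrand of the approximate functional equation in logarithmic coordinates. -/
noncomputable def thetaPair {N : ℕ} (χ : DirichletCharacter ℂ N) (z : ℝ × ℝ) : ℂ :=
  charTheta χ (Real.exp (z.1 + z.2)) * (starRingEnd ℂ) (charTheta χ (Real.exp (z.1 - z.2)))

theorem thetaPair_eq {N : ℕ} (χ : DirichletCharacter ℂ N) (z : ℝ × ℝ) :
    (Real.exp (z.1 / 2) : ℂ) * thetaPair χ z =
    ((Real.exp (1 / 4 * (z.1 + z.2)) : ℂ) * charTheta χ (Real.exp (z.1 + z.2))) *
      (starRingEnd ℂ) ((Real.exp (1 / 4 * (z.1 - z.2)) : ℂ) * charTheta χ (Real.exp (z.1 - z.2))) := by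
  rw [thetaPair, map_mul, conj_ofReal, show z.1 / 2 = 1 / 4 * (z.1 + z.2) + 1 / 4 * (z.1 - z.2) by ring,
    Real.exp_add]
  push_cast
  ring

theorem integrable_charTheta_exp {N : ℕ} (hN : 1 < N) {χ : DirichletCharacter ℂ N}
    (hχ : χ.IsPrimitive) :
    Integrable fun α : ℝ => (Real.exp (1 / 4 * α) : ℂ) * charTheta χ (Real.exp α) :=
  (mellinConvergent_iff_integrable_exp _ _).1 (mellinConvergent_charTheta hN hχ _)

theorem integrable_thetaPair {N : ℕ} (hN : 1 < N) {χ : DirichletCharacter ℂ N}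
    (hχ : χ.IsPrimitive) :
    Integrable fun z : ℝ × ℝ => (Real.exp (z.1 / 2) : ℂ) * thetaPair χ z := by
  have h := integrable_charTheta_exp hN hχ
  have h2 := h.mul_prod (RCLike.conjCLE.toContinuousLinearMap.integrable_comp h)
  refine (integrable_comp_addSub h2).congr (Filter.Eventually.of_forall fun z => ?_)
  simp only
  rw [thetaPair_eq]
  rfl

theorem thetaPair_neg {N : ℕ} [NeZero N] {χ : DirichletCharacter ℂ N}
    (hχ : χ.IsPrimitive) (x y : ℝ) :
    (Real.exp (-x / 2) : ℂ) * thetaPair χ (-x, y) = (Real.exp (x / 2) : ℂ) * thetaPair χ (x, y) := by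
  have h1 := charTheta_functional hχ (Real.exp_pos (-x + y))
  have h2 := charTheta_functional hχ (Real.exp_pos (-x - y))
  have h3 := norm_rootNum_sq_mul_charTheta hχ (Real.exp_pos (x + y))
  rw [one_div (Real.exp _), ← Real.exp_neg, ← Real.exp_mul, show -(-x + y) = x - y by ring] at h1
  rw [one_div (Real.exp _), ← Real.exp_neg, ← Real.exp_mul, show -(-x - y) = x + y by ring] at h2
  have h4 : Real.exp (-x / 2) * Real.exp ((-x + y) * -(1 / 2)) * Real.exp ((-x - y) * -(1 / 2)) =
      Real.exp (x / 2) := by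
    rw [← Real.exp_add, ← Real.exp_add]
    congr 1
    ring
  simp only [thetaPair]
  rw [h1, h2, map_mul, map_mul, conj_conj, conj_ofReal, ← h4]
  conv_rhs => rw [← h3]
  push_cast
  ring

theorem integral_eq_two_mul_of_even_fst {f : ℝ × ℝ → ℂ} (hf : Integrable f)
    (he : ∀ x y, f (-x, y) = f (x, y)) :
    ∫ z, f z = 2 * ∫ z in Set.Ioi (0 : ℝ) ×ˢ (Set.univ : Set ℝ), f z := by
  have h1 : ∫ z, f z = ∫ x, ∫ y, f (x, y) := integral_prod _ hf
  have h2 : ∫ z in Set.Ioi (0 : ℝ) ×ˢ (Set.univ : Set ℝ), f z = ∫ x in Set.Ioi 0, ∫ y, f (x, y) := by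
    have : _ = ∫ x in Set.Ioi (0 : ℝ), ∫ y in Set.univ, f (x, y) :=
      setIntegral_prod (μ := volume) (ν := volume) (s := Set.Ioi (0 : ℝ)) (t := Set.univ) f hf.integrableOn
    simp only [setIntegral_univ] at this
    exact this
  have hI : Integrable fun x => ∫ y, f (x, y) := hf.integral_prod_left
  have h3 := integral_comp_neg_Iic (0 : ℝ) fun x => ∫ y, f (x, y)
  simp only [he, neg_zero] at h3
  rw [h1, h2, ← intervalIntegral.integral_Iic_add_Ioi (b := 0) hI.integrableOn hI.integrableOn, h3, two_mul]

theorem norm_LFunction_sq_eq {N : ℕ} [NeZero N] (hN : 1 < N) {χ : DirichletCharacter ℂ N}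
    (hχ : χ.IsPrimitive) (hev : χ.Even) :
    ((√(N / Real.pi) * Real.Gamma (1 / 4) ^ 2 * ‖χ.LFunction (1 / 2)‖ ^ 2 : ℝ) : ℂ) =
      ∫ z in Set.Ioi (0 : ℝ) ×ˢ (Set.univ : Set ℝ), (Real.exp (z.1 / 2) : ℂ) * thetaPair χ z := by
  have hN0 : (0 : ℝ) < N := by exact_mod_cast NeZero.pos N
  have h := integrable_charTheta_exp hN hχ
  set J := ∫ α : ℝ, (Real.exp (1 / 4 * α) : ℂ) * charTheta χ (Real.exp α) with hJ
  have h1 : J = (N : ℂ) ^ ((1 / 2 : ℂ) / 2) * (Gammaℝ (1 / 2) * (2 * χ.LFunction (1 / 2))) := by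
    rw [← mellin_charTheta_eq hN hχ hev (by norm_num), hJ, ← mellin_eq_integral_exp]
    norm_num
  have h2 := integral_comp_addSub (fun z : ℝ × ℝ => ((Real.exp (1 / 4 * z.1) : ℂ) * charTheta χ (Real.exp z.1)) *
      (starRingEnd ℂ) ((Real.exp (1 / 4 * z.2) : ℂ) * charTheta χ (Real.exp z.2)))
  have h3 : ∫ z : ℝ × ℝ, ((Real.exp (1 / 4 * z.1) : ℂ) * charTheta χ (Real.exp z.1)) *
      (starRingEnd ℂ) ((Real.exp (1 / 4 * z.2) : ℂ) * charTheta χ (Real.exp z.2)) = J * (starRingEnd ℂ) J := by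
    have h4 := integral_prod_mul (μ := volume) (ν := volume) (fun α : ℝ => (Real.exp (1 / 4 * α) : ℂ) * charTheta χ (Real.exp α))
      (fun α : ℝ => (starRingEnd ℂ) ((Real.exp (1 / 4 * α) : ℂ) * charTheta χ (Real.exp α)))
    rw [integral_conj] at h4
    exact h4
  rw [h3] at h2
  simp only [← thetaPair_eq] at h2
  rw [integral_eq_two_mul_of_even_fst (integrable_thetaPair hN hχ) (fun x y => thetaPair_neg hχ x y)] at h2
  rw [mul_conj, normSq_eq_norm_sq] at h2
  have h5 : ‖J‖ ^ 2 = 4 * (√(N / Real.pi) * Real.Gamma (1 / 4) ^ 2 * ‖χ.LFunction (1 / 2)‖ ^ 2) := by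
    have h6 : ((1 : ℂ) / 2 / 2) = ((1 / 4 : ℝ) : ℂ) := by norm_num
    rw [h1, Gammaℝ_def, show (-(1 / 2 : ℂ) / 2) = ((-(1 / 4) : ℝ) : ℂ) by norm_num, h6, Gamma_ofReal,
      ← ofReal_natCast, ← ofReal_cpow hN0.le, ← ofReal_cpow Real.pi_pos.le]
    simp only [norm_mul, norm_real, Real.norm_eq_abs, mul_pow, sq_abs]
    rw [← Real.rpow_natCast, ← Real.rpow_natCast (Real.pi ^ _), ← Real.rpow_mul hN0.le,
      ← Real.rpow_mul Real.pi_pos.le, Real.sqrt_eq_rpow, Real.div_rpow hN0.le Real.pi_pos.le]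
    rw [show -(1 / 4 : ℝ) * (2 : ℕ) = -(1 / 2) by norm_num, show (1 / 4 : ℝ) * (2 : ℕ) = 1 / 2 by norm_num,
      Real.rpow_neg Real.pi_pos.le, RCLike.norm_ofNat]
    ring
  rw [h5] at h2
  push_cast at h2 ⊢
  linear_combination -(1 / 2 : ℂ) * h2

/-! ### Sums over even characters -/

theorem isPrimitive_mul_changeLevel {p j k : ℕ} (hp : p.Prime) (hjk : j < k)
    {χ : DirichletCharacter ℂ (p ^ k)} (hχ : χ.IsPrimitive) (ψ : DirichletCharacter ℂ (p ^ j)) :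
    (χ * DirichletCharacter.changeLevel (pow_dvd_pow p hjk.le) ψ).IsPrimitive := by
  have : NeZero (p ^ k) := ⟨pow_ne_zero k hp.ne_zero⟩
  set ψ' := DirichletCharacter.changeLevel (pow_dvd_pow p hjk.le) ψ with hψ'
  rw [DirichletCharacter.isPrimitive_def] at hχ ⊢
  obtain ⟨i, hi, hi'⟩ := (Nat.dvd_prime_pow hp).1 (DirichletCharacter.conductor_dvd_level (χ * ψ'))
  rw [hi']
  congr 1
  by_contra hik
  have h1 := DirichletCharacter.conductor_mul_dvd_lcm_conductor (χ * ψ') ψ'⁻¹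
  rw [mul_inv_cancel_right, hχ, hi', DirichletCharacter.conductor_inv, hψ',
    DirichletCharacter.conductor_changeLevel] at h1
  have h2 : (p ^ i).lcm ψ.conductor ∣ p ^ (max i j) := Nat.lcm_dvd (pow_dvd_pow p (le_max_left _ _))
    (ψ.conductor_dvd_level.trans (pow_dvd_pow p (le_max_right _ _)))
  have h3 := (Nat.pow_dvd_pow_iff_le_right hp.one_lt).1 (h1.trans h2)
  omega

theorem charTheta_eq_zero_of_odd {N : ℕ} {χ : DirichletCharacter ℂ N} (hχ : χ.Odd) (t : ℝ) :
    charTheta χ t = 0 := by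
  have h : charTheta χ t = -charTheta χ t := by
    conv_lhs => rw [charTheta, ← (Equiv.neg ℤ).tsum_eq]
    rw [charTheta, ← tsum_neg]
    refine tsum_congr fun n => ?_
    rw [Equiv.neg_apply]
    push_cast
    rw [hχ.eval_neg, neg_sq]
    ring
  exact self_eq_neg.1 h

/-- A weight on pairs of integers attached to a point of the plane (in logarithmic coordinates). -/
noncomputable def pairWeight (N : ℕ) (z : ℝ × ℝ) (v : ℤ × ℤ) : ℝ :=
  Real.exp (-Real.pi * (Real.exp (z.1 + z.2) / N) * v.1 ^ 2) *
    Real.exp (-Real.pi * (Real.exp (z.1 - z.2) / N) * v.2 ^ 2)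

theorem pairWeight_pos (N : ℕ) (z : ℝ × ℝ) (v : ℤ × ℤ) : 0 < pairWeight N z v := by
  unfold pairWeight; positivity

theorem summable_pairWeight {N : ℕ} [NeZero N] (z : ℝ × ℝ) : Summable (pairWeight N z) := by
  have hN : (0 : ℝ) < N := by exact_mod_cast NeZero.pos N
  exact (summable_real_gaussian (div_pos (Real.exp_pos (z.1 + z.2)) hN)).mul_of_nonneg
    (summable_real_gaussian (div_pos (Real.exp_pos (z.1 - z.2)) hN))
    (fun _ => (Real.exp_pos _).le) (fun _ => (Real.exp_pos _).le)

/-- Terms of the theta series over pairs in the same residue class modulo `M`. -/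
noncomputable def cosetTerm {N : ℕ} (χ : DirichletCharacter ℂ N) (M : ℕ) (z : ℝ × ℝ) (v : ℤ × ℤ) : ℂ :=
  open Classical in
  if v.1 ≡ v.2 [ZMOD M] then χ v.1 * (starRingEnd ℂ) (χ v.2) * pairWeight N z v else 0

/-- The theta series over pairs in the same residue class modulo `M`. -/
noncomputable def cosetTheta {N : ℕ} (χ : DirichletCharacter ℂ N) (M : ℕ) (z : ℝ × ℝ) : ℂ :=
  ∑' v : ℤ × ℤ, cosetTerm χ M z v

theorem norm_char_mul_pairWeight_le {N : ℕ} (χ : DirichletCharacter ℂ N) (z : ℝ × ℝ) (v : ℤ × ℤ) :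
    ‖χ v.1 * (starRingEnd ℂ) (χ v.2) * pairWeight N z v‖ ≤ pairWeight N z v := by
  have h0 := pairWeight_pos N z v
  rw [norm_mul, norm_mul, RCLike.norm_conj, norm_real, Real.norm_of_nonneg h0.le]
  have := mul_le_mul (χ.norm_le_one v.1) (χ.norm_le_one v.2) (norm_nonneg _) zero_le_one
  rw [one_mul] at this
  exact mul_le_of_le_one_left h0.le this

theorem norm_cosetTerm_le {N : ℕ} (χ : DirichletCharacter ℂ N) (M : ℕ) (z : ℝ × ℝ) (v : ℤ × ℤ) :
    ‖cosetTerm χ M z v‖ ≤ pairWeight N z v := by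
  rw [cosetTerm]
  split_ifs
  · exact norm_char_mul_pairWeight_le χ z v
  · rw [norm_zero]
    exact (pairWeight_pos N z v).le

theorem summable_cosetTerm {N : ℕ} [NeZero N] (χ : DirichletCharacter ℂ N) (M : ℕ) (z : ℝ × ℝ) :
    Summable (cosetTerm χ M z) :=
  Summable.of_norm_bounded (summable_pairWeight z) (norm_cosetTerm_le χ M z)

theorem thetaPair_eq_tsum {N : ℕ} [NeZero N] (χ : DirichletCharacter ℂ N) (z : ℝ × ℝ) :
    thetaPair χ z = ∑' v : ℤ × ℤ, χ v.1 * (starRingEnd ℂ) (χ v.2) * pairWeight N z v := by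
  rw [thetaPair, charTheta, charTheta, Complex.conj_tsum, tsum_mul_tsum_of_summable_norm
    (summable_charTheta χ (Real.exp_pos _)).norm
    (by simpa only [RCLike.norm_conj] using (summable_charTheta χ (Real.exp_pos _)).norm)]
  refine tsum_congr fun v => ?_
  rw [map_mul, conj_ofReal, pairWeight, ofReal_mul]
  ring

theorem sum_even_char_mul {p j k : ℕ} (hp : p.Prime) (hjk : j ≤ k)
    (χ : DirichletCharacter ℂ (p ^ k)) (m n : ℤ) :
    ∑ ψ : DirichletCharacter ℂ (p ^ j),
      (χ * DirichletCharacter.changeLevel (pow_dvd_pow p hjk) ψ) m *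
      (starRingEnd ℂ) ((χ * DirichletCharacter.changeLevel (pow_dvd_pow p hjk) ψ) n) =
    (p ^ j).totient * (open Classical in if m ≡ n [ZMOD (p ^ j : ℕ)] then χ m * (starRingEnd ℂ) (χ n) else 0) := by
  have : NeZero (p ^ k) := ⟨pow_ne_zero k hp.ne_zero⟩
  have : NeZero (p ^ j) := ⟨pow_ne_zero j hp.ne_zero⟩
  by_cases hm : IsCoprime m (p ^ k : ℕ)
  swap
  · have h0 : χ m = 0 := (χ.apply_eq_zero_iff m).2 hm
    simp [MulChar.mul_apply, h0]
  by_cases hn : IsCoprime n (p ^ k : ℕ)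
  swap
  · have h0 : χ n = 0 := (χ.apply_eq_zero_iff n).2 hn
    simp [MulChar.mul_apply, h0]
  have hn' : IsCoprime n ((p ^ j : ℕ) : ℤ) := IsCoprime.of_isCoprime_of_dvd_right hn
    (by exact_mod_cast pow_dvd_pow p hjk)
  have hu : IsUnit (n : ZMod (p ^ j)) := (ZMod.coe_int_isUnit_iff_isCoprime _ _).2 hn'.symm
  have hort := DirichletCharacter.sum_char_inv_mul_char_eq ℂ hu (m : ZMod (p ^ j))
  have hterm (ψ : DirichletCharacter ℂ (p ^ j)) :
      (χ * DirichletCharacter.changeLevel (pow_dvd_pow p hjk) ψ) m *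
      (starRingEnd ℂ) ((χ * DirichletCharacter.changeLevel (pow_dvd_pow p hjk) ψ) n) =
      (χ m * (starRingEnd ℂ) (χ n)) * (ψ (n : ZMod (p ^ j))⁻¹ * ψ m) := by
    rw [MulChar.mul_apply, MulChar.mul_apply, DirichletCharacter.changeLevel_eq_cast_of_dvd' _ _ hm,
      DirichletCharacter.changeLevel_eq_cast_of_dvd' _ _ hn, map_mul, star_dirichlet ψ,
      MulChar.inv_apply]
    have : Ring.inverse (n : ZMod (p ^ j)) = (n : ZMod (p ^ j))⁻¹ := by
      refine hu.mul_left_cancel ?_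
      rw [Ring.mul_inverse_cancel _ hu, ZMod.mul_inv_of_unit _ hu]
    rw [this]
    ring
  rw [Finset.sum_congr rfl fun ψ _ => hterm ψ, ← Finset.mul_sum, hort]
  have hiff : (n : ZMod (p ^ j)) = m ↔ m ≡ n [ZMOD (p ^ j : ℕ)] := by
    rw [eq_comm, ZMod.intCast_eq_intCast_iff]
  by_cases h : m ≡ n [ZMOD (p ^ j : ℕ)]
  · rw [if_pos h, if_pos (hiff.2 h)]; ring
  · rw [if_neg h, if_neg (fun h' => h (hiff.1 h'))]; ring

theorem sum_thetaPair {p j k : ℕ} (hp : p.Prime) (hjk : j ≤ k)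
    (χ : DirichletCharacter ℂ (p ^ k)) (z : ℝ × ℝ) :
    ∑ ψ : DirichletCharacter ℂ (p ^ j),
      thetaPair (χ * DirichletCharacter.changeLevel (pow_dvd_pow p hjk) ψ) z =
      (p ^ j).totient * cosetTheta χ (p ^ j) z := by
  have : NeZero (p ^ k) := ⟨pow_ne_zero k hp.ne_zero⟩
  simp only [thetaPair_eq_tsum]
  rw [← Summable.tsum_finsetSum, cosetTheta, ← tsum_mul_left]
  · refine tsum_congr fun v => ?_
    rw [← Finset.sum_mul, sum_even_char_mul hp hjk, cosetTerm]
    split_ifs <;> ring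
  · intro ψ _
    refine Summable.of_norm_bounded (summable_pairWeight (N := p ^ k) z) fun v => ?_
    exact norm_char_mul_pairWeight_le _ z v

theorem integral_exp_mul_exp_neg {s c : ℝ} (hs : 0 < s) (hc : 0 < c) :
    Integrable (fun α : ℝ => Real.exp (s * α) * Real.exp (-(c * Real.exp α))) ∧
    ∫ α : ℝ, Real.exp (s * α) * Real.exp (-(c * Real.exp α)) = c ^ (-s) * Real.Gamma s := by
  have hpt (α : ℝ) : |Real.exp α| • ((Real.exp α) ^ (s - 1) * Real.exp (-(c * Real.exp α))) =
      Real.exp (s * α) * Real.exp (-(c * Real.exp α)) := by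
    rw [Real.abs_exp, smul_eq_mul, ← mul_assoc, ← Real.exp_mul, ← Real.exp_add]
    ring_nf
  have hval : ∫ α : ℝ, Real.exp (s * α) * Real.exp (-(c * Real.exp α)) = c ^ (-s) * Real.Gamma s := by
    have h := Real.integral_rpow_mul_exp_neg_mul_Ioi hs hc
    rw [← Real.range_exp, ← Set.image_univ, integral_image_eq_integral_abs_deriv_smul
      MeasurableSet.univ (fun x _ => (Real.hasDerivAt_exp x).hasDerivWithinAt)
      Real.exp_injective.injOn, setIntegral_univ] at h
    simp only [hpt] at h
    rw [h, one_div, Real.inv_rpow hc.le, Real.rpow_neg hc.le]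
  refine ⟨?_, hval⟩
  refine Integrable.of_integral_ne_zero ?_
  rw [hval]
  exact (mul_pos (Real.rpow_pos_of_pos hc _) (Real.Gamma_pos_of_pos hs)).ne'

theorem exp_mul_two_exp_eq (s c d : ℝ) (z : ℝ × ℝ) :
    Real.exp (s * z.1) * Real.exp (-(c * Real.exp (z.1 + z.2) + d * Real.exp (z.1 - z.2))) =
    (Real.exp (s / 2 * (z.1 + z.2)) * Real.exp (-(c * Real.exp (z.1 + z.2)))) *
      (Real.exp (s / 2 * (z.1 - z.2)) * Real.exp (-(d * Real.exp (z.1 - z.2)))) := by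
  simp only [← Real.exp_add]
  ring_nf

theorem integral_exp_two_exp {s c d : ℝ} (hs : 0 < s) (hc : 0 < c) (hd : 0 < d) :
    Integrable (fun z : ℝ × ℝ => Real.exp (s * z.1) *
      Real.exp (-(c * Real.exp (z.1 + z.2) + d * Real.exp (z.1 - z.2)))) ∧
    ∫ z : ℝ × ℝ, Real.exp (s * z.1) *
      Real.exp (-(c * Real.exp (z.1 + z.2) + d * Real.exp (z.1 - z.2))) =
      1 / 2 * (c * d) ^ (-(s / 2)) * Real.Gamma (s / 2) ^ 2 := by
  have h1 := integral_exp_mul_exp_neg (half_pos hs) hc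
  have h2 := integral_exp_mul_exp_neg (half_pos hs) hd
  set f : ℝ × ℝ → ℝ := fun z => (Real.exp (s / 2 * z.1) * Real.exp (-(c * Real.exp z.1))) *
      (Real.exp (s / 2 * z.2) * Real.exp (-(d * Real.exp z.2))) with hf
  have hfi : Integrable f := h1.1.mul_prod h2.1
  have hfv : ∫ z, f z = (c ^ (-(s / 2)) * Real.Gamma (s / 2)) * (d ^ (-(s / 2)) * Real.Gamma (s / 2)) := by
    rw [← h1.2, ← h2.2]
    exact integral_prod_mul (μ := volume) (ν := volume) (fun x => Real.exp (s / 2 * x) * Real.exp (-(c * Real.exp x)))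
      (fun x => Real.exp (s / 2 * x) * Real.exp (-(d * Real.exp x)))
  have hfi' : Integrable fun z => (f z : ℂ) := hfi.ofReal
  have e1 := integrable_comp_addSub hfi'
  have e2 := integral_comp_addSub fun z => (f z : ℂ)
  simp only [exp_mul_two_exp_eq]
  refine ⟨e1.re.congr (Filter.Eventually.of_forall fun z => ?_), ?_⟩
  · simp only [hf, RCLike.re_to_complex, ofReal_re]
  · rw [integral_complex_ofReal, integral_complex_ofReal] at e2
    have e3 : ∫ z : ℝ × ℝ, f (z.1 + z.2, z.1 - z.2) = 1 / 2 * ∫ z, f z := by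
      apply ofReal_injective
      rw [e2, ofReal_mul]
      norm_num
    refine e3.trans ?_
    rw [hfv, Real.mul_rpow hc.le hd.le]
    ring

theorem integrableOn_prod_mul {S T : Set ℝ} {A B : ℝ → ℝ}
    (hA : IntegrableOn A S) (hB : IntegrableOn B T) :
    IntegrableOn (fun z : ℝ × ℝ => A z.1 * B z.2) (S ×ˢ T) := by
  rw [IntegrableOn, Measure.volume_eq_prod, ← Measure.prod_restrict]
  exact hA.mul_prod hB

theorem norm_setIntegral_prod_le {S T : Set ℝ} (hS : MeasurableSet S) (hT : MeasurableSet T)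
    {E : Type*} [NormedAddCommGroup E] [NormedSpace ℝ E] {f : ℝ × ℝ → E} {A B : ℝ → ℝ} {a b : ℝ}
    (hA : IntegrableOn A S) (hB : IntegrableOn B T)
    (hA0 : 0 ≤ ∫ x in S, A x) (hB0 : 0 ≤ ∫ x in T, B x)
    (ha : ∫ x in S, A x ≤ a) (hb : ∫ x in T, B x ≤ b)
    (h : ∀ x ∈ S, ∀ y ∈ T, ‖f (x, y)‖ ≤ A x * B y) :
    ‖∫ z in S ×ˢ T, f z‖ ≤ a * b := by
  refine (norm_integral_le_of_norm_le (integrableOn_prod_mul hA hB) ?_).trans ?_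
  · exact (ae_restrict_iff' (hS.prod hT)).2 (Filter.Eventually.of_forall fun _ hz => h _ hz.1 _ hz.2)
  · have := setIntegral_prod_mul (μ := volume) (ν := volume) A B S T
    rw [Measure.volume_eq_prod, this]
    exact mul_le_mul ha hb hB0 (hA0.trans ha)

theorem integrableOn_prod_of_norm_le {S T : Set ℝ} (hS : MeasurableSet S) (hT : MeasurableSet T)
    {E : Type*} [NormedAddCommGroup E] [NormedSpace ℝ E] {f : ℝ × ℝ → E} {A B : ℝ → ℝ}
    (hA : IntegrableOn A S) (hB : IntegrableOn B T)
    (hf : AEStronglyMeasurable f (volume.restrict (S ×ˢ T)))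
    (h : ∀ x ∈ S, ∀ y ∈ T, ‖f (x, y)‖ ≤ A x * B y) :
    IntegrableOn f (S ×ˢ T) :=
  Integrable.mono' (integrableOn_prod_mul hA hB) hf
    ((ae_restrict_iff' (hS.prod hT)).2 (Filter.Eventually.of_forall fun _ hz => h _ hz.1 _ hz.2))

theorem integrableOn_exp_neg_mul_Ioi {a : ℝ} (ha : 0 < a) (c : ℝ) :
    IntegrableOn (fun x => Real.exp (-a * x)) (Set.Ioi c) :=
  integrableOn_exp_mul_Ioi (neg_neg_of_pos ha) c

theorem integral_exp_neg_mul_Ioi {a : ℝ} (ha : 0 < a) (c : ℝ) :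
    ∫ x in Set.Ioi c, Real.exp (-a * x) = Real.exp (-a * c) / a := by
  rw [integral_exp_mul_Ioi (neg_neg_of_pos ha), neg_div_neg_eq]

/-! ### The diagonal contribution -/

theorem exp_neg_le_mul_rpow {κ : ℝ} (hκ : 0 < κ) {y : ℝ} (hy : 0 < y) :
    Real.exp (-y) ≤ κ ^ κ * y ^ (-κ) := by
  have h1 : y / κ ≤ Real.exp (y / κ) := by linarith [Real.add_one_le_exp (y / κ)]
  have h2 : (y / κ) ^ κ ≤ Real.exp y := by
    calc (y / κ) ^ κ ≤ Real.exp (y / κ) ^ κ := Real.rpow_le_rpow (by positivity) h1 hκ.le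
      _ = Real.exp y := by rw [← Real.exp_mul, div_mul_cancel₀ _ hκ.ne']
  have h3 : 0 < (y / κ) ^ κ := by positivity
  calc Real.exp (-y) = (Real.exp y)⁻¹ := Real.exp_neg y
    _ ≤ ((y / κ) ^ κ)⁻¹ := inv_anti₀ h3 h2
    _ = κ ^ κ * y ^ (-κ) := by
      rw [Real.div_rpow hy.le hκ.le, inv_div, Real.rpow_neg hy.le, div_eq_mul_inv]

/-- The Jacobi theta function on the positive axis. -/
noncomputable def realTheta (t : ℝ) : ℝ := ∑' n : ℤ, Real.exp (-Real.pi * t * n ^ 2)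

theorem realTheta_inv {t : ℝ} (ht : 0 < t) : realTheta t = t ^ (-(1 / 2 : ℝ)) * realTheta t⁻¹ := by
  rw [realTheta, Real.tsum_exp_neg_mul_int_sq ht, realTheta, Real.rpow_neg ht.le, one_div,
    one_div]
  simp only [div_eq_mul_inv]

theorem one_le_realTheta {t : ℝ} (ht : 0 < t) : 1 ≤ realTheta t := by
  have := (summable_real_gaussian ht).le_tsum 0 (fun _ _ => (Real.exp_pos _).le)
  simpa [realTheta] using this

theorem realTheta_sub_one_le : ∃ K > 0, ∀ t : ℝ, 0 < t → realTheta t ≤ 1 + K * t⁻¹ := by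
  have hs : Summable fun n : ℤ => |(n : ℝ)| ^ (-2 : ℝ) := Real.summable_abs_int_rpow (by norm_num)
  refine ⟨∑' n : ℤ, |(n : ℝ)| ^ (-2 : ℝ), ?_, fun t ht => ?_⟩
  · refine hs.tsum_pos (fun n => by positivity) 1 ?_
    simp
  have hle (n : ℤ) : Real.exp (-Real.pi * t * n ^ 2) ≤ (if n = 0 then 1 else 0) + |(n : ℝ)| ^ (-2 : ℝ) * t⁻¹ := by
    by_cases hn : n = 0
    · simp [hn]
    rw [if_neg hn, zero_add]
    have hn' : 0 < |(n : ℝ)| := abs_pos.2 (by exact_mod_cast hn)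
    have h1 := Real.add_one_le_exp (Real.pi * t * n ^ 2)
    have h2 : t * n ^ 2 ≤ Real.exp (Real.pi * t * n ^ 2) := by
      nlinarith [Real.pi_gt_three, mul_nonneg ht.le (sq_nonneg (n : ℝ))]
    rw [show -Real.pi * t * (n : ℝ) ^ 2 = -(Real.pi * t * n ^ 2) by ring, Real.exp_neg,
      Real.rpow_neg hn'.le, ← mul_inv, Real.rpow_two, sq_abs, mul_comm ((n : ℝ) ^ 2) t]
    refine inv_anti₀ ?_ h2
    rw [← sq_abs]
    positivity
  have h1 : Summable fun n : ℤ => (if n = 0 then (1 : ℝ) else 0) :=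
    (hasSum_ite_eq (0 : ℤ) (1 : ℝ)).summable
  calc realTheta t ≤ ∑' n : ℤ, ((if n = 0 then 1 else 0) + |(n : ℝ)| ^ (-2 : ℝ) * t⁻¹) :=
        (summable_real_gaussian ht).tsum_le_tsum hle (h1.add (hs.mul_right _))
    _ = _ := by rw [h1.tsum_add (hs.mul_right _), tsum_ite_eq, tsum_mul_right]

theorem abs_realTheta_sub_le : ∃ K > 0, ∀ t : ℝ, 0 < t →
    |realTheta t - t ^ (-(1 / 2 : ℝ))| ≤ K := by
  obtain ⟨K, hK, h⟩ := realTheta_sub_one_le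
  refine ⟨K + 1, by positivity, fun t ht => ?_⟩
  have hr : 0 < t ^ (-(1 / 2 : ℝ)) := Real.rpow_pos_of_pos ht _
  rcases le_total t 1 with h1 | h1
  · rw [realTheta_inv ht]
    have h2 := h t⁻¹ (inv_pos.2 ht)
    have h3 := one_le_realTheta (inv_pos.2 ht)
    rw [inv_inv] at h2
    have h4 : t ^ (-(1 / 2 : ℝ)) * t ≤ 1 := by
      nth_rw 2 [← Real.rpow_one t]
      rw [← Real.rpow_add ht]
      exact Real.rpow_le_one ht.le h1 (by norm_num)
    rw [abs_le]
    constructor <;> nlinarith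
  · have h2 := h t ht
    have h3 := one_le_realTheta ht
    have h4 : t⁻¹ ≤ 1 := inv_le_one_of_one_le₀ h1
    have h5 : t ^ (-(1 / 2 : ℝ)) ≤ 1 := Real.rpow_le_one_of_one_le_of_nonpos h1 (by norm_num)
    rw [abs_le]
    constructor <;> nlinarith

theorem realTheta_le : ∃ K > 0, ∀ t : ℝ, 0 < t → realTheta t ≤ K * (1 + t ^ (-(1 / 2 : ℝ))) := by
  obtain ⟨K, hK, h⟩ := abs_realTheta_sub_le
  refine ⟨K + 1, by positivity, fun t ht => ?_⟩
  have hr : 0 < t ^ (-(1 / 2 : ℝ)) := Real.rpow_pos_of_pos ht _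
  have := (abs_le.1 (h t ht)).2
  nlinarith

/-- The theta function restricted to integers prime to `p`. -/
noncomputable def primeTheta (p : ℕ) (t : ℝ) : ℝ :=
  ∑' n : ℤ, if (p : ℤ) ∣ n then 0 else Real.exp (-Real.pi * t * n ^ 2)

theorem primeTheta_term_nonneg (p : ℕ) (t : ℝ) (n : ℤ) :
    0 ≤ if (p : ℤ) ∣ n then 0 else Real.exp (-Real.pi * t * n ^ 2) := by
  split_ifs <;> positivity

theorem summable_primeTheta (p : ℕ) {t : ℝ} (ht : 0 < t) :
    Summable fun n : ℤ => if (p : ℤ) ∣ n then 0 else Real.exp (-Real.pi * t * n ^ 2) := by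
  refine (summable_real_gaussian ht).of_nonneg_of_le (primeTheta_term_nonneg p t) fun n => ?_
  split_ifs
  · exact (Real.exp_pos _).le
  · exact le_rfl

theorem primeTheta_nonneg (p : ℕ) (t : ℝ) : 0 ≤ primeTheta p t :=
  tsum_nonneg (primeTheta_term_nonneg p t)

theorem primeTheta_eq {p : ℕ} (hp : p ≠ 0) {t : ℝ} (ht : 0 < t) :
    primeTheta p t = realTheta t - realTheta (p ^ 2 * t) := by
  have hp0 : (0 : ℝ) < p := by positivity
  have hinj : Function.Injective fun n : ℤ => (p : ℤ) * n :=
    mul_right_injective₀ (by exact_mod_cast hp)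
  set g : ℤ → ℝ := fun n => if (p : ℤ) ∣ n then Real.exp (-Real.pi * t * n ^ 2) else 0 with hg
  have h1 : realTheta (p ^ 2 * t) = ∑' n, g n := by
    rw [← hinj.tsum_eq (f := g), realTheta]
    · refine tsum_congr fun n => ?_
      rw [hg]
      simp only [dvd_mul_right, if_true]
      push_cast
      ring_nf
    · intro n hn
      by_contra h
      refine hn (if_neg fun h' => h ?_)
      obtain ⟨m, hm⟩ := h'
      exact ⟨m, hm.symm⟩
  have hgs : Summable g := by
    refine (summable_real_gaussian ht).of_nonneg_of_le (fun n => ?_) fun n => ?_ <;>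
    · simp only [hg]
      split_ifs <;> first | positivity | exact le_rfl
  rw [h1, eq_sub_iff_add_eq, primeTheta, ← (summable_primeTheta p ht).tsum_add hgs, realTheta]
  refine tsum_congr fun n => ?_
  simp only [hg]
  split_ifs <;> simp

theorem primeTheta_le_rpow {κ : ℝ} (hκ : 1 / 2 < κ) : ∃ K > 0, ∀ (p : ℕ) (t : ℝ), 0 < t →
    primeTheta p t ≤ K * t ^ (-κ) := by
  have hκ0 : 0 < κ := by linarith
  have hs : Summable fun n : ℤ => |(n : ℝ)| ^ (-(2 * κ)) := Real.summable_abs_int_rpow (by linarith)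
  refine ⟨κ ^ κ * ∑' n : ℤ, |(n : ℝ)| ^ (-(2 * κ)), ?_, fun p t ht => ?_⟩
  · refine mul_pos (by positivity) (hs.tsum_pos (fun n => by positivity) 1 ?_)
    simp
  have hle (n : ℤ) : (if (p : ℤ) ∣ n then 0 else Real.exp (-Real.pi * t * n ^ 2)) ≤
      κ ^ κ * |(n : ℝ)| ^ (-(2 * κ)) * t ^ (-κ) := by
    split_ifs with hn
    · positivity
    have hn0 : n ≠ 0 := fun h => hn (h ▸ dvd_zero _)
    have hn' : 0 < |(n : ℝ)| := abs_pos.2 (by exact_mod_cast hn0)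
    have hy : 0 < t * |(n : ℝ)| ^ 2 := by positivity
    calc Real.exp (-Real.pi * t * n ^ 2) ≤ Real.exp (-(t * |(n : ℝ)| ^ 2)) := by
          rw [sq_abs] at hy ⊢
          rw [Real.exp_le_exp]
          nlinarith [Real.pi_gt_three]
      _ ≤ κ ^ κ * (t * |(n : ℝ)| ^ 2) ^ (-κ) := exp_neg_le_mul_rpow hκ0 hy
      _ = _ := by
        rw [Real.mul_rpow ht.le (by positivity), ← Real.rpow_natCast, ← Real.rpow_mul hn'.le]
        push_cast
        ring_nf
  calc primeTheta p t ≤ ∑' n : ℤ, κ ^ κ * |(n : ℝ)| ^ (-(2 * κ)) * t ^ (-κ) :=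
        (summable_primeTheta p ht).tsum_le_tsum hle ((hs.mul_left _).mul_right _)
    _ = _ := by rw [tsum_mul_right, tsum_mul_left]

theorem abs_primeTheta_sub_le : ∃ K > 0, ∀ (p : ℕ), p ≠ 0 → ∀ (t : ℝ), 0 < t →
    |primeTheta p t - (1 - 1 / (p : ℝ)) * t ^ (-(1 / 2 : ℝ))| ≤ K * t ^ (-(1 / 4 : ℝ)) := by
  obtain ⟨K, hK, h⟩ := abs_realTheta_sub_le
  obtain ⟨L, hL, hL'⟩ := primeTheta_le_rpow (κ := 1) (by norm_num)
  refine ⟨2 * K + L + 1, by positivity, fun p hp t ht => ?_⟩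
  have hp0 : (0 : ℝ) < p := by positivity
  rcases le_total t 1 with h1 | h1
  · have h2 : (1 : ℝ) ≤ t ^ (-(1 / 4 : ℝ)) := Real.one_le_rpow_of_pos_of_le_one_of_nonpos ht h1 (by norm_num)
    have e : ((p : ℝ) ^ 2 * t) ^ (-(1 / 2 : ℝ)) = 1 / p * t ^ (-(1 / 2 : ℝ)) := by
      rw [Real.mul_rpow (by positivity) ht.le, ← Real.rpow_natCast, ← Real.rpow_mul hp0.le]
      norm_num [Real.rpow_neg_one]
    rw [primeTheta_eq hp ht]
    have h3 := abs_le.1 (h t ht)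
    have h4 := abs_le.1 (h (p ^ 2 * t) (by positivity))
    rw [e] at h4
    calc _ ≤ 2 * K := by
          rw [abs_le]
          constructor <;> linarith
      _ ≤ (2 * K + L + 1) * 1 := by linarith
      _ ≤ _ := by gcongr
  · have h2 := hL' p t ht
    have h3 := primeTheta_nonneg p t
    have h4 : t ^ (-(1 : ℝ)) ≤ t ^ (-(1 / 4 : ℝ)) := Real.rpow_le_rpow_of_exponent_le h1 (by norm_num)
    have h5 : t ^ (-(1 / 2 : ℝ)) ≤ t ^ (-(1 / 4 : ℝ)) := Real.rpow_le_rpow_of_exponent_le h1 (by norm_num)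
    have h6 : 0 < t ^ (-(1 / 2 : ℝ)) := Real.rpow_pos_of_pos ht _
    have h7 : 1 / (p : ℝ) ≤ 1 := by
      rw [div_le_one hp0]
      exact_mod_cast Nat.one_le_iff_ne_zero.2 hp
    have h8 : 0 < 1 / (p : ℝ) := by positivity
    have h9 : L * t ^ (-(1 : ℝ)) ≤ L * t ^ (-(1 / 4 : ℝ)) := by gcongr
    rw [abs_le]
    constructor <;> nlinarith

/-- The Dirichlet series `∑ n ^ (-s)` over positive integers. -/
noncomputable def realZeta (s : ℝ) : ℝ := ∑' n : ℕ, ((n : ℝ) + 1) ^ (-s)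

theorem realZeta_pos {s : ℝ} (hs : 1 < s) : 0 < realZeta s := by
  have h : Summable fun n : ℕ => ((n : ℝ) + 1) ^ (-s) := by
    have := (summable_nat_add_iff 1).2 (Real.summable_nat_rpow.2 (show -s < -1 by linarith))
    simpa using this
  exact h.tsum_pos (fun n => by positivity) 0 (by positivity)

theorem tendsto_realZeta : Filter.Tendsto (fun s : ℝ => realZeta s - 1 / (s - 1))
    (nhdsWithin 1 (Set.Ioi 1)) (nhds Real.eulerMascheroniConstant) := by
  have h := (Complex.continuous_re.tendsto _).comp ZetaAsymptotics.tendsto_riemannZeta_sub_one_div_nhds_right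
  rw [ofReal_re] at h
  refine h.congr' ?_
  filter_upwards [self_mem_nhdsWithin] with s hs
  have : riemannZeta s - 1 / (s - 1) = ((realZeta s - 1 / (s - 1) : ℝ) : ℂ) := by
    rw [zeta_eq_tsum_one_div_nat_add_one_cpow (by simpa using hs), realZeta]
    push_cast
    congr 2
    ext n
    rw [ofReal_cpow (by positivity), one_div, ← Complex.cpow_neg]
    push_cast
    rfl
  rw [Function.comp_apply, this, ofReal_re]

theorem tsum_int_abs_rpow {s : ℝ} (hs : 1 < s) :
    ∑' n : ℤ, |(n : ℝ)| ^ (-s) = 2 * realZeta s := by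
  have h0 : Summable fun n : ℕ => (n : ℝ) ^ (-s) := Real.summable_nat_rpow.2 (by linarith)
  have h1 : Summable fun n : ℕ => ((n : ℝ) + 1) ^ (-s) := by
    simpa using (summable_nat_add_iff 1).2 h0
  have e (n : ℕ) : |(n : ℝ) + 1| = n + 1 := abs_of_pos (by positivity)
  have e' (n : ℕ) : |-1 + -(n : ℝ)| = n + 1 := by rw [← neg_add, abs_neg, add_comm, e]
  rw [tsum_of_nat_of_neg_add_one]
  · simp only [Int.cast_natCast, Nat.abs_cast]
    rw [h0.tsum_eq_zero_add]
    simp only [Nat.cast_zero, Nat.cast_add, Nat.cast_one, Int.cast_neg, Int.cast_add, Int.cast_natCast, Int.cast_one,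
      neg_add_rev, e', realZeta]
    rw [Real.zero_rpow (by linarith)]
    ring
  · simpa using h0
  · simpa [e'] using h1

theorem tsum_int_abs_rpow_prime {p : ℕ} (hp : p ≠ 0) {s : ℝ} (hs : 1 < s) :
    HasSum (fun n : ℤ => if (p : ℤ) ∣ n then 0 else |(n : ℝ)| ^ (-s))
      (2 * (1 - (p : ℝ) ^ (-s)) * realZeta s) := by
  have hp0 : (0 : ℝ) < p := by positivity
  have hsum : Summable fun n : ℤ => |(n : ℝ)| ^ (-s) := Real.summable_abs_int_rpow hs
  have hinj : Function.Injective fun n : ℤ => (p : ℤ) * n :=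
    mul_right_injective₀ (by exact_mod_cast hp)
  set g : ℤ → ℝ := fun n => if (p : ℤ) ∣ n then |(n : ℝ)| ^ (-s) else 0 with hg
  have h1 : ∑' n, g n = (p : ℝ) ^ (-s) * (2 * realZeta s) := by
    rw [← hinj.tsum_eq (f := g), ← tsum_int_abs_rpow hs, ← tsum_mul_left]
    · refine tsum_congr fun n => ?_
      rw [hg]
      simp only [dvd_mul_right, if_true]
      push_cast
      rw [abs_mul, abs_of_pos hp0, Real.mul_rpow hp0.le (abs_nonneg _)]
    · intro n hn
      by_contra h
      refine hn (if_neg fun h' => h ?_)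
      obtain ⟨m, hm⟩ := h'
      exact ⟨m, hm.symm⟩
  have hgs : Summable g := by
    refine hsum.of_nonneg_of_le (fun n => ?_) fun n => ?_ <;>
    · simp only [hg]
      split_ifs <;> first | positivity | exact le_rfl
  have h2 := hsum.hasSum.sub hgs.hasSum
  rw [h1, tsum_int_abs_rpow hs] at h2
  rw [show 2 * (1 - (p : ℝ) ^ (-s)) * realZeta s = 2 * realZeta s - p ^ (-s) * (2 * realZeta s) by ring]
  refine h2.congr_fun fun n => ?_
  simp only [hg]
  split_ifs <;> simp

/-- The diagonal weight in logarithmic coordinates. -/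
noncomputable def diagTheta (p : ℕ) (q : ℝ) (z : ℝ × ℝ) : ℝ :=
  primeTheta p ((Real.exp (z.1 + z.2) + Real.exp (z.1 - z.2)) / q)

theorem measurable_diagTheta (p : ℕ) (q : ℝ) : Measurable (diagTheta p q) := by
  unfold diagTheta primeTheta
  refine Measurable.tsum fun n => ?_
  split_ifs <;> fun_prop

theorem integral_diagTheta {p : ℕ} (hp : 1 < p) {q s : ℝ} (hq : 0 < q) (hs : 1 / 2 < s) :
    Integrable (fun z => Real.exp (s * z.1) * diagTheta p q z) ∧
    ∫ z, Real.exp (s * z.1) * diagTheta p q z =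
      (q / Real.pi) ^ s * Real.Gamma (s / 2) ^ 2 * (1 - (p : ℝ) ^ (-(2 * s))) * realZeta (2 * s) := by
  have hs0 : 0 < s := by linarith
  have hsum := tsum_int_abs_rpow_prime (p := p) (by omega) (show 1 < 2 * s by linarith)
  set F : ℤ → ℝ × ℝ → ℝ := fun n z => Real.exp (s * z.1) * (if (p : ℤ) ∣ n then 0 else
    Real.exp (-Real.pi * ((Real.exp (z.1 + z.2) + Real.exp (z.1 - z.2)) / q) * n ^ 2)) with hF
  have hF0 (n : ℤ) (z : ℝ × ℝ) : 0 ≤ F n z := mul_nonneg (Real.exp_pos _).le (primeTheta_term_nonneg p _ n)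
  have key (n : ℤ) : Integrable (F n) ∧ ∫ z, F n z =
      (1 / 2 * (q / Real.pi) ^ s * Real.Gamma (s / 2) ^ 2) * (if (p : ℤ) ∣ n then 0 else |(n : ℝ)| ^ (-(2 * s))) := by
    by_cases hn : (p : ℤ) ∣ n
    · have : F n = fun _ => 0 := by
        funext z
        simp only [hF, if_pos hn, mul_zero]
      rw [this, if_pos hn]
      simp
    have hn0 : n ≠ 0 := fun h => hn (h ▸ dvd_zero _)
    have hn' : 0 < |(n : ℝ)| := abs_pos.2 (by exact_mod_cast hn0)
    have hc : 0 < Real.pi / q * |(n : ℝ)| ^ 2 := by have := Real.pi_pos; positivity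
    have h := integral_exp_two_exp hs0 hc hc
    have e : F n = fun z : ℝ × ℝ => Real.exp (s * z.1) * Real.exp (-(Real.pi / q * |(n : ℝ)| ^ 2 *
        Real.exp (z.1 + z.2) + Real.pi / q * |(n : ℝ)| ^ 2 * Real.exp (z.1 - z.2))) := by
      funext z
      simp only [hF, if_neg hn]
      rw [sq_abs]
      ring_nf
    rw [e, if_neg hn]
    refine ⟨h.1, h.2.trans ?_⟩
    rw [← sq, ← Real.rpow_natCast, ← Real.rpow_mul hc.le, Real.mul_rpow (by have := Real.pi_pos; positivity) (by positivity),
      ← Real.rpow_natCast, ← Real.rpow_mul hn'.le, ← inv_div q, Real.inv_rpow (by have := Real.pi_pos; positivity),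
      ← Real.rpow_neg (by have := Real.pi_pos; positivity)]
    push_cast
    ring_nf
  have hnorm : Summable fun n => ∫ z, ‖F n z‖ := by
    have : (fun n => ∫ z, ‖F n z‖) = fun n =>
        (1 / 2 * (q / Real.pi) ^ s * Real.Gamma (s / 2) ^ 2) *
        (if (p : ℤ) ∣ n then 0 else |(n : ℝ)| ^ (-(2 * s))) := by
      funext n
      rw [← (key n).2]
      exact integral_congr_ae (Filter.Eventually.of_forall fun z => Real.norm_of_nonneg (hF0 n z))
    rw [this]
    exact hsum.summable.mul_left _
  have h := hasSum_integral_of_summable_integral_norm (fun n => (key n).1) hnorm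
  have h' := (hsum.mul_left (1 / 2 * (q / Real.pi) ^ s * Real.Gamma (s / 2) ^ 2))
  have h'' : HasSum (fun n => ∫ z, F n z) _ := h'.congr_fun fun n => (key n).2
  have e : ∀ z, ∑' n, F n z = Real.exp (s * z.1) * diagTheta p q z := fun z => by
    simp only [hF]
    rw [tsum_mul_left]
    rfl
  have hv := h.unique h''
  simp only [e] at hv
  have hv2 : ∫ z, Real.exp (s * z.1) * diagTheta p q z =
      (q / Real.pi) ^ s * Real.Gamma (s / 2) ^ 2 * (1 - (p : ℝ) ^ (-(2 * s))) * realZeta (2 * s) := by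
    rw [hv]; ring
  refine ⟨Integrable.of_integral_ne_zero ?_, hv2⟩
  rw [hv2]
  have h1 : (p : ℝ) ^ (-(2 * s)) < 1 := Real.rpow_lt_one_of_one_lt_of_neg (by exact_mod_cast hp) (by linarith)
  have h2 := realZeta_pos (show 1 < 2 * s by linarith)
  have h3 := Real.Gamma_pos_of_pos (half_pos hs0)
  have h4 : 0 < 1 - (p : ℝ) ^ (-(2 * s)) := by linarith
  have := Real.pi_pos
  positivity

theorem abs_sub_le_of_abs_mul_realZeta_sub_le {h J : ℝ → ℝ} {h' A J₀ E : ℝ}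
    (hh : HasDerivAt h h' (1 / 2))
    (hJ : Filter.Tendsto J (nhdsWithin (1 / 2) (Set.Ioi (1 / 2))) (nhds J₀))
    (hE : ∀ᶠ s in nhdsWithin (1 / 2 : ℝ) (Set.Ioi (1 / 2)),
      |h s * realZeta (2 * s) - A / (s - 1 / 2) - J s| ≤ E) :
    |Real.eulerMascheroniConstant * h (1 / 2) + h' / 2 - J₀| ≤ E := by
  set F := nhdsWithin (1 / 2 : ℝ) (Set.Ioi (1 / 2)) with hF
  have hle : F ≤ nhds (1 / 2) := nhdsWithin_le_nhds
  have hid : Filter.Tendsto (fun s : ℝ => s - 1 / 2) F (nhds 0) := by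
    have : Filter.Tendsto (fun s : ℝ => s - 1 / 2) (nhds (1 / 2)) (nhds (1 / 2 - 1 / 2)) :=
      Filter.Tendsto.sub_const Filter.tendsto_id _
    rw [sub_self] at this
    exact this.mono_left hle
  have hz : Filter.Tendsto (fun s : ℝ => realZeta (2 * s) - 1 / (2 * s - 1)) F
      (nhds Real.eulerMascheroniConstant) := by
    refine tendsto_realZeta.comp (tendsto_nhdsWithin_iff.2 ⟨?_, ?_⟩)
    · have : Filter.Tendsto (fun s : ℝ => 2 * s) (nhds (1 / 2)) (nhds (2 * (1 / 2))) :=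
        Filter.Tendsto.const_mul _ Filter.tendsto_id
      norm_num at this
      exact this.mono_left (by simpa using hle)
    · filter_upwards [self_mem_nhdsWithin] with s hs
      have : (1 / 2 : ℝ) < s := hs
      simp only [Set.mem_Ioi]
      linarith
  have hslope : Filter.Tendsto (fun s : ℝ => (s - 1 / 2)⁻¹ * (h s - h (1 / 2))) F (nhds h') := by
    have := (hasDerivAt_iff_tendsto_slope.1 hh)
    refine (this.mono_left (nhdsWithin_mono _ fun s hs => ?_)).congr fun s => ?_
    · exact ne_of_gt hs
    · rw [slope_def_field, div_eq_inv_mul]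
  have hR : Filter.Tendsto (fun s => (realZeta (2 * s) - 1 / (2 * s - 1)) * h s +
      (s - 1 / 2)⁻¹ * (h s - h (1 / 2)) / 2 - J s) F
      (nhds (Real.eulerMascheroniConstant * h (1 / 2) + h' / 2 - J₀)) :=
    ((hz.mul (hh.continuousAt.tendsto.mono_left hle)).add (hslope.div_const 2)).sub hJ
  set R := fun s => (realZeta (2 * s) - 1 / (2 * s - 1)) * h s +
      (s - 1 / 2)⁻¹ * (h s - h (1 / 2)) / 2 - J s with hRdef
  have hpos : ∀ᶠ s in F, 0 < s - 1 / 2 := by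
    filter_upwards [self_mem_nhdsWithin] with s hs
    exact sub_pos.2 hs
  have hdec : ∀ᶠ s in F, |R s + (h (1 / 2) / 2 - A) / (s - 1 / 2)| ≤ E := by
    filter_upwards [hE, hpos] with s hs hs0
    convert hs using 2
    have h1 : 2 * s - 1 ≠ 0 := by linarith
    have h2 : s - 1 / 2 = (2 * s - 1) / 2 := by ring
    simp only [hRdef]
    rw [h2]
    field_simp
    ring
  have hD : h (1 / 2) / 2 - A = 0 := by
    have h1 : Filter.Tendsto (fun s => |(s - 1 / 2) * R s + (h (1 / 2) / 2 - A)|) F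
        (nhds |0 * (Real.eulerMascheroniConstant * h (1 / 2) + h' / 2 - J₀) + (h (1 / 2) / 2 - A)|) :=
      ((hid.mul hR).add_const _).abs
    have h2 : Filter.Tendsto (fun s => (s - 1 / 2) * E) F (nhds (0 * E)) := hid.mul_const E
    have h3 := le_of_tendsto_of_tendsto h1 h2 (by
      filter_upwards [hdec, hpos] with s hs hs0
      have : (s - 1 / 2) * R s + (h (1 / 2) / 2 - A) =
          (s - 1 / 2) * (R s + (h (1 / 2) / 2 - A) / (s - 1 / 2)) := by
        rw [mul_add, mul_div_cancel₀ _ hs0.ne']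
      rw [this, abs_mul, abs_of_pos hs0]
      exact mul_le_mul_of_nonneg_left hs hs0.le)
    rw [zero_mul, zero_mul, zero_add] at h3
    exact abs_nonpos_iff.1 h3
  refine le_of_tendsto hR.abs ?_
  filter_upwards [hdec] with s hs
  rwa [hD, zero_div, add_zero] at hs

theorem hasDerivAt_diag_mellin {p : ℕ} (hp : 1 < p) {q : ℝ} (hq : 0 < q) :
    HasDerivAt (fun s : ℝ => (q / Real.pi) ^ s * Real.Gamma (s / 2) ^ 2 * (1 - (p : ℝ) ^ (-(2 * s))))
      ((q / Real.pi) ^ (1 / 2 : ℝ) * Real.Gamma (1 / 4) ^ 2 * (1 - 1 / (p : ℝ)) *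
        (Real.log (q / Real.pi) + deriv Real.Gamma (1 / 4) / Real.Gamma (1 / 4)
          + 2 * Real.log p / (p - 1))) (1 / 2) := by
  have hp0 : (0 : ℝ) < p := by positivity
  have hp1 : (1 : ℝ) < p := by exact_mod_cast hp
  have hG : Real.Gamma (1 / 4) ≠ 0 := (Real.Gamma_pos_of_pos (by norm_num)).ne'
  have h1 : HasDerivAt (fun s : ℝ => (q / Real.pi) ^ s) ((q / Real.pi) ^ (1 / 2 : ℝ) * Real.log (q / Real.pi)) (1 / 2) :=
    Real.hasStrictDerivAt_const_rpow (by have := Real.pi_pos; positivity) _ |>.hasDerivAt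
  have h2 : HasDerivAt (fun s : ℝ => Real.Gamma (s / 2)) (deriv Real.Gamma (1 / 4) * (1 / 2)) (1 / 2) := by
    have hd : HasDerivAt Real.Gamma (deriv Real.Gamma (1 / 4)) (1 / 2 / 2) := by
      rw [show (1 / 2 / 2 : ℝ) = 1 / 4 by norm_num]
      refine (Real.differentiableAt_Gamma fun m => ?_).hasDerivAt
      have : (0 : ℝ) ≤ m := Nat.cast_nonneg m
      linarith
    exact hd.comp (1 / 2 : ℝ) ((hasDerivAt_id (1 / 2 : ℝ)).div_const 2)
  have h3 : HasDerivAt (fun s : ℝ => (p : ℝ) ^ (-(2 * s))) ((p : ℝ) ^ (-(2 * (1 / 2)) : ℝ) * Real.log p * (-2)) (1 / 2) := by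
    have hd : HasDerivAt (fun x : ℝ => (p : ℝ) ^ x) ((p : ℝ) ^ (-(2 * (1 / 2)) : ℝ) * Real.log p) (-(2 * (1 / 2))) :=
      Real.hasStrictDerivAt_const_rpow hp0 _ |>.hasDerivAt
    refine hd.comp (1 / 2 : ℝ) ?_
    refine (((hasDerivAt_id (1 / 2 : ℝ)).const_mul 2).neg).congr_deriv ?_
    norm_num
  have h := (h1.mul (h2.pow 2)).mul (h3.const_sub 1)
  refine h.congr_deriv ?_
  rw [show (-(2 * (1 / 2)) : ℝ) = -1 by norm_num, Real.rpow_neg_one]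
  simp only [Pi.mul_apply, Pi.pow_apply, show (1 / 2 / 2 : ℝ) = 1 / 4 by norm_num]
  have hp2 : (p : ℝ) - 1 ≠ 0 := by linarith
  field_simp
  ring

theorem integral_exp_neg_mul_abs {κ : ℝ} (hκ : 0 < κ) :
    Integrable (fun x : ℝ => Real.exp (-κ * |x|)) ∧ ∫ x : ℝ, Real.exp (-κ * |x|) = 2 / κ := by
  have h : ∫ x : ℝ, Real.exp (-κ * |x|) = 2 / κ := by
    rw [integral_comp_abs (f := fun x => Real.exp (-κ * x)), integral_exp_neg_mul_Ioi hκ]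
    simp
    ring
  exact ⟨Integrable.of_integral_ne_zero (by rw [h]; positivity), h⟩

theorem diag_arg_rpow_le {q κ : ℝ} (hq : 0 < q) (hκ : 0 ≤ κ) (z : ℝ × ℝ) :
    ((Real.exp (z.1 + z.2) + Real.exp (z.1 - z.2)) / q) ^ (-κ) ≤
      q ^ κ * (Real.exp (-κ * z.1) * Real.exp (-κ * |z.2|)) := by
  have h1 : Real.exp (z.1 + |z.2|) ≤ Real.exp (z.1 + z.2) + Real.exp (z.1 - z.2) := by
    rcases abs_cases z.2 with ⟨h, _⟩ | ⟨h, _⟩ <;> rw [h]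
    · linarith [Real.exp_pos (z.1 - z.2)]
    · rw [← sub_eq_add_neg]
      linarith [Real.exp_pos (z.1 + z.2)]
  calc _ ≤ (Real.exp (z.1 + |z.2|) / q) ^ (-κ) := by
        refine Real.rpow_le_rpow_of_nonpos (by positivity) ?_ (by linarith)
        gcongr
    _ = _ := by
      rw [Real.div_rpow (Real.exp_pos _).le hq.le, ← Real.exp_mul, Real.rpow_neg hq.le, div_inv_eq_mul,
        ← Real.exp_add, mul_comm]
      ring_nf

theorem diagTheta_nonneg (p : ℕ) (q : ℝ) (z : ℝ × ℝ) : 0 ≤ diagTheta p q z := primeTheta_nonneg _ _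

theorem diagTheta_le {κ : ℝ} (hκ : 1 / 2 < κ) : ∃ K > 0, ∀ (p : ℕ) (q : ℝ), 0 < q → ∀ z : ℝ × ℝ,
    diagTheta p q z ≤ K * q ^ κ * (Real.exp (-κ * z.1) * Real.exp (-κ * |z.2|)) := by
  obtain ⟨K, hK, h⟩ := primeTheta_le_rpow hκ
  refine ⟨K, hK, fun p q hq z => ?_⟩
  refine (h p _ (by positivity)).trans ?_
  rw [mul_assoc]
  exact mul_le_mul_of_nonneg_left (diag_arg_rpow_le hq (by linarith) z) hK.le

theorem integrableOn_diagTheta (p : ℕ) {q : ℝ} (hq : 0 < q) :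
    IntegrableOn (fun z : ℝ × ℝ => Real.exp (z.1 / 2) * diagTheta p q z) (Set.Ioi 0 ×ˢ Set.univ) := by
  obtain ⟨K, hK, h⟩ := diagTheta_le (κ := 1) (by norm_num)
  refine integrableOn_prod_of_norm_le (A := fun x => K * q * Real.exp (-(1 / 2) * x))
    (B := fun y => Real.exp (-1 * |y|)) measurableSet_Ioi MeasurableSet.univ
    ((integrableOn_exp_neg_mul_Ioi (by norm_num) 0).const_mul _)
    (integral_exp_neg_mul_abs one_pos).1.integrableOn ?_ fun x _ y _ => ?_
  · exact ((by fun_prop : Measurable fun z : ℝ × ℝ => Real.exp (z.1 / 2)).mul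
      (measurable_diagTheta p q)).aestronglyMeasurable
  · rw [Real.norm_of_nonneg (mul_nonneg (Real.exp_pos _).le (diagTheta_nonneg _ _ _))]
    refine (mul_le_mul_of_nonneg_left (h p q hq (x, y)) (Real.exp_pos _).le).trans (le_of_eq ?_)
    rw [show (-(1 / 2) * x : ℝ) = x / 2 + -1 * x by ring, Real.exp_add, Real.rpow_one]
    ring

theorem tendsto_integral_diagTheta (p : ℕ) {q : ℝ} (hq : 0 < q) :
    Filter.Tendsto (fun s : ℝ => ∫ z in Set.Ioi (0 : ℝ) ×ˢ (Set.univ : Set ℝ), Real.exp (s * z.1) * diagTheta p q z)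
      (nhdsWithin (1 / 2) (Set.Ioi (1 / 2)))
      (nhds (∫ z in Set.Ioi (0 : ℝ) ×ˢ (Set.univ : Set ℝ), Real.exp (z.1 / 2) * diagTheta p q z)) := by
  obtain ⟨K, hK, h⟩ := diagTheta_le (κ := 1) (by norm_num)
  refine tendsto_integral_filter_of_dominated_convergence
    (fun z => K * q * Real.exp (-(1 / 4) * z.1) * Real.exp (-1 * |z.2|)) ?_ ?_ ?_ ?_
  · refine Filter.Eventually.of_forall fun s => ?_
    exact ((by fun_prop : Measurable fun z : ℝ × ℝ => Real.exp (s * z.1)).mul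
      (measurable_diagTheta p q)).aestronglyMeasurable
  · have : ∀ᶠ s in nhdsWithin (1 / 2 : ℝ) (Set.Ioi (1 / 2)), s < 3 / 4 :=
      nhdsWithin_le_nhds (Iio_mem_nhds (by norm_num))
    filter_upwards [this] with s hs
    refine (ae_restrict_iff' (measurableSet_Ioi.prod MeasurableSet.univ)).2
      (Filter.Eventually.of_forall fun z hz => ?_)
    have hz1 : 0 < z.1 := hz.1
    rw [Real.norm_of_nonneg (mul_nonneg (Real.exp_pos _).le (diagTheta_nonneg _ _ _))]
    have h1 : Real.exp (s * z.1) ≤ Real.exp (3 / 4 * z.1) := Real.exp_le_exp.2 (by nlinarith)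
    refine (mul_le_mul h1 (h p q hq z) (diagTheta_nonneg _ _ _) (Real.exp_pos _).le).trans (le_of_eq ?_)
    rw [show (-(1 / 4) * z.1 : ℝ) = 3 / 4 * z.1 + -1 * z.1 by ring, Real.exp_add, Real.rpow_one]
    ring
  · exact integrableOn_prod_mul ((integrableOn_exp_neg_mul_Ioi (by norm_num) 0).const_mul (K * q))
      (integral_exp_neg_mul_abs one_pos).1.integrableOn
  · refine Filter.Eventually.of_forall fun z => ?_
    refine Filter.Tendsto.mul_const _ ?_
    have : Continuous fun s : ℝ => Real.exp (s * z.1) := by fun_prop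
    have h2 := (this.tendsto (1 / 2)).mono_left (nhdsWithin_le_nhds (s := Set.Ioi (1 / 2 : ℝ)))
    rwa [show (1 / 2 * z.1 : ℝ) = z.1 / 2 by ring] at h2

/-- The main term of the diagonal contribution. -/
noncomputable def diagMain (p : ℕ) (q : ℝ) : ℝ :=
  1 / 2 * ((q / Real.pi) ^ (1 / 2 : ℝ) * Real.Gamma (1 / 4) ^ 2 * (1 - 1 / (p : ℝ)) *
    (2 * Real.eulerMascheroniConstant + Real.log (q / Real.pi) +
      deriv Real.Gamma (1 / 4) / Real.Gamma (1 / 4) + 2 * Real.log p / (p - 1)))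

theorem abs_integral_diagTheta_sub_le : ∃ K > 0, ∀ (p : ℕ) (q : ℝ), 1 < p → 0 < q →
    |(∫ z in Set.Ioi (0 : ℝ) ×ˢ (Set.univ : Set ℝ), Real.exp (z.1 / 2) * diagTheta p q z) - diagMain p q|
      ≤ K * q ^ (1 / 4 : ℝ) := by
  obtain ⟨K, hK, hKb⟩ := abs_primeTheta_sub_le
  refine ⟨K * 32, by positivity, fun p q hp hq => ?_⟩
  have hp0 : (0 : ℝ) < p := by positivity
  set U : ℝ → ℝ := fun y => ((Real.exp y + Real.exp (-y)) / q) ^ (-(1 / 2) : ℝ) with hU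
  set A : ℝ := (1 - 1 / (p : ℝ)) * ∫ y, U y with hA
  have hsplit (z : ℝ × ℝ) : ((Real.exp (z.1 + z.2) + Real.exp (z.1 - z.2)) / q) ^ (-(1 / 2) : ℝ) =
      Real.exp (-(1 / 2) * z.1) * U z.2 := by
    rw [hU]
    simp only
    rw [sub_eq_add_neg, Real.exp_add, Real.exp_add, ← mul_add, mul_div_assoc,
      Real.mul_rpow (Real.exp_pos _).le (by positivity), ← Real.exp_mul]
    ring_nf
  have hUi : Integrable U := by
    refine Integrable.mono' ((integral_exp_neg_mul_abs (κ := 1 / 2) (by norm_num)).1.const_mul (q ^ (1 / 2 : ℝ))) ?_ ?_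
    · exact (by fun_prop : Measurable U).aestronglyMeasurable
    · refine Filter.Eventually.of_forall fun y => ?_
      rw [Real.norm_of_nonneg (by positivity)]
      have := diag_arg_rpow_le hq (κ := 1 / 2) (by norm_num) (0, y)
      simpa [hU] using this
  have hJ := tendsto_integral_diagTheta p hq
  have key := abs_sub_le_of_abs_mul_realZeta_sub_le (A := A) (E := K * 32 * q ^ (1 / 4 : ℝ))
    (hasDerivAt_diag_mellin hp hq) hJ ?_
  · rw [abs_sub_comm]
    convert key using 2
    rw [diagMain]
    rw [show (-(2 * (1 / 2)) : ℝ) = -1 by norm_num, Real.rpow_neg_one, show (1 / 2 / 2 : ℝ) = 1 / 4 by norm_num]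
    ring
  have h34 : ∀ᶠ s in nhdsWithin (1 / 2 : ℝ) (Set.Ioi (1 / 2)), s < 3 / 4 :=
    nhdsWithin_le_nhds (Iio_mem_nhds (by norm_num))
  filter_upwards [h34, self_mem_nhdsWithin] with s hs3 hs
  have hs : 1 / 2 < s := hs
  obtain ⟨hMi, hM⟩ := integral_diagTheta hp hq hs
  have hcompl : (Set.Ioi (0 : ℝ) ×ˢ (Set.univ : Set ℝ))ᶜ = Set.Iic 0 ×ˢ Set.univ := by
    ext z; simp
  have h1 := integral_add_compl
    (measurableSet_Ioi.prod MeasurableSet.univ : MeasurableSet (Set.Ioi (0 : ℝ) ×ˢ (Set.univ : Set ℝ))) hMi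
  rw [hM, hcompl] at h1
  rw [← h1]
  have hexp : IntegrableOn (fun x => Real.exp ((s - 1 / 2) * x)) (Set.Iic 0) :=
    integrableOn_exp_mul_Iic (by linarith) 0
  have hZi : IntegrableOn (fun z : ℝ × ℝ => Real.exp ((s - 1 / 2) * z.1) * ((1 - 1 / (p : ℝ)) * U z.2))
      (Set.Iic 0 ×ˢ Set.univ) :=
    integrableOn_prod_mul hexp (hUi.const_mul _).integrableOn
  have hZ : ∫ z in Set.Iic (0 : ℝ) ×ˢ (Set.univ : Set ℝ), Real.exp ((s - 1 / 2) * z.1) * ((1 - 1 / (p : ℝ)) * U z.2)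
      = A / (s - 1 / 2) := by
    have := setIntegral_prod_mul (μ := volume) (ν := volume) (fun x => Real.exp ((s - 1 / 2) * x))
      (fun y => (1 - 1 / (p : ℝ)) * U y) (Set.Iic 0) Set.univ
    rw [Measure.volume_eq_prod, this, integral_exp_mul_Iic (by linarith), setIntegral_univ, integral_const_mul,
      mul_zero, Real.exp_zero, hA]
    ring
  rw [← hZ, add_sub_assoc, ← integral_sub hMi.integrableOn hZi, add_sub_cancel_left, ← Real.norm_eq_abs]
  have hE := integral_exp_neg_mul_abs (κ := 1 / 4) (by norm_num)
  have hexp4 : IntegrableOn (fun x => K * q ^ (1 / 4 : ℝ) * Real.exp ((s - 1 / 4) * x)) (Set.Iic 0) :=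
    (integrableOn_exp_mul_Iic (by linarith) 0).const_mul _
  have hv : ∫ x in Set.Iic (0 : ℝ), K * q ^ (1 / 4 : ℝ) * Real.exp ((s - 1 / 4) * x) =
      K * q ^ (1 / 4 : ℝ) / (s - 1 / 4) := by
    rw [integral_const_mul, integral_exp_mul_Iic (by linarith), mul_zero, Real.exp_zero]
    ring
  have hs4 : 0 < s - 1 / 4 := by linarith
  have := norm_setIntegral_prod_le (a := K * q ^ (1 / 4 : ℝ) * 4) (b := 8)
    (f := fun z : ℝ × ℝ => Real.exp (s * z.1) * diagTheta p q z -
      Real.exp ((s - 1 / 2) * z.1) * ((1 - 1 / (p : ℝ)) * U z.2))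
    measurableSet_Iic MeasurableSet.univ hexp4 hE.1.integrableOn (by rw [hv]; positivity)
    (by rw [setIntegral_univ, hE.2]; norm_num) ?_ (by rw [setIntegral_univ, hE.2]; norm_num) ?_
  · refine this.trans (le_of_eq (by ring))
  · rw [hv, div_eq_mul_inv]
    have : (s - 1 / 4)⁻¹ ≤ 4 := by
      rw [inv_le_comm₀ hs4 (by norm_num)]
      linarith
    gcongr
  · intro x _ y _
    have e : Real.exp (s * x) * diagTheta p q (x, y) - Real.exp ((s - 1 / 2) * x) * ((1 - 1 / (p : ℝ)) * U y) =
        Real.exp (s * x) * (diagTheta p q (x, y) - (1 - 1 / (p : ℝ)) *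
          ((Real.exp (x + y) + Real.exp (x - y)) / q) ^ (-(1 / 2) : ℝ)) := by
      rw [hsplit (x, y), show (s - 1 / 2) * x = s * x + -(1 / 2) * x by ring, Real.exp_add]
      ring
    rw [e, norm_mul, Real.norm_of_nonneg (Real.exp_pos _).le, Real.norm_eq_abs]
    have h2 := hKb p (by omega) ((Real.exp (x + y) + Real.exp (x - y)) / q) (by positivity)
    have h3 := diag_arg_rpow_le hq (κ := 1 / 4) (by norm_num) (x, y)
    calc _ ≤ Real.exp (s * x) * (K * (q ^ (1 / 4 : ℝ) * (Real.exp (-(1 / 4) * x) * Real.exp (-(1 / 4) * |y|)))) := by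
          refine mul_le_mul_of_nonneg_left (h2.trans ?_) (Real.exp_pos _).le
          exact mul_le_mul_of_nonneg_left h3 hK.le
      _ = _ := by
        rw [show (s - 1 / 4) * x = s * x + -(1 / 4) * x by ring, Real.exp_add]
        ring

/-! ### Splitting the second moment -/

theorem star_mul_self_char {p k : ℕ} (hp : p.Prime) (hk : k ≠ 0) (χ : DirichletCharacter ℂ (p ^ k)) (n : ℤ) :
    χ n * (starRingEnd ℂ) (χ n) = if (p : ℤ) ∣ n then 0 else 1 := by
  have : NeZero (p ^ k) := ⟨pow_ne_zero k hp.ne_zero⟩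
  have hu : IsUnit ((n : ℤ) : ZMod (p ^ k)) ↔ ¬ (p : ℤ) ∣ n := by
    rw [ZMod.coe_int_isUnit_iff_isCoprime, Nat.cast_pow, IsCoprime.pow_left_iff (Nat.pos_of_ne_zero hk),
      (Nat.prime_iff_prime_int.1 hp).irreducible.coprime_iff_not_dvd]
  split_ifs with h
  · rw [χ.map_nonunit (fun h' => hu.1 h' h), zero_mul]
  · obtain ⟨u, hu'⟩ := hu.2 h
    rw [mul_conj, ← hu', normSq_eq_norm_sq, χ.unit_norm_eq_one]
    simp

/-- The off-diagonal part of `cosetTheta`. -/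
noncomputable def offTheta {N : ℕ} (χ : DirichletCharacter ℂ N) (M : ℕ) (z : ℝ × ℝ) : ℂ :=
  ∑' v : ℤ × ℤ, if v.1 = v.2 then 0 else cosetTerm χ M z v

theorem summable_offTheta {N : ℕ} [NeZero N] (χ : DirichletCharacter ℂ N) (M : ℕ) (z : ℝ × ℝ) :
    Summable fun v : ℤ × ℤ => if v.1 = v.2 then 0 else cosetTerm χ M z v := by
  refine Summable.of_norm_bounded (summable_pairWeight (N := N) z) fun v => ?_
  split_ifs
  · rw [norm_zero]; exact (pairWeight_pos N z v).le
  · exact norm_cosetTerm_le χ M z v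

theorem cosetTheta_eq_add {p k : ℕ} (hp : p.Prime) (hk : k ≠ 0) (χ : DirichletCharacter ℂ (p ^ k))
    (M : ℕ) (z : ℝ × ℝ) :
    cosetTheta χ M z = (diagTheta p (p ^ k : ℝ) z : ℝ) + offTheta χ M z := by
  have : NeZero (p ^ k) := ⟨pow_ne_zero k hp.ne_zero⟩
  have hinj : Function.Injective fun n : ℤ => ((n, n) : ℤ × ℤ) := fun a b h => (Prod.ext_iff.1 h).1
  have hd : ((diagTheta p (p ^ k : ℝ) z : ℝ) : ℂ) =
      ∑' v : ℤ × ℤ, if v.1 = v.2 then cosetTerm χ M z v else 0 := by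
    rw [← hinj.tsum_eq, diagTheta, primeTheta, ofReal_tsum]
    · refine tsum_congr fun n => ?_
      simp only [if_true, cosetTerm, Int.ModEq.refl, star_mul_self_char hp hk]
      split_ifs
      · simp
      · rw [one_mul, pairWeight, ← Real.exp_add]
        push_cast
        congr 1
        ring
    · intro v hv
      by_contra h
      refine hv (if_neg fun h' => h ⟨v.1, ?_⟩)
      ext <;> simp [h']
  have hs : Summable fun v : ℤ × ℤ => if v.1 = v.2 then cosetTerm χ M z v else 0 := by
    refine Summable.of_norm_bounded (summable_pairWeight (N := p ^ k) z) fun v => ?_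
    split_ifs
    · exact norm_cosetTerm_le χ M z v
    · rw [norm_zero]; exact (pairWeight_pos _ z v).le
  rw [hd, offTheta, ← hs.tsum_add (summable_offTheta χ M z), cosetTheta]
  refine tsum_congr fun v => ?_
  split_ifs <;> simp

theorem cosetTheta_neg {N : ℕ} (χ : DirichletCharacter ℂ N) (M : ℕ) (x y : ℝ) :
    cosetTheta χ M (x, -y) = (starRingEnd ℂ) (cosetTheta χ M (x, y)) := by
  rw [cosetTheta, cosetTheta, conj_tsum, ← (Equiv.prodComm ℤ ℤ).tsum_eq]
  refine tsum_congr fun v => ?_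
  simp only [cosetTerm, Equiv.prodComm_apply, Prod.fst_swap, Prod.snd_swap, pairWeight,
    Int.modEq_comm (a := v.2)]
  split_ifs
  · simp only [map_mul, conj_conj, conj_ofReal, ofReal_mul, sub_neg_eq_add, ← sub_eq_add_neg]
    ring
  · simp

theorem diagTheta_neg (p : ℕ) (q x y : ℝ) : diagTheta p q (x, -y) = diagTheta p q (x, y) := by
  simp only [diagTheta, sub_neg_eq_add, ← sub_eq_add_neg]
  rw [add_comm]

theorem offTheta_neg {p k : ℕ} (hp : p.Prime) (hk : k ≠ 0) (χ : DirichletCharacter ℂ (p ^ k))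
    (M : ℕ) (x y : ℝ) :
    offTheta χ M (x, -y) = (starRingEnd ℂ) (offTheta χ M (x, y)) := by
  have h1 := cosetTheta_eq_add hp hk χ M (x, -y)
  rw [cosetTheta_neg, cosetTheta_eq_add hp hk, map_add, conj_ofReal, diagTheta_neg] at h1
  exact (add_left_cancel h1).symm

theorem re_setIntegral_eq_two_mul {f : ℝ × ℝ → ℂ}
    (hf : IntegrableOn f (Set.Ioi (0 : ℝ) ×ˢ (Set.univ : Set ℝ)))
    (he : ∀ x y, f (x, -y) = (starRingEnd ℂ) (f (x, y))) :
    (∫ z in Set.Ioi (0 : ℝ) ×ˢ (Set.univ : Set ℝ), f z).re =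
      2 * (∫ z in Set.Ioi (0 : ℝ) ×ˢ Set.Iic (0 : ℝ), f z).re := by
  have hu : (Set.univ : Set ℝ) = Set.Iic 0 ∪ Set.Ioi 0 := Set.Iic_union_Ioi.symm
  have hf1 := hf.mono_set (Set.prod_mono_right (Set.subset_univ (Set.Iic (0 : ℝ))))
  have hf2 := hf.mono_set (Set.prod_mono_right (Set.subset_univ (Set.Ioi (0 : ℝ))))
  have key : ∫ z in Set.Ioi (0 : ℝ) ×ˢ Set.Ioi (0 : ℝ), f z =
      (starRingEnd ℂ) (∫ z in Set.Ioi (0 : ℝ) ×ˢ Set.Iic (0 : ℝ), f z) := by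
    rw [← integral_conj]
    have h1 : _ = ∫ x in Set.Ioi (0 : ℝ), ∫ y in Set.Ioi (0 : ℝ), f (x, y) :=
      setIntegral_prod (μ := volume) (ν := volume) f hf2
    have h2 : _ = ∫ x in Set.Ioi (0 : ℝ), ∫ y in Set.Iic (0 : ℝ), (starRingEnd ℂ) (f (x, y)) :=
      setIntegral_prod (μ := volume) (ν := volume) (fun z => (starRingEnd ℂ) (f z))
        (conjCLE.toContinuousLinearMap.integrable_comp hf1)
    refine h1.trans (Eq.trans ?_ h2.symm)
    refine integral_congr_ae (Filter.Eventually.of_forall fun x => ?_)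
    simp only [← he]
    rw [integral_comp_neg_Iic 0 (fun y => f (x, y)), neg_zero]
  rw [hu, Set.prod_union, setIntegral_union _ (measurableSet_Ioi.prod measurableSet_Ioi) hf1 hf2, key,
    add_re, conj_re, two_mul]
  exact Set.disjoint_prod.2 (Or.inr (Set.Iic_disjoint_Ioi le_rfl))

theorem integrable_cosetTheta {p j k : ℕ} (hp : p.Prime) (hjk : j < k)
    {χ : DirichletCharacter ℂ (p ^ k)} (hχ : χ.IsPrimitive) :
    Integrable fun z : ℝ × ℝ => (Real.exp (z.1 / 2) : ℂ) * cosetTheta χ (p ^ j) z := by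
  have hq : 1 < p ^ k := Nat.one_lt_pow (by omega) hp.one_lt
  have hφ : ((p ^ j).totient : ℂ) ≠ 0 := by
    exact_mod_cast (Nat.totient_pos.2 (pow_pos hp.pos j)).ne'
  have := (integrable_finsetSum Finset.univ fun ψ (_ : ψ ∈ (Finset.univ : Finset (DirichletCharacter ℂ (p ^ j)))) =>
    integrable_thetaPair hq (isPrimitive_mul_changeLevel hp hjk hχ ψ)).const_mul ((p ^ j).totient : ℂ)⁻¹
  refine this.congr (Filter.Eventually.of_forall fun z => ?_)
  simp only
  rw [← Finset.mul_sum, sum_thetaPair hp hjk.le χ z]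
  field_simp

open Classical in
theorem sum_norm_LFunction_eq {p j k : ℕ} (hp : p.Prime) (hjk : j < k) [NeZero (p ^ k)]
    {χ : DirichletCharacter ℂ (p ^ k)} (hχ : χ.IsPrimitive) (hev : χ.Even) :
    √((p ^ k : ℕ) / Real.pi) * Real.Gamma (1 / 4) ^ 2 * (∑ ψ : DirichletCharacter ℂ (p ^ j),
      if ψ.Even then
        ‖(χ * DirichletCharacter.changeLevel (pow_dvd_pow p hjk.le) ψ).LFunction (1 / 2)‖ ^ 2
      else 0) =
    (p ^ j).totient * (∫ z in Set.Ioi (0 : ℝ) ×ˢ (Set.univ : Set ℝ),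
      (Real.exp (z.1 / 2) : ℂ) * cosetTheta χ (p ^ j) z).re := by
  have hq : 1 < p ^ k := Nat.one_lt_pow (by omega) hp.one_lt
  have hpair ψ := (integrable_thetaPair hq (isPrimitive_mul_changeLevel hp hjk hχ ψ)).integrableOn
    (s := Set.Ioi (0 : ℝ) ×ˢ (Set.univ : Set ℝ))
  have key : ((√((p ^ k : ℕ) / Real.pi) * Real.Gamma (1 / 4) ^ 2 * (∑ ψ : DirichletCharacter ℂ (p ^ j),
      if ψ.Even then
        ‖(χ * DirichletCharacter.changeLevel (pow_dvd_pow p hjk.le) ψ).LFunction (1 / 2)‖ ^ 2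
      else 0) : ℝ) : ℂ) = (p ^ j).totient * (∫ z in Set.Ioi (0 : ℝ) ×ˢ (Set.univ : Set ℝ),
      (Real.exp (z.1 / 2) : ℂ) * cosetTheta χ (p ^ j) z) := by
    rw [Finset.mul_sum, ofReal_sum, ← integral_const_mul]
    simp only [mul_left_comm _ ((Real.exp _ : ℝ) : ℂ), ← sum_thetaPair hp hjk.le χ, Finset.mul_sum]
    rw [integral_finsetSum _ fun ψ _ => hpair ψ]
    refine Finset.sum_congr rfl fun ψ _ => ?_
    have hcl : (DirichletCharacter.changeLevel (pow_dvd_pow p hjk.le) ψ) (-1) = ψ (-1) := by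
      have := DirichletCharacter.changeLevel_eq_cast_of_dvd ψ (pow_dvd_pow p hjk.le) (-1)
      simpa [ZMod.cast_neg (pow_dvd_pow p hjk.le), ZMod.cast_one (pow_dvd_pow p hjk.le)] using this
    split_ifs with h
    · refine norm_LFunction_sq_eq hq (isPrimitive_mul_changeLevel hp hjk hχ ψ) ?_
      rw [DirichletCharacter.Even, MulChar.mul_apply, hcl, h, hev, one_mul]
    · have h2 : ψ.Odd := ψ.even_or_odd.resolve_left h
      have h3 : (χ * DirichletCharacter.changeLevel (pow_dvd_pow p hjk.le) ψ).Odd := by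
        rw [DirichletCharacter.Odd, MulChar.mul_apply, hcl, h2, hev, one_mul]
      simp [thetaPair, charTheta_eq_zero_of_odd h3]
  have := congrArg re key
  rwa [ofReal_re, ← ofReal_natCast, re_ofReal_mul] at this

open Classical in
/-- The second moment in terms of the theta integrals over the region split at height `c`. -/
theorem sum_norm_LFunction_eq_split {p j k : ℕ} (hp : p.Prime) (hjk : j < k) [NeZero (p ^ k)]
    {χ : DirichletCharacter ℂ (p ^ k)} (hχ : χ.IsPrimitive) (hev : χ.Even) {c : ℝ} (hc : c ≤ 0) :
    √((p ^ k : ℕ) / Real.pi) * Real.Gamma (1 / 4) ^ 2 * (∑ ψ : DirichletCharacter ℂ (p ^ j),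
      if ψ.Even then
        ‖(χ * DirichletCharacter.changeLevel (pow_dvd_pow p hjk.le) ψ).LFunction (1 / 2)‖ ^ 2
      else 0) =
    (p ^ j).totient * ((∫ z in Set.Ioi (0 : ℝ) ×ˢ (Set.univ : Set ℝ),
        Real.exp (z.1 / 2) * diagTheta p (p ^ k : ℝ) z) -
      2 * (∫ z in Set.Ioi (0 : ℝ) ×ˢ Set.Iic c, Real.exp (z.1 / 2) * diagTheta p (p ^ k : ℝ) z) +
      2 * (∫ z in Set.Ioi (0 : ℝ) ×ˢ Set.Iic c, (Real.exp (z.1 / 2) : ℂ) * cosetTheta χ (p ^ j) z).re +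
      2 * (∫ z in Set.Ioi (0 : ℝ) ×ˢ Set.Ioc c 0,
        (Real.exp (z.1 / 2) : ℂ) * offTheta χ (p ^ j) z).re) := by
  have hk : k ≠ 0 := by omega
  have hq0 : (0 : ℝ) < p ^ k := pow_pos (by exact_mod_cast hp.pos) k
  rw [sum_norm_LFunction_eq hp hjk hχ hev]
  congr 1
  have hs := (integrable_cosetTheta hp hjk hχ).integrableOn (s := Set.Ioi (0 : ℝ) ×ˢ (Set.univ : Set ℝ))
  have hd := integrableOn_diagTheta p hq0
  have hdc : IntegrableOn (fun z => (Real.exp (z.1 / 2) : ℂ) * (diagTheta p (p ^ k : ℝ) z : ℝ))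
      (Set.Ioi (0 : ℝ) ×ˢ (Set.univ : Set ℝ)) := by
    have h : IntegrableOn (fun z => ((Real.exp (z.1 / 2) * diagTheta p (p ^ k : ℝ) z : ℝ) : ℂ))
      (Set.Ioi (0 : ℝ) ×ˢ (Set.univ : Set ℝ)) := Integrable.ofReal hd
    simpa only [ofReal_mul] using h
  have heq (z : ℝ × ℝ) : (Real.exp (z.1 / 2) : ℂ) * offTheta χ (p ^ j) z =
      (Real.exp (z.1 / 2) : ℂ) * cosetTheta χ (p ^ j) z - (Real.exp (z.1 / 2) : ℂ) * (diagTheta p (p ^ k : ℝ) z : ℝ) := by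
    rw [cosetTheta_eq_add hp hk]; ring
  have ho : IntegrableOn (fun z => (Real.exp (z.1 / 2) : ℂ) * offTheta χ (p ^ j) z)
      (Set.Ioi (0 : ℝ) ×ˢ (Set.univ : Set ℝ)) := by
    simp only [heq]
    exact hs.sub hdc
  have hre (S : Set (ℝ × ℝ)) : (∫ z in S, (Real.exp (z.1 / 2) : ℂ) * (diagTheta p (p ^ k : ℝ) z : ℝ)).re =
      ∫ z in S, Real.exp (z.1 / 2) * diagTheta p (p ^ k : ℝ) z := by
    simp only [← ofReal_mul]
    exact (congrArg re integral_complex_ofReal).trans (ofReal_re _)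
  have h1 := re_setIntegral_eq_two_mul ho fun x y => by
    simp only [offTheta_neg hp hk, map_mul, conj_ofReal]
  have hsub (A : Set ℝ) : (Set.Ioi (0 : ℝ) ×ˢ A) ⊆ Set.Ioi (0 : ℝ) ×ˢ Set.univ :=
    Set.prod_mono_right (Set.subset_univ _)
  have h2 : ∫ z in Set.Ioi (0 : ℝ) ×ˢ Set.Iic (0 : ℝ), (Real.exp (z.1 / 2) : ℂ) * offTheta χ (p ^ j) z =
      (∫ z in Set.Ioi (0 : ℝ) ×ˢ Set.Iic c, (Real.exp (z.1 / 2) : ℂ) * offTheta χ (p ^ j) z) +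
      ∫ z in Set.Ioi (0 : ℝ) ×ˢ Set.Ioc c 0, (Real.exp (z.1 / 2) : ℂ) * offTheta χ (p ^ j) z := by
    rw [← setIntegral_union _ (measurableSet_Ioi.prod measurableSet_Ioc) (ho.mono_set (hsub _)) (ho.mono_set (hsub _)),
      ← Set.prod_union, Set.Iic_union_Ioc_eq_Iic hc]
    exact Set.disjoint_prod.2 (Or.inr (Set.Iic_disjoint_Ioc le_rfl))
  have h3 := integral_sub hs hdc
  have h4 := integral_sub (hs.mono_set (hsub (Set.Iic c))) (hdc.mono_set (hsub (Set.Iic c)))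
  simp only [← heq] at h3 h4
  have h5 := congrArg re h3
  have h6 := congrArg re h4
  have h7 := congrArg re h2
  rw [sub_re, hre] at h5 h6
  rw [add_re] at h7
  linarith

theorem abs_integral_diagTheta_Iic_le {κ : ℝ} (hκ : 1 / 2 < κ) : ∃ K > 0, ∀ (p : ℕ) (q c : ℝ), 0 < q → c ≤ 0 →
    |∫ z in Set.Ioi (0 : ℝ) ×ˢ Set.Iic c, Real.exp (z.1 / 2) * diagTheta p q z| ≤
      K * (q ^ κ * Real.exp (κ * c)) := by
  obtain ⟨K, hK, hKb⟩ := diagTheta_le hκ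
  have hκ0 : 0 < κ := by linarith
  refine ⟨K / (κ - 1 / 2) / κ, div_pos (div_pos hK (by linarith)) hκ0, fun p q c hq hc => ?_⟩
  have hA := (integrableOn_exp_neg_mul_Ioi (a := κ - 1 / 2) (by linarith) 0).const_mul (K * q ^ κ)
  have hB := integrableOn_exp_mul_Iic hκ0 c
  have := norm_setIntegral_prod_le (f := fun z => Real.exp (z.1 / 2) * diagTheta p q z)
    measurableSet_Ioi measurableSet_Iic hA hB
    (setIntegral_nonneg measurableSet_Ioi fun x _ => by positivity)
    (setIntegral_nonneg measurableSet_Iic fun x _ => by positivity) le_rfl le_rfl ?_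
  · rw [Real.norm_eq_abs] at this
    refine this.trans_eq ?_
    rw [integral_const_mul, integral_exp_neg_mul_Ioi (by linarith), integral_exp_mul_Iic hκ0]
    simp
    ring
  · intro x _ y hy
    have hy' : y ≤ 0 := (Set.mem_Iic.1 hy).trans hc
    have h := hKb p q hq (x, y)
    rw [Real.norm_of_nonneg (mul_nonneg (Real.exp_pos _).le (diagTheta_nonneg _ _ _))]
    refine (mul_le_mul_of_nonneg_left h (Real.exp_pos _).le).trans_eq ?_
    simp only [abs_of_nonpos hy']
    rw [show -(κ - 1 / 2) * x = x / 2 + -κ * x by ring, Real.exp_add, show -κ * -y = κ * y by ring]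
    ring

theorem summable_sqrt_padicVal_mul_rpow {κ : ℝ} (hκ : 1 / 2 < κ) : ∃ K > 0, ∀ p : ℕ, p.Prime →
    (Summable fun l : ℤ => √((p : ℝ) ^ padicValInt p l) * |(l : ℝ)| ^ (-(2 * κ))) ∧
    ∑' l : ℤ, √((p : ℝ) ^ padicValInt p l) * |(l : ℝ)| ^ (-(2 * κ)) ≤ K := by
  have hs1 : Summable fun l : ℤ => |(l : ℝ)| ^ (-(2 * κ)) := Real.summable_abs_int_rpow (by linarith)
  have h2 : (√2)⁻¹ < 1 := inv_lt_one_of_one_lt₀ (Real.lt_sqrt_of_sq_lt (by norm_num))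
  have hs2 : Summable fun g : ℕ => (√2)⁻¹ ^ g := summable_geometric_of_lt_one (by positivity) h2
  have hs := hs2.mul_of_nonneg hs1 (fun _ => by positivity) (fun _ => by positivity)
  set H : ℕ × ℤ → ℝ := fun x => (√2)⁻¹ ^ x.1 * |(x.2 : ℝ)| ^ (-(2 * κ)) with hH
  have hH0 (x) : 0 ≤ H x := by positivity
  refine ⟨∑' x, H x, hs.tsum_pos hH0 (0, 1) (by simp [hH]), fun p hp => ?_⟩
  have hpf : Fact p.Prime := ⟨hp⟩
  have hdvd (l : ℤ) : (p : ℤ) ^ padicValInt p l ∣ l := padicValInt_dvd l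
  set ι : ℤ → ℕ × ℤ := fun l => (padicValInt p l, l / (p : ℤ) ^ padicValInt p l) with hι
  have hinj : Function.Injective ι := by
    intro l l' h
    have h1 : padicValInt p l = padicValInt p l' := (Prod.ext_iff.1 h).1
    have h2 : l / (p : ℤ) ^ padicValInt p l = l' / (p : ℤ) ^ padicValInt p l' := (Prod.ext_iff.1 h).2
    rw [← Int.mul_ediv_cancel' (hdvd l), h2, h1, Int.mul_ediv_cancel' (hdvd l')]
  have hle (l : ℤ) : √((p : ℝ) ^ padicValInt p l) * |(l : ℝ)| ^ (-(2 * κ)) ≤ H (ι l) := by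
    simp only [hH, hι]
    set g := padicValInt p l
    obtain ⟨m, hm⟩ := hdvd l
    have hp0 : (0 : ℝ) < p := by exact_mod_cast hp.pos
    have hp2 : (2 : ℝ) ≤ p := by exact_mod_cast hp.two_le
    have hpg : (1 : ℝ) ≤ (p : ℝ) ^ g := one_le_pow₀ (by linarith)
    have hdiv : l / (p : ℤ) ^ g = m := by
      rw [hm, Int.mul_ediv_cancel_left _ (pow_ne_zero _ (by exact_mod_cast hp.ne_zero))]
    rw [hdiv]
    have hl : (l : ℝ) = (p : ℝ) ^ g * m := by
      have := congrArg (Int.cast : ℤ → ℝ) hm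
      push_cast at this
      exact this
    rw [hl, abs_mul, abs_of_pos (by positivity : (0 : ℝ) < (p : ℝ) ^ g), Real.mul_rpow (by positivity) (abs_nonneg _),
      ← mul_assoc]
    refine mul_le_mul_of_nonneg_right ?_ (by positivity)
    calc √((p : ℝ) ^ g) * ((p : ℝ) ^ g) ^ (-(2 * κ)) ≤ √((p : ℝ) ^ g) * ((p : ℝ) ^ g) ^ (-1 : ℝ) := by
          gcongr
          linarith
      _ = (√((p : ℝ) ^ g))⁻¹ := by
          rw [Real.rpow_neg_one]
          nth_rewrite 2 [← Real.mul_self_sqrt (by positivity : (0 : ℝ) ≤ (p : ℝ) ^ g)]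
          have : √((p : ℝ) ^ g) ≠ 0 := by positivity
          field_simp
      _ ≤ (√2)⁻¹ ^ g := by
          have : √2 ^ g ≤ √((p : ℝ) ^ g) := by
            rw [Real.le_sqrt (by positivity) (by positivity), ← pow_mul, mul_comm, pow_mul, Real.sq_sqrt (by norm_num)]
            gcongr
          rw [inv_pow]
          exact inv_anti₀ (by positivity) this
  have hsc : Summable (H ∘ ι) := hs.comp_injective hinj
  have hsum := hsc.of_nonneg_of_le (fun l => by positivity) hle
  refine ⟨hsum, (hsum.tsum_le_tsum hle hsc).trans ?_⟩
  exact tsum_comp_le_tsum_of_inj hs hH0 hinj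

theorem norm_tsum_zmod_gaussian_le {N : ℕ} [NeZero N] (g : ZMod N → ℂ) {a G : ℝ} (b : ℝ) (ha : 0 < a)
    (hg : ∀ h, ‖zmodFourier g h‖ ≤ G) :
    ‖∑' n : ℤ, g n * cexp (-Real.pi * a * n ^ 2 + 2 * Real.pi * b * n)‖ ≤
      G / (N * √a) * Real.exp (Real.pi * b ^ 2 / a) * realTheta (1 / (a * N ^ 2)) := by
  have hN : (0 : ℝ) < N := by exact_mod_cast NeZero.pos N
  have hG : 0 ≤ G := (norm_nonneg _).trans (hg 0)
  rw [tsum_zmod_gaussian g (a := (a : ℂ)) (by simpa using ha) b, norm_mul]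
  have h1 : ‖(1 : ℂ) / (N * (a : ℂ) ^ (1 / 2 : ℂ))‖ = 1 / (N * √a) := by
    rw [norm_div, norm_one, norm_mul, norm_natCast, Real.sqrt_eq_rpow]
    congr 2
    rw [show (1 / 2 : ℂ) = ((1 / 2 : ℝ) : ℂ) by push_cast; rfl, ← ofReal_cpow ha.le, norm_real,
      Real.norm_of_nonneg (by positivity)]
  have h2 (h : ℤ) : ‖cexp (-Real.pi / (a * N ^ 2) * (h + I * (b * N)) ^ 2)‖ =
      Real.exp (Real.pi * b ^ 2 / a) * Real.exp (-Real.pi * (1 / (a * N ^ 2)) * h ^ 2) := by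
    rw [norm_exp, ← Real.exp_add]
    congr 1
    rw [show (-Real.pi / (a * N ^ 2) * (h + I * (b * N)) ^ 2 : ℂ) =
      ((-Real.pi / (a * N ^ 2) * (h ^ 2 - (b * N) ^ 2) : ℝ) : ℂ) +
        ((-Real.pi / (a * N ^ 2) * (2 * h * (b * N)) : ℝ) : ℂ) * I by
      push_cast
      linear_combination (-Real.pi / (a * N ^ 2) * (b * N) ^ 2 : ℂ) * I_sq]
    rw [add_re, ofReal_re, re_ofReal_mul, I_re]
    field_simp
    ring
  have hs := (summable_real_gaussian (c := 1 / (a * N ^ 2)) (by positivity)).mul_left (G * Real.exp (Real.pi * b ^ 2 / a))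
  have h3 := tsum_of_norm_bounded (f := fun h : ℤ => zmodFourier g h * cexp (-Real.pi / (a * N ^ 2) * (h + I * (b * N)) ^ 2))
    hs.hasSum fun h => by
      rw [norm_mul, h2, mul_assoc G]
      exact mul_le_mul_of_nonneg_right (hg _) (by positivity)
  rw [h1]
  refine (mul_le_mul_of_nonneg_left h3 (by positivity)).trans_eq ?_
  rw [tsum_mul_left, realTheta]
  ring

theorem exists_norm_tsum_mul_pairWeight_le : ∃ K > 0, ∀ (N q : ℕ) [NeZero N] [NeZero q] (g : ZMod N → ℂ) (G : ℝ),
    (∀ h, ‖zmodFourier g h‖ ≤ G) → ∀ (z : ℝ × ℝ) (Δ : ℤ), 0 ≤ z.1 → z.2 ≤ 0 →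
    ‖∑' n : ℤ, g n * pairWeight q z (n + Δ, n)‖ ≤
      K * G * (√q / N + 1) * Real.exp (-(Real.pi / 2) * (Real.exp (z.1 + z.2) * Δ ^ 2 / q)) := by
  obtain ⟨K, hK, hKb⟩ := realTheta_le
  refine ⟨K, hK, fun N q _ _ g G hg z Δ hz1 hz2 => ?_⟩
  have hN : (0 : ℝ) < N := by exact_mod_cast NeZero.pos N
  have hq : (0 : ℝ) < q := by exact_mod_cast NeZero.pos q
  have hG : 0 ≤ G := (norm_nonneg _).trans (hg 0)
  set X := Real.exp (z.1 + z.2) with hX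
  set Y := Real.exp (z.1 - z.2) with hY
  have hX0 : 0 < X := Real.exp_pos _
  have hXY : X ≤ Y := Real.exp_le_exp.2 (by linarith)
  have hY1 : 1 ≤ Y := Real.one_le_exp (by linarith)
  set A := (X + Y) / q with hA
  have hA0 : 0 < A := by positivity
  set B := -(X * Δ / q) with hB
  have h1 (n : ℤ) : g n * pairWeight q z (n + Δ, n) = Real.exp (-Real.pi * (X * Δ ^ 2 / q)) *
      (g n * cexp (-Real.pi * A * n ^ 2 + 2 * Real.pi * B * n)) := by
    rw [pairWeight, ← Real.exp_add, ← hX, ← hY, mul_left_comm, ofReal_exp, ofReal_exp, ← Complex.exp_add]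
    congr 2
    rw [hA, hB]
    push_cast
    ring
  simp only [h1]
  rw [tsum_mul_left, norm_mul, norm_real, Real.norm_of_nonneg (Real.exp_pos _).le]
  refine (mul_le_mul_of_nonneg_left (norm_tsum_zmod_gaussian_le g B hA0 hg) (Real.exp_pos _).le).trans ?_
  have h2 : G / (N * √A) * realTheta (1 / (A * N ^ 2)) ≤ K * G * (√q / N + 1) := by
    have hs : 0 < √A := Real.sqrt_pos.2 hA0
    have e : (1 / (A * N ^ 2)) ^ (-(1 / 2) : ℝ) = N * √A := by
      rw [Real.rpow_neg (by positivity), ← Real.sqrt_eq_rpow, one_div, Real.sqrt_inv, inv_inv,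
        Real.sqrt_mul hA0.le, Real.sqrt_sq hN.le, mul_comm]
    have h3 := hKb (1 / (A * N ^ 2)) (by positivity)
    rw [e] at h3
    have h4 : 1 / √A ≤ √q := by
      rw [div_le_iff₀ hs, ← Real.sqrt_mul hq.le, hA, mul_div_cancel₀ _ hq.ne']
      exact Real.one_le_sqrt.2 (by linarith)
    calc G / (N * √A) * realTheta (1 / (A * N ^ 2)) ≤ G / (N * √A) * (K * (1 + N * √A)) := by gcongr
      _ = K * G * (1 / √A / N + 1) := by field_simp
      _ ≤ _ := by gcongr
  have h5 : Real.exp (-Real.pi * (X * Δ ^ 2 / q)) * Real.exp (Real.pi * B ^ 2 / A) ≤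
      Real.exp (-(Real.pi / 2) * (X * Δ ^ 2 / q)) := by
    rw [← Real.exp_add]
    refine Real.exp_le_exp.2 ?_
    have h6 : B ^ 2 / A ≤ 1 / 2 * (X * Δ ^ 2 / q) := by
      rw [hB, hA]
      have : (-(X * Δ / q)) ^ 2 / ((X + Y) / q) = X / (X + Y) * (X * Δ ^ 2 / q) := by
        field_simp
      rw [this]
      refine mul_le_mul_of_nonneg_right ?_ (by positivity)
      rw [div_le_iff₀ (by positivity)]
      linarith
    rw [show Real.pi * B ^ 2 / A = Real.pi * (B ^ 2 / A) by ring]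
    have := mul_le_mul_of_nonneg_left h6 Real.pi_pos.le
    linarith
  calc _ = (G / (N * √A) * realTheta (1 / (A * N ^ 2))) *
        (Real.exp (-Real.pi * (X * Δ ^ 2 / q)) * Real.exp (Real.pi * B ^ 2 / A)) := by ring
    _ ≤ _ := mul_le_mul h2 h5 (by positivity) (by positivity)

theorem char_mul_conj_char {p j k : ℕ} (hp : p.Prime) {χ : DirichletCharacter ℂ (p ^ k)} {a b : ℤ}
    (hχ : ∀ x : ℤ, χ ((1 + p ^ j * x : ℤ) : ZMod (p ^ k)) = eN (p ^ (k - j)) (a * (x - b * p ^ j * x ^ 2)))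
    {n r : ℤ} (hr : n * r ≡ 1 [ZMOD (p ^ k : ℕ)]) (l : ℤ) :
    χ ((n + p ^ j * l : ℤ) : ZMod (p ^ k)) * (starRingEnd ℂ) (χ n) =
      eN (p ^ (k - j)) (a * (l * r - b * p ^ j * (l * r) ^ 2)) := by
  have : NeZero (p ^ k) := ⟨pow_ne_zero k hp.ne_zero⟩
  have hr' : (n : ZMod (p ^ k)) * r = 1 := by
    have := (ZMod.intCast_eq_intCast_iff _ _ _).2 hr
    push_cast at this ⊢
    exact this
  have h1 : χ n * χ r = 1 := by rw [← map_mul, hr', map_one]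
  have h2 : (starRingEnd ℂ) (χ n) = χ r := by
    have hu : IsUnit (n : ZMod (p ^ k)) := IsUnit.of_mul_eq_one _ hr'
    have h3 : χ n * (starRingEnd ℂ) (χ n) = 1 := by
      rw [mul_conj, ← hu.unit_spec, normSq_eq_norm_sq, χ.unit_norm_eq_one]
      simp
    exact mul_left_cancel₀ (left_ne_zero_of_mul_eq_one h1) (h3.trans h1.symm)
  rw [h2, ← map_mul, ← hχ]
  congr 1
  push_cast
  linear_combination hr'

open Classical in
/-- The inverse phase attached to a shifted product of characters. -/
theorem char_shift_eq_invPhase {p j k g : ℕ} (hp : p.Prime) (hj : 0 < j) (hg : g < k - j)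
    {χ : DirichletCharacter ℂ (p ^ k)} {a b : ℤ}
    (hχ : ∀ x : ℤ, χ ((1 + p ^ j * x : ℤ) : ZMod (p ^ k)) = eN (p ^ (k - j)) (a * (x - b * p ^ j * x ^ 2)))
    (m n : ℤ) [NeZero (p ^ (k - j - g))] :
    χ ((n + p ^ j * (p ^ g * m) : ℤ) : ZMod (p ^ k)) * (starRingEnd ℂ) (χ n) =
      if IsUnit (n : ZMod (p ^ (k - j - g))) then
        ZMod.stdAddChar (((a * m : ℤ) : ZMod (p ^ (k - j - g))) * (n : ZMod (p ^ (k - j - g)))⁻¹ +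
          p * ((-(a * b * p ^ (j + g - 1) * m ^ 2) : ℤ) : ZMod (p ^ (k - j - g))) *
            (n : ZMod (p ^ (k - j - g)))⁻¹ ^ 2 : ZMod (p ^ (k - j - g))) else 0 := by
  have hcop (w : ℕ) (hw : w ≠ 0) : IsUnit (n : ZMod (p ^ w)) ↔ ¬ (p : ℤ) ∣ n := by
    rw [ZMod.coe_int_isUnit_iff_isCoprime, Nat.cast_pow, IsCoprime.pow_left_iff (Nat.pos_of_ne_zero hw),
      (Nat.prime_iff_prime_int.1 hp).irreducible.coprime_iff_not_dvd]
  split_ifs with h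
  · have hn : ¬ (p : ℤ) ∣ n := (hcop _ (by omega)).1 h
    have hu : IsUnit (n : ZMod (p ^ k)) := (hcop k (by omega)).2 hn
    obtain ⟨r, hr⟩ := ZMod.intCast_surjective ((n : ZMod (p ^ k))⁻¹)
    have hr1 : n * r ≡ 1 [ZMOD (p ^ k : ℕ)] := by
      rw [← ZMod.intCast_eq_intCast_iff]
      push_cast
      rw [hr, ZMod.mul_inv_of_unit _ hu]
    have hr2 : (n : ZMod (p ^ (k - j - g))) * r = 1 := by
      have := (ZMod.intCast_eq_intCast_iff _ _ (p ^ (k - j - g))).2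
        (hr1.of_dvd (by exact_mod_cast pow_dvd_pow p (by omega)))
      push_cast at this ⊢
      exact this
    have hr3 : (n : ZMod (p ^ (k - j - g)))⁻¹ = r := by
      rw [← one_mul ((n : ZMod (p ^ (k - j - g)))⁻¹), ← hr2, mul_right_comm, ZMod.mul_inv_of_unit _ h, one_mul]
    rw [char_mul_conj_char hp hχ hr1]
    have e1 : p ^ (k - j) = p ^ g * p ^ (k - j - g) := by rw [← pow_add]; congr 1; omega
    have e2 : a * (p ^ g * m * r - b * p ^ j * (p ^ g * m * r) ^ 2) =
        ((p ^ g : ℕ) : ℤ) * (a * m * r + p * (-(a * b * p ^ (j + g - 1) * m ^ 2)) * r ^ 2) := by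
      obtain ⟨i, hi⟩ : ∃ i, j = i + 1 := ⟨j - 1, by omega⟩
      rw [hi, show i + 1 + g - 1 = i + g by omega]
      push_cast
      ring
    rw [e1, e2, eN_mul_left (pow_ne_zero g hp.ne_zero), eN_eq_stdAddChar, hr3]
    push_cast
    rfl
  · have hn : ¬ IsUnit (n : ZMod (p ^ k)) := fun h' => h ((hcop _ (by omega)).2 ((hcop k (by omega)).1 h'))
    rw [χ.map_nonunit hn, map_zero, mul_zero]

theorem padicValInt_eq_of_not_dvd {p : ℕ} (hp : p.Prime) (l : ℤ) (hl : l ≠ 0) :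
    ∃ m : ℤ, l = p ^ padicValInt p l * m ∧ ¬ (p : ℤ) ∣ m := by
  have : Fact p.Prime := ⟨hp⟩
  obtain ⟨m, hm⟩ := padicValInt_dvd (p := p) l
  refine ⟨m, hm, fun ⟨m', hm'⟩ => ?_⟩
  have : (p : ℤ) ^ (padicValInt p l + 1) ∣ l := ⟨m', by rw [hm' ] at hm; rw [pow_succ, mul_assoc]; exact hm⟩
  rw [padicValInt_dvd_iff] at this
  omega

theorem exists_norm_tsum_shift_le : ∃ K > 0, ∀ (p j k : ℕ), p.Prime → p ≠ 2 → 0 < j → 2 * j ≤ k →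
    ∀ (χ : DirichletCharacter ℂ (p ^ k)) (a b : ℤ), ¬ (p : ℤ) ∣ a →
    (∀ x : ℤ, χ ((1 + p ^ j * x : ℤ) : ZMod (p ^ k)) = eN (p ^ (k - j)) (a * (x - b * p ^ j * x ^ 2))) →
    ∀ (z : ℝ × ℝ) (l : ℤ), 0 ≤ z.1 → z.2 ≤ 0 → l ≠ 0 →
    ‖∑' n : ℤ, χ ((n + p ^ j * l : ℤ) : ZMod (p ^ k)) * (starRingEnd ℂ) (χ n) *
        pairWeight (p ^ k) z (n + p ^ j * l, n)‖ ≤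
      K * (√((p : ℝ) ^ (k - j)) * √((p : ℝ) ^ padicValInt p l) *
        Real.exp (-(Real.pi / 2) * (Real.exp (z.1 + z.2) * (p ^ j * l : ℤ) ^ 2 / (p ^ k : ℕ)))) := by
  classical
  obtain ⟨K, hK, h⟩ := exists_norm_tsum_mul_pairWeight_le
  refine ⟨4 * K, by positivity, fun p j k hp hp2 hj hjk χ a b ha hχ z l hz1 hz2 hl => ?_⟩
  have hq0 : NeZero (p ^ k) := ⟨pow_ne_zero k hp.ne_zero⟩
  have hpf : Fact p.Prime := ⟨hp⟩
  have hp1 : (1 : ℝ) ≤ p := by exact_mod_cast hp.one_le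
  set E := Real.exp (-(Real.pi / 2) * (Real.exp (z.1 + z.2) * (p ^ j * l : ℤ) ^ 2 / (p ^ k : ℕ))) with hE
  have hE0 : 0 < E := Real.exp_pos _
  have hkj : (√((p ^ k : ℕ) : ℝ)) = √((p : ℝ) ^ j) * √((p : ℝ) ^ (k - j)) := by
    rw [← Real.sqrt_mul (by positivity), ← pow_add]
    push_cast
    congr 2; omega
  have hjf : √((p : ℝ) ^ j) ≤ √((p : ℝ) ^ (k - j)) :=
    Real.sqrt_le_sqrt (pow_le_pow_right₀ hp1 (by omega))
  have hf1 : 1 ≤ √((p : ℝ) ^ (k - j)) := Real.one_le_sqrt.2 (one_le_pow₀ hp1)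
  have hj1 : 1 ≤ √((p : ℝ) ^ j) := Real.one_le_sqrt.2 (one_le_pow₀ hp1)
  set g := padicValInt p l with hg
  have hg1 : 1 ≤ √((p : ℝ) ^ g) := Real.one_le_sqrt.2 (one_le_pow₀ hp1)
  obtain ⟨m, hm, hpm⟩ := padicValInt_eq_of_not_dvd hp l hl
  rcases lt_or_ge g (k - j) with hgf | hgf
  · set w := k - j - g with hw
    have hN0 : NeZero (p ^ w) := ⟨pow_ne_zero w hp.ne_zero⟩
    have hα : IsUnit ((a * m : ℤ) : ZMod (p ^ w)) := by
      rw [ZMod.coe_int_isUnit_iff_isCoprime, Nat.cast_pow, IsCoprime.pow_left_iff (by omega),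
        (Nat.prime_iff_prime_int.1 hp).irreducible.coprime_iff_not_dvd]
      intro h'
      exact ((Nat.prime_iff_prime_int.1 hp).dvd_or_dvd h').elim ha hpm
    have key := h (p ^ w) (p ^ k) (fun r : ZMod (p ^ w) => if IsUnit r then
        ZMod.stdAddChar (((a * m : ℤ) : ZMod (p ^ w)) * r⁻¹ +
          p * ((-(a * b * p ^ (j + g - 1) * m ^ 2) : ℤ) : ZMod (p ^ w)) *
            r⁻¹ ^ 2 : ZMod (p ^ w)) else 0) (2 * √((p : ℝ) ^ w))
      (fun h => norm_invSum_le hp2 (by omega) hα _ h) z (p ^ j * l) hz1 hz2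
    rw [← hE] at key
    have hrw (n : ℤ) := char_shift_eq_invPhase hp hj hgf hχ m n
    rw [← hg] at hm
    rw [← hm] at hrw
    simp only [hrw]
    refine key.trans ?_
    have hwg : √((p : ℝ) ^ w) * √((p : ℝ) ^ g) = √((p : ℝ) ^ (k - j)) := by
      rw [← Real.sqrt_mul (by positivity), ← pow_add]
      congr 2; omega
    have hww : ((p ^ w : ℕ) : ℝ) = √((p : ℝ) ^ w) * √((p : ℝ) ^ w) := by
      rw [Real.mul_self_sqrt (by positivity)]; push_cast; rfl
    have hw1 : 1 ≤ √((p : ℝ) ^ w) := Real.one_le_sqrt.2 (one_le_pow₀ hp1)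
    rw [hkj, hww, ← hwg]
    rw [← hwg] at hjf
    set W := √((p : ℝ) ^ w)
    set G := √((p : ℝ) ^ g)
    set J := √((p : ℝ) ^ j)
    have : 2 * W * (J * (W * G) / (W * W) + 1) ≤ 4 * (W * G * G) := by
      have e : 2 * W * (J * (W * G) / (W * W) + 1) = 2 * (J * G) + 2 * W := by field_simp
      rw [e]
      have h1 : J * G ≤ W * G * G := by gcongr
      have h2 : W * 1 * 1 ≤ W * G * G := by gcongr
      linarith
    calc _ = K * (2 * W * (J * (W * G) / (W * W) + 1)) * E := by ring
      _ ≤ K * (4 * (W * G * G)) * E := by gcongr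
      _ = _ := by ring
  · have hz : ∀ r, ‖zmodFourier (fun _ : ZMod 1 => (1 : ℂ)) r‖ ≤ 1 := fun r => by
      have : (Finset.univ : Finset (ZMod 1)) = {0} := rfl
      rw [zmodFourier, this, Finset.sum_singleton, norm_mul, norm_zmod_stdAddChar, norm_one, one_mul]
    have key := h 1 (p ^ k) (fun _ => 1) 1 hz z (p ^ j * l) hz1 hz2
    rw [← hE] at key
    have hsum : Summable fun n : ℤ => pairWeight (p ^ k) z (n + p ^ j * l, n) :=
      (summable_pairWeight z).comp_injective (i := fun n : ℤ => (n + p ^ j * l, n)) fun a b h => (Prod.ext_iff.1 h).2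
    have h1 := tsum_of_norm_bounded (f := fun n : ℤ => χ ((n + p ^ j * l : ℤ) : ZMod (p ^ k)) * (starRingEnd ℂ) (χ n) *
        pairWeight (p ^ k) z (n + p ^ j * l, n)) hsum.hasSum fun n =>
          norm_char_mul_pairWeight_le χ z (n + p ^ j * l, n)
    refine h1.trans ?_
    simp only [one_mul] at key
    rw [← ofReal_tsum, norm_real, Real.norm_of_nonneg (tsum_nonneg fun n => (pairWeight_pos _ _ _).le)] at key
    refine key.trans ?_
    have hfg : √((p : ℝ) ^ (k - j)) ≤ √((p : ℝ) ^ g) :=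
      Real.sqrt_le_sqrt (pow_le_pow_right₀ hp1 hgf)
    rw [hkj]
    set F := √((p : ℝ) ^ (k - j))
    set G := √((p : ℝ) ^ g)
    set J := √((p : ℝ) ^ j)
    have h2 : J * F ≤ G * F := by gcongr; linarith
    have h3 : 1 * 1 ≤ G * F := by gcongr
    calc _ = K * (J * F + 1) * E := by push_cast; ring
      _ ≤ K * (4 * (F * G)) * E := by gcongr; linarith
      _ = _ := by ring

theorem offTheta_eq_tsum {p k : ℕ} (hp : p.Prime) (χ : DirichletCharacter ℂ (p ^ k)) (j : ℕ) (z : ℝ × ℝ) :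
    offTheta χ (p ^ j) z = ∑' l : ℤ, if l = 0 then 0 else
      ∑' n : ℤ, χ ((n + p ^ j * l : ℤ) : ZMod (p ^ k)) * (starRingEnd ℂ) (χ n) *
        pairWeight (p ^ k) z (n + p ^ j * l, n) := by
  have : NeZero (p ^ k) := ⟨pow_ne_zero k hp.ne_zero⟩
  have hpj : (p : ℤ) ^ j ≠ 0 := pow_ne_zero j (by exact_mod_cast hp.ne_zero)
  set ι : ℤ × ℤ → ℤ × ℤ := fun x => (x.2 + p ^ j * x.1, x.2) with hι
  have hinj : Function.Injective ι := by
    intro x y h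
    have h2 : x.2 = y.2 := (Prod.ext_iff.1 h).2
    have h1 : x.2 + p ^ j * x.1 = y.2 + p ^ j * y.1 := (Prod.ext_iff.1 h).1
    rw [h2, add_left_cancel_iff] at h1
    exact Prod.ext (mul_left_cancel₀ hpj h1) h2
  have hs := (summable_offTheta χ (p ^ j) z).comp_injective hinj
  rw [offTheta, ← hinj.tsum_eq]
  · have h := hs.tsum_prod
    simp only [Function.comp_def] at h
    rw [h]
    refine tsum_congr fun l => ?_
    split_ifs with hl
    · simp [hι, hl]
    · refine tsum_congr fun n => ?_
      have h1 : ¬ n + p ^ j * l = n := by simp [hl, hp.ne_zero]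
      have h2 : n + p ^ j * l ≡ n [ZMOD (p ^ j : ℕ)] := by
        rw [Int.modEq_comm, Int.modEq_iff_dvd]
        exact ⟨l, by push_cast; ring⟩
      simp only [hι, if_neg h1, cosetTerm, if_pos h2]
  · intro v hv
    by_contra h
    refine hv ?_
    simp only
    split_ifs with h'
    · rfl
    · rw [cosetTerm, if_neg]
      intro h2
      obtain ⟨l, hl⟩ := (Int.modEq_iff_dvd.1 h2.symm)
      refine h ⟨(l, v.2), Prod.ext ?_ rfl⟩
      simp only [hι]
      push_cast at hl
      linarith

theorem exists_norm_offTheta_le {κ : ℝ} (hκ : 1 / 2 < κ) : ∃ K > 0, ∀ (p j k : ℕ), p.Prime → p ≠ 2 → 0 < j →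
    2 * j ≤ k → ∀ (χ : DirichletCharacter ℂ (p ^ k)) (a b : ℤ), ¬ (p : ℤ) ∣ a →
    (∀ x : ℤ, χ ((1 + p ^ j * x : ℤ) : ZMod (p ^ k)) = eN (p ^ (k - j)) (a * (x - b * p ^ j * x ^ 2))) →
    ∀ z : ℝ × ℝ, 0 ≤ z.1 → z.2 ≤ 0 →
    ‖offTheta χ (p ^ j) z‖ ≤ K * √((p : ℝ) ^ (k - j)) *
      (Real.exp (z.1 + z.2) * (((p : ℝ) ^ j) ^ 2 / (p : ℝ) ^ k)) ^ (-κ) := by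
  obtain ⟨K, hK, h⟩ := exists_norm_tsum_shift_le
  obtain ⟨L, hL, hL'⟩ := summable_sqrt_padicVal_mul_rpow hκ
  have hκ0 : 0 < κ := by linarith
  refine ⟨K * κ ^ κ * L, by positivity, fun p j k hp hp2 hj hjk χ a b ha hχ z hz1 hz2 => ?_⟩
  have hp0 : (0 : ℝ) < p := by exact_mod_cast hp.pos
  obtain ⟨hs, hsL⟩ := hL' p hp
  set y := Real.exp (z.1 + z.2) * (((p : ℝ) ^ j) ^ 2 / (p : ℝ) ^ k) with hy
  have hy0 : 0 < y := by positivity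
  rw [offTheta_eq_tsum hp]
  have key := tsum_of_norm_bounded (f := fun l : ℤ => if l = 0 then 0 else
      ∑' n : ℤ, χ ((n + p ^ j * l : ℤ) : ZMod (p ^ k)) * (starRingEnd ℂ) (χ n) *
        pairWeight (p ^ k) z (n + p ^ j * l, n))
    (hs.hasSum.mul_left (K * √((p : ℝ) ^ (k - j)) * (κ ^ κ * y ^ (-κ)))) fun l => ?_
  · refine key.trans ?_
    calc _ ≤ K * √((p : ℝ) ^ (k - j)) * (κ ^ κ * y ^ (-κ)) * L := by gcongr
      _ = _ := by ring
  split_ifs with hl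
  · rw [norm_zero]; positivity
  · refine (h p j k hp hp2 hj hjk χ a b ha hχ z l hz1 hz2 hl).trans ?_
    have hl0 : 0 < |(l : ℝ)| := abs_pos.2 (by exact_mod_cast hl)
    have e : Real.exp (z.1 + z.2) * ((p ^ j * l : ℤ) : ℝ) ^ 2 / (p ^ k : ℕ) = y * |(l : ℝ)| ^ 2 := by
      rw [hy, sq_abs]
      push_cast
      ring
    have h1 : Real.exp (-(Real.pi / 2) * (y * |(l : ℝ)| ^ 2)) ≤ κ ^ κ * y ^ (-κ) * |(l : ℝ)| ^ (-(2 * κ)) := by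
      calc _ ≤ Real.exp (-(y * |(l : ℝ)| ^ 2)) := by
            refine Real.exp_le_exp.2 ?_
            have h0 : 0 ≤ y * |(l : ℝ)| ^ 2 := by positivity
            have := Real.pi_gt_three
            nlinarith
        _ ≤ κ ^ κ * (y * |(l : ℝ)| ^ 2) ^ (-κ) := exp_neg_le_mul_rpow hκ0 (by positivity)
        _ = _ := by
          rw [Real.mul_rpow hy0.le (by positivity), ← Real.rpow_natCast |(l : ℝ)| 2, ← Real.rpow_mul (by positivity)]
          push_cast
          rw [show (2 : ℝ) * -κ = -(2 * κ) by ring]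
          ring
    rw [e]
    calc _ ≤ K * (√((p : ℝ) ^ (k - j)) * √((p : ℝ) ^ padicValInt p l) *
        (κ ^ κ * y ^ (-κ) * |(l : ℝ)| ^ (-(2 * κ)))) := by gcongr
      _ = _ := by ring

theorem exists_norm_integral_offTheta_le {κ : ℝ} (hκ : 1 / 2 < κ) : ∃ K > 0, ∀ (p j k : ℕ), p.Prime → p ≠ 2 →
    0 < j → 2 * j ≤ k → ∀ (χ : DirichletCharacter ℂ (p ^ k)) (a b : ℤ), ¬ (p : ℤ) ∣ a →
    (∀ x : ℤ, χ ((1 + p ^ j * x : ℤ) : ZMod (p ^ k)) = eN (p ^ (k - j)) (a * (x - b * p ^ j * x ^ 2))) →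
    ∀ c ≤ 0, ‖∫ z in Set.Ioi (0 : ℝ) ×ˢ Set.Ioc c 0, (Real.exp (z.1 / 2) : ℂ) * offTheta χ (p ^ j) z‖ ≤
      K * (√((p : ℝ) ^ (k - j)) * (((p : ℝ) ^ j) ^ 2 / (p : ℝ) ^ k) ^ (-κ) * Real.exp (-κ * c)) := by
  obtain ⟨K, hK, h⟩ := exists_norm_offTheta_le hκ
  have hκ0 : 0 < κ := by linarith
  have hκ1 : 0 < κ - 1 / 2 := by linarith
  refine ⟨K / (κ - 1 / 2) / κ, by positivity, fun p j k hp hp2 hj hjk χ a b ha hχ c hc => ?_⟩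
  have hp0 : (0 : ℝ) < p := by exact_mod_cast hp.pos
  set y : ℝ := ((p : ℝ) ^ j) ^ 2 / (p : ℝ) ^ k with hy
  have hy0 : 0 < y := by positivity
  have hA := (integrableOn_exp_neg_mul_Ioi hκ1 0).const_mul (K * √((p : ℝ) ^ (k - j)) * y ^ (-κ))
  have hB' := integrableOn_exp_neg_mul_Ioi hκ0 c
  have hB := hB'.mono_set (Set.Ioc_subset_Ioi_self : Set.Ioc c 0 ⊆ Set.Ioi c)
  have hb : ∫ x in Set.Ioc c 0, Real.exp (-κ * x) ≤ Real.exp (-κ * c) / κ := by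
    rw [← integral_exp_neg_mul_Ioi hκ0 c]
    exact setIntegral_mono_set hB' (Filter.Eventually.of_forall fun x => (Real.exp_pos _).le)
      (Filter.Eventually.of_forall Set.Ioc_subset_Ioi_self)
  have := norm_setIntegral_prod_le (f := fun z => (Real.exp (z.1 / 2) : ℂ) * offTheta χ (p ^ j) z)
    measurableSet_Ioi measurableSet_Ioc hA hB
    (setIntegral_nonneg measurableSet_Ioi fun x _ => by positivity)
    (setIntegral_nonneg measurableSet_Ioc fun x _ => by positivity) le_rfl hb ?_
  · refine this.trans_eq ?_
    rw [integral_const_mul, integral_exp_neg_mul_Ioi hκ1]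
    simp
    ring
  · intro x hx v hv
    rw [norm_mul, norm_real, Real.norm_of_nonneg (Real.exp_pos _).le]
    refine (mul_le_mul_of_nonneg_left (h p j k hp hp2 hj hjk χ a b ha hχ (x, v) (Set.mem_Ioi.1 hx).le hv.2)
      (Real.exp_pos _).le).trans_eq ?_
    simp only
    rw [Real.mul_rpow (Real.exp_pos _).le hy0.le, ← Real.exp_mul,
      show -(κ - 1 / 2) * x = x / 2 + x * -κ by ring, Real.exp_add,
      show (x + v) * -κ = x * -κ + -κ * v by ring, Real.exp_add]
    ring

/-! ### The dual sum over a coset -/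

theorem sum_eN_quadratic_split {p : ℕ} (hp : p.Prime) (j w : ℕ) (α D : ℤ) :
    ∑ t ∈ Finset.range (p ^ (j + w)), eN (p ^ (j + w)) (α * t + D * p ^ j * t ^ 2) =
    (∑ y ∈ Finset.range (p ^ w), eN (p ^ (j + w)) (α * y + D * p ^ j * y ^ 2)) *
      if ((p ^ j : ℕ) : ℤ) ∣ α then ((p ^ j : ℕ) : ℂ) else 0 := by
  have h1 : NeZero (p ^ (j + w)) := ⟨pow_ne_zero _ hp.ne_zero⟩
  have h2 : NeZero (p ^ j) := ⟨pow_ne_zero _ hp.ne_zero⟩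
  rw [show Finset.range (p ^ (j + w)) = Finset.range (p ^ w * p ^ j) by rw [← pow_add, add_comm],
    sum_range_mul_eq, Finset.sum_mul]
  refine Finset.sum_congr rfl fun y _ => ?_
  rw [← sum_range_eN, Finset.mul_sum]
  refine Finset.sum_congr rfl fun t _ => ?_
  rw [← eN_mul_left (pow_ne_zero w hp.ne_zero) (p ^ j) (α * t),
    show p ^ w * p ^ j = p ^ (j + w) by rw [← pow_add, add_comm], ← eN_add]
  refine eN_congr ?_
  rw [Int.modEq_iff_dvd]
  refine ⟨-(D * (2 * y * t + p ^ w * t ^ 2)), ?_⟩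
  push_cast
  ring

theorem sum_eN_complete_square {N : ℕ} [NeZero N] {T D r : ℤ} (h : T ≡ -(2 * D * r) [ZMOD N]) :
    ∑ y ∈ Finset.range N, eN N (T * y + D * y ^ 2) = eN N (-(D * r ^ 2)) * quadGauss D N := by
  have hT : (T : ZMod N) = -(2 * D * r) := by
    have := (ZMod.intCast_eq_intCast_iff _ _ _).2 h
    push_cast at this
    exact this
  have h1 : ∑ y ∈ Finset.range N, eN N (T * y + D * y ^ 2) =
      ∑ y : ZMod N, ZMod.stdAddChar (T * y + D * y ^ 2 : ZMod N) := by
    rw [sum_zmod_eq_sum_range]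
    refine Finset.sum_congr rfl fun y _ => ?_
    rw [eN_eq_stdAddChar]
    push_cast
    rfl
  rw [h1, quadGauss_eq, ← Equiv.sum_comp (Equiv.addRight (r : ZMod N)), Finset.mul_sum]
  refine Finset.sum_congr rfl fun y _ => ?_
  rw [eN_eq_stdAddChar, ← AddChar.map_add_eq_mul, Equiv.coe_addRight, hT]
  congr 1
  push_cast
  ring

theorem norm_ite_one_I (P : Prop) [Decidable P] : ‖(if P then 1 else I : ℂ)‖ = 1 := by
  split_ifs <;> simp

/-- The local phase of the dual sum. -/
noncomputable def dualSign (p j k : ℕ) (a b : ℤ) : ℂ :=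
  jacobiSym (-(a * b)) (p ^ (k - 2 * j)) * (if p ^ (k - 2 * j) % 4 = 1 then 1 else I)

open Classical in
/-- The coefficients of the dual sum. -/
noncomputable def dualCoeff (p j k : ℕ) (a c N : ℤ) : ℂ :=
  if ((p ^ j : ℕ) : ℤ) ∣ a + N then eN (p ^ k) N * eN (p ^ k) (c * (a + N) ^ 2) else 0

open Classical in
theorem zmodFourier_coset {p j k : ℕ} (hp : p.Prime) (hp2 : p ≠ 2) (hj : 0 < j) (hjk : 2 * j ≤ k) [NeZero (p ^ k)]
    {χ : DirichletCharacter ℂ (p ^ k)} {a b c : ℤ}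
    (hχ : ∀ x : ℤ, χ ((1 + p ^ j * x : ℤ) : ZMod (p ^ k)) = eN (p ^ (k - j)) (a * (x - b * p ^ j * x ^ 2)))
    (hb : 2 * b ≡ 1 [ZMOD (p ^ (k - j) : ℕ)]) (hc : 2 * a * c ≡ 1 [ZMOD (p ^ k : ℕ)]) (n h : ℤ) :
    zmodFourier (fun m : ZMod (p ^ k) =>
      if ZMod.castHom (pow_dvd_pow p ((Nat.le_mul_of_pos_left j two_pos).trans hjk)) (ZMod (p ^ j)) m =
      (n : ZMod (p ^ j)) then χ m * (starRingEnd ℂ) (χ n) else 0) h =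
    √((p : ℝ) ^ k) * dualSign p j k a b * dualCoeff p j k a c (n * h) := by
  have hPI := Nat.prime_iff_prime_int.1 hp
  have hk0 : k ≠ 0 := by omega
  have hpa : ¬ (p : ℤ) ∣ a := fun hd => by
    have h1 := hc.of_dvd (Int.natCast_dvd_natCast.2 (dvd_pow_self p hk0))
    have h2 : (p : ℤ) ∣ 1 := (Int.ModEq.dvd_iff h1).1 (Dvd.dvd.mul_right (Dvd.dvd.mul_left hd 2) c)
    exact hPI.not_isUnit (isUnit_of_dvd_one h2)
  by_cases hn : (p : ℤ) ∣ n
  · have hu : ¬ IsUnit (n : ZMod (p ^ k)) := by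
      rw [ZMod.coe_int_isUnit_iff_isCoprime, Nat.cast_pow, IsCoprime.pow_left_iff (Nat.pos_of_ne_zero hk0),
        hPI.irreducible.coprime_iff_not_dvd, not_not]
      exact hn
    have h0 : dualCoeff p j k a c (n * h) = 0 := by
      rw [dualCoeff, if_neg]
      intro hd
      refine hpa ((Int.dvd_add_left (hn.mul_right h)).1 (dvd_trans ?_ hd))
      exact Int.natCast_dvd_natCast.2 (dvd_pow_self p hj.ne')
    rw [h0, mul_zero, zmodFourier]
    refine Finset.sum_eq_zero fun m _ => ?_
    rw [χ.map_nonunit hu]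
    simp
  have hu : IsUnit (n : ZMod (p ^ k)) := by
    rw [ZMod.coe_int_isUnit_iff_isCoprime, Nat.cast_pow, IsCoprime.pow_left_iff (Nat.pos_of_ne_zero hk0),
      hPI.irreducible.coprime_iff_not_dvd]
    exact hn
  obtain ⟨r, hr⟩ := ZMod.intCast_surjective ((n : ZMod (p ^ k))⁻¹)
  have hr1 : n * r ≡ 1 [ZMOD (p ^ k : ℕ)] := by
    rw [← ZMod.intCast_eq_intCast_iff]
    push_cast
    rw [hr, ZMod.mul_inv_of_unit _ hu]
  obtain ⟨w, hw⟩ : ∃ w, k = 2 * j + w := ⟨k - 2 * j, by omega⟩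
  have hkj : k - j = j + w := by omega
  have hk2 : k - 2 * j = w := by omega
  have hk3 : p ^ k = p ^ j * p ^ (j + w) := by rw [← pow_add]; congr 1; omega
  have h1 : NeZero (p ^ j) := ⟨pow_ne_zero _ hp.ne_zero⟩
  have h2 : NeZero (p ^ w) := ⟨pow_ne_zero _ hp.ne_zero⟩
  have h3 : NeZero (p ^ (j + w)) := ⟨pow_ne_zero _ hp.ne_zero⟩
  set F : ZMod (p ^ k) → ℂ := fun m =>
    (if ZMod.castHom (pow_dvd_pow p ((Nat.le_mul_of_pos_left j two_pos).trans hjk)) (ZMod (p ^ j)) m =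
      (n : ZMod (p ^ j)) then χ m * (starRingEnd ℂ) (χ n) else 0) * ZMod.stdAddChar (m * h : ZMod (p ^ k)) with hF
  have hFsum : zmodFourier (fun m : ZMod (p ^ k) =>
      if ZMod.castHom (pow_dvd_pow p ((Nat.le_mul_of_pos_left j two_pos).trans hjk)) (ZMod (p ^ j)) m =
      (n : ZMod (p ^ j)) then χ m * (starRingEnd ℂ) (χ n) else 0) h =
      ∑ t ∈ Finset.range (p ^ (j + w)), eN (p ^ k) (n * h) *
        eN (p ^ (j + w)) ((a * r + h) * t + (-(a * b * r ^ 2)) * p ^ j * t ^ 2) := by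
    have e1 : zmodFourier (fun m : ZMod (p ^ k) =>
      if ZMod.castHom (pow_dvd_pow p ((Nat.le_mul_of_pos_left j two_pos).trans hjk)) (ZMod (p ^ j)) m =
      (n : ZMod (p ^ j)) then χ m * (starRingEnd ℂ) (χ n) else 0) h = ∑ m, F m := rfl
    have e2 (i : ℕ) : F ((i : ZMod (p ^ k)) + n) = if p ^ j ∣ i then
        χ ((i + n : ℤ) : ZMod (p ^ k)) * (starRingEnd ℂ) (χ n) * eN (p ^ k) ((i + n) * h) else 0 := by
      simp only [hF, map_add, map_natCast, map_intCast, add_eq_right, ZMod.natCast_eq_zero_iff]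
      rw [eN_eq_stdAddChar]
      push_cast
      split_ifs <;> simp
    rw [e1, ← Equiv.sum_comp (Equiv.addRight (n : ZMod (p ^ k)))]
    simp only [Equiv.coe_addRight]
    rw [sum_zmod_eq_sum_range (fun m : ZMod (p ^ k) => F (m + n))]
    simp only [e2]
    rw [show Finset.range (p ^ k) = Finset.range (p ^ j * p ^ (j + w)) by rw [hk3], sum_range_mul_eq,
      Finset.sum_eq_single_of_mem 0 (Finset.mem_range.2 (pow_pos hp.pos j))]
    · refine Finset.sum_congr rfl fun t _ => ?_
      rw [if_pos (by simp), show ((0 + p ^ j * t : ℕ) : ℤ) + n = n + p ^ j * t by push_cast; ring,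
        char_mul_conj_char hp hχ hr1, hkj, show (n + p ^ j * t : ℤ) * h = n * h + (p ^ j : ℕ) * (h * t) by push_cast; ring,
        eN_add, show eN (p ^ k) ((p ^ j : ℕ) * (h * t)) = eN (p ^ (j + w)) (h * t) by
          rw [hk3, eN_mul_left (pow_ne_zero _ hp.ne_zero)], mul_left_comm, ← eN_add]
      congr 2
      ring
    · intro s hs hs0
      refine Finset.sum_eq_zero fun t _ => if_neg fun hd => hs0 ?_
      have := (Nat.dvd_add_left (dvd_mul_right (p ^ j) t)).1 hd
      exact Nat.eq_zero_of_dvd_of_lt this (Finset.mem_range.1 hs)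
  rw [hFsum, ← Finset.mul_sum, sum_eN_quadratic_split hp]
  have hcopr : IsCoprime ((p ^ j : ℕ) : ℤ) n := by
    rw [Nat.cast_pow]
    exact ((hPI.irreducible.coprime_iff_not_dvd).2 hn).pow_left
  have hdk : ((p ^ j : ℕ) : ℤ) ∣ (p ^ k : ℕ) := Int.natCast_dvd_natCast.2 (pow_dvd_pow p (by omega))
  have hiff : ((p ^ j : ℕ) : ℤ) ∣ a * r + h ↔ ((p ^ j : ℕ) : ℤ) ∣ a + n * h := by
    have e : n * (a * r + h) ≡ a + n * h [ZMOD (p ^ j : ℕ)] := by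
      have := ((hr1.of_dvd hdk).mul_left a).add_right (n * h)
      convert this using 1 <;> ring
    rw [← Int.ModEq.dvd_iff e]
    exact ⟨fun h => Dvd.dvd.mul_left h n, fun h => hcopr.dvd_of_dvd_mul_left h⟩
  rw [dualCoeff]
  by_cases hd : ((p ^ j : ℕ) : ℤ) ∣ a * r + h
  · rw [if_pos hd, if_pos (hiff.1 hd)]
    obtain ⟨T, hT⟩ := hd
    have e3 (y : ℕ) : eN (p ^ (j + w)) ((a * r + h) * y + (-(a * b * r ^ 2)) * p ^ j * y ^ 2) =
        eN (p ^ w) (T * y + (-(a * b * r ^ 2)) * y ^ 2) := by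
      rw [pow_add, ← eN_mul_left (pow_ne_zero j hp.ne_zero) (p ^ w), hT]
      congr 1
      push_cast
      ring
    simp only [e3]
    have hwk : ((p ^ w : ℕ) : ℤ) ∣ (p ^ k : ℕ) := Int.natCast_dvd_natCast.2 (pow_dvd_pow p (by omega))
    have hwj : ((p ^ w : ℕ) : ℤ) ∣ (p ^ (k - j) : ℕ) := Int.natCast_dvd_natCast.2 (pow_dvd_pow p (by omega))
    have zb : (2 * b : ZMod (p ^ w)) = 1 := by
      have := (ZMod.intCast_eq_intCast_iff _ _ _).2 (hb.of_dvd hwj); push_cast at this ⊢; exact this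
    have zc : (2 * a * c : ZMod (p ^ w)) = 1 := by
      have := (ZMod.intCast_eq_intCast_iff _ _ _).2 (hc.of_dvd hwk); push_cast at this ⊢; exact this
    have zr : (n * r : ZMod (p ^ w)) = 1 := by
      have := (ZMod.intCast_eq_intCast_iff _ _ _).2 (hr1.of_dvd hwk); push_cast at this ⊢; exact this
    have hsq : T ≡ -(2 * (-(a * b * r ^ 2)) * (2 * c * n ^ 2 * T)) [ZMOD (p ^ w : ℕ)] := by
      rw [← ZMod.intCast_eq_intCast_iff]
      push_cast
      linear_combination (-(2 * a * c * (2 * b) * (n * r + 1) * T) : ZMod (p ^ w)) * zr - (2 * b : ZMod (p ^ w)) * T * zc - T * zb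
    rw [sum_eN_complete_square hsq]
    have hphase : eN (p ^ w) (-(-(a * b * r ^ 2) * (2 * c * n ^ 2 * T) ^ 2)) = eN (p ^ k) (c * (a + n * h) ^ 2) := by
      have e4 : c * (a + n * h) ^ 2 ≡ ((p ^ (2 * j) : ℕ) : ℤ) * (c * n ^ 2 * T ^ 2) [ZMOD (p ^ k : ℕ)] := by
        have e5 : a + n * h ≡ n * ((p ^ j : ℕ) * T) [ZMOD (p ^ k : ℕ)] := by
          rw [← hT]
          have := ((hr1.mul_left a).add_right (n * h)).symm
          convert this using 1 <;> ring
        have := (e5.pow 2).mul_left c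
        convert this using 1
        push_cast
        ring
      rw [eN_congr e4, hw, pow_add p (2 * j), eN_mul_left (pow_ne_zero _ hp.ne_zero)]
      refine eN_congr ?_
      rw [← ZMod.intCast_eq_intCast_iff]
      push_cast
      linear_combination (2 * a * c * (2 * b) * c * n ^ 2 * T ^ 2 * (n * r + 1) : ZMod (p ^ w)) * zr +
        (2 * b * c * n ^ 2 * T ^ 2 : ZMod (p ^ w)) * zc + (c * n ^ 2 * T ^ 2 : ZMod (p ^ w)) * zb
    have hpb : ¬ (p : ℤ) ∣ b := fun hd => by
      have h1 := hb.of_dvd (Int.natCast_dvd_natCast.2 (dvd_pow_self p (by omega)))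
      have h2 : (p : ℤ) ∣ 1 := (Int.ModEq.dvd_iff h1).1 (Dvd.dvd.mul_left hd 2)
      exact hPI.not_isUnit (isUnit_of_dvd_one h2)
    have hpr : ¬ (p : ℤ) ∣ r := fun hd => by
      have h1 := hr1.of_dvd (Int.natCast_dvd_natCast.2 (dvd_pow_self p hk0))
      have h2 : (p : ℤ) ∣ 1 := (Int.ModEq.dvd_iff h1).1 (Dvd.dvd.mul_left hd n)
      exact hPI.not_isUnit (isUnit_of_dvd_one h2)
    have hpA : ¬ (p : ℤ) ∣ -(a * b * r ^ 2) := by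
      rw [dvd_neg]
      intro hd
      rcases hPI.dvd_or_dvd hd with h' | h'
      · exact (hPI.dvd_or_dvd h').elim hpa hpb
      · exact hpr (hPI.dvd_of_dvd_pow h')
    have hjac : jacobiSym (-(a * b * r ^ 2)) (p ^ w) = jacobiSym (-(a * b)) (p ^ w) := by
      rw [show -(a * b * r ^ 2) = -(a * b) * r ^ 2 by ring, jacobiSym.mul_left, jacobiSym.sq_one', mul_one]
      rw [Int.isCoprime_iff_gcd_eq_one.symm, Nat.cast_pow]
      exact ((hPI.irreducible.coprime_iff_not_dvd).2 hpr).pow_left.symm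
    rw [hphase, quadGauss_primePow hp hp2 hpA, hjac, dualSign, hk2]
    have hsqrt : √((p : ℝ) ^ k) = (p : ℝ) ^ j * √((p : ℝ) ^ w) := by
      rw [hw, pow_add, mul_comm 2 j, pow_mul, Real.sqrt_mul (by positivity), Real.sqrt_sq (by positivity)]
    rw [hsqrt]
    push_cast
    ring
  · rw [if_neg hd, if_neg (fun h' => hd (hiff.2 h'))]
    simp

theorem norm_dualSign_le (p j k : ℕ) (a b : ℤ) : ‖dualSign p j k a b‖ ≤ 1 := by
  rw [dualSign, norm_mul, norm_ite_one_I, mul_one, norm_intCast]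
  have h : jacobiSym (-(a * b)) (p ^ (k - 2 * j)) = 0 ∨ jacobiSym (-(a * b)) (p ^ (k - 2 * j)) = 1 ∨
      jacobiSym (-(a * b)) (p ^ (k - 2 * j)) = -1 := jacobiSym.trichotomy _ _
  rcases h with h | h | h <;> rw [h] <;> simp

theorem norm_dualCoeff_le (p j k : ℕ) (a c N : ℤ) : ‖dualCoeff p j k a c N‖ ≤ 1 := by
  rw [dualCoeff]
  split_ifs
  · rw [norm_mul, norm_eN, norm_eN, mul_one]
  · simp

theorem summable_dualCoeff_mul_pairWeight (p j k : ℕ) [NeZero (p ^ k)] (a c : ℤ) (z : ℝ × ℝ) :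
    Summable fun v : ℤ × ℤ => dualCoeff p j k a c (v.1 * v.2) * pairWeight (p ^ k) z v := by
  refine Summable.of_norm_bounded (summable_pairWeight (N := p ^ k) z) fun v => ?_
  have h0 := pairWeight_pos (p ^ k) z v
  rw [norm_mul, norm_real, Real.norm_of_nonneg h0.le]
  exact mul_le_of_le_one_left h0.le (norm_dualCoeff_le _ _ _ _ _ _)

theorem cosetTheta_eq_dual {p j k : ℕ} (hp : p.Prime) (hp2 : p ≠ 2) (hj : 0 < j) (hjk : 2 * j ≤ k)
    {χ : DirichletCharacter ℂ (p ^ k)} {a b c : ℤ}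
    (hχ : ∀ x : ℤ, χ ((1 + p ^ j * x : ℤ) : ZMod (p ^ k)) = eN (p ^ (k - j)) (a * (x - b * p ^ j * x ^ 2)))
    (hb : 2 * b ≡ 1 [ZMOD (p ^ (k - j) : ℕ)]) (hc : 2 * a * c ≡ 1 [ZMOD (p ^ k : ℕ)]) (z : ℝ × ℝ) :
    (Real.exp (z.1 / 2) : ℂ) * cosetTheta χ (p ^ j) z =
      dualSign p j k a b * ((Real.exp (-z.2 / 2) : ℂ) *
        ∑' v : ℤ × ℤ, dualCoeff p j k a c (v.1 * v.2) * pairWeight (p ^ k) (-z.2, z.1) v) := by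
  have : NeZero (p ^ k) := ⟨pow_ne_zero k hp.ne_zero⟩
  have hq : (0 : ℝ) < (p : ℝ) ^ k := pow_pos (by exact_mod_cast hp.pos) k
  have hs : (0 : ℝ) < √((p : ℝ) ^ k) := Real.sqrt_pos.2 hq
  have hss : √((p : ℝ) ^ k) * √((p : ℝ) ^ k) = (p : ℝ) ^ k := Real.mul_self_sqrt hq.le
  set A : ℝ := Real.exp (z.1 + z.2) / (p : ℝ) ^ k with hA
  have hA0 : 0 < A := by positivity
  have hsA : √A = Real.exp ((z.1 + z.2) / 2) / √((p : ℝ) ^ k) := by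
    rw [hA, Real.sqrt_div (Real.exp_pos _).le, ← Real.exp_half]
  have hinner (n : ℤ) : ∑' m : ℤ, cosetTerm χ (p ^ j) z (m, n) =
      dualSign p j k a b * (Real.exp (-(z.1 + z.2) / 2) : ℂ) *
        ∑' h : ℤ, dualCoeff p j k a c (n * h) * pairWeight (p ^ k) (-z.2, z.1) (n, h) := by
    classical
    obtain ⟨g, hg⟩ : ∃ g : ZMod (p ^ k) → ℂ, g = fun m : ZMod (p ^ k) =>
      if ZMod.castHom (pow_dvd_pow p ((Nat.le_mul_of_pos_left j two_pos).trans hjk)) (ZMod (p ^ j)) m =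
        (n : ZMod (p ^ j)) then χ m * (starRingEnd ℂ) (χ n) else 0 := ⟨_, rfl⟩
    have hgF (h : ℤ) : zmodFourier g h = √((p : ℝ) ^ k) * dualSign p j k a b * dualCoeff p j k a c (n * h) := by
      rw [hg, ← zmodFourier_coset hp hp2 hj hjk hχ hb hc n h]
    have h1 (m : ℤ) : cosetTerm χ (p ^ j) z (m, n) =
        (Real.exp (-Real.pi * (Real.exp (z.1 - z.2) / (p : ℝ) ^ k) * n ^ 2) : ℂ) *
        (g m * cexp (-Real.pi * (A : ℂ) * m ^ 2 + 2 * Real.pi * 0 * m)) := by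
      have e : (m ≡ n [ZMOD (p ^ j : ℕ)]) ↔
          ZMod.castHom (pow_dvd_pow p ((Nat.le_mul_of_pos_left j two_pos).trans hjk)) (ZMod (p ^ j))
          (m : ZMod (p ^ k)) = (n : ZMod (p ^ j)) := by
        rw [map_intCast, ZMod.intCast_eq_intCast_iff]
      rw [cosetTerm, hg]
      simp only [e]
      split_ifs
      · rw [pairWeight, hA]
        push_cast
        rw [mul_zero, zero_mul, add_zero]
        ring
      · simp
    have h2 (h : ℤ) : cexp (-Real.pi / ((A : ℂ) * (p ^ k : ℕ) ^ 2) * (h + I * (0 * (p ^ k : ℕ))) ^ 2) *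
        (Real.exp (-Real.pi * (Real.exp (z.1 - z.2) / (p : ℝ) ^ k) * n ^ 2) : ℂ) =
        pairWeight (p ^ k) (-z.2, z.1) (n, h) := by
      have hAq : -Real.pi / (A * ((p : ℝ) ^ k) ^ 2) = -Real.pi * (Real.exp (-z.2 - z.1) / (p : ℝ) ^ k) := by
        rw [hA, show -z.2 - z.1 = -(z.1 + z.2) by ring, Real.exp_neg]
        field_simp
      have e : -Real.pi / ((A : ℂ) * (p ^ k : ℕ) ^ 2) * (h + I * (0 * (p ^ k : ℕ))) ^ 2 =
          ((-Real.pi * (Real.exp (-z.2 - z.1) / (p : ℝ) ^ k) * h ^ 2 : ℝ) : ℂ) := by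
        rw [← hAq]
        push_cast
        rw [zero_mul, mul_zero, add_zero]
      rw [e, ← ofReal_exp, ← ofReal_mul, pairWeight]
      push_cast
      rw [show -(z.2 : ℂ) + z.1 = z.1 - z.2 by ring, mul_comm]
    have hcoef : (1 : ℂ) / ((p ^ k : ℕ) * (A : ℂ) ^ (1 / 2 : ℂ)) * (√((p : ℝ) ^ k) : ℂ) =
        (Real.exp (-(z.1 + z.2) / 2) : ℂ) := by
      rw [show (1 / 2 : ℂ) = ((1 / 2 : ℝ) : ℂ) by push_cast; rfl, ← ofReal_cpow hA0.le, ← Real.sqrt_eq_rpow, hsA,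
        neg_div, Real.exp_neg]
      norm_cast
      push_cast
      rw [inv_eq_one_div]
      field_simp
      rw [sq, hss]
    rw [tsum_congr h1, tsum_mul_left, tsum_zmod_gaussian g (a := (A : ℂ)) (by simpa using hA0) 0]
    simp only [hgF]
    rw [← hcoef, ← tsum_mul_left, ← tsum_mul_left, ← tsum_mul_left]
    refine tsum_congr fun h => ?_
    rw [← h2]
    ring
  have hsum := summable_dualCoeff_mul_pairWeight p j k a c (-z.2, z.1)
  have hprod := ((Equiv.prodComm ℤ ℤ).summable_iff.2 (summable_cosetTerm χ (p ^ j) z)).tsum_prod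
  simp only [Function.comp_apply] at hprod
  rw [cosetTheta, ← (Equiv.prodComm ℤ ℤ).tsum_eq, hprod]
  simp only [Equiv.prodComm_apply, Prod.swap_prod_mk, hinner]
  rw [tsum_mul_left, hsum.tsum_prod,
    show (Real.exp (-z.2 / 2) : ℂ) = (Real.exp (z.1 / 2) : ℂ) * (Real.exp (-(z.1 + z.2) / 2) : ℂ) by
      rw [← ofReal_mul, ← Real.exp_add]; ring_nf]
  ring

theorem Nat.card_divisorsAntidiagonal' (n : ℕ) : n.divisorsAntidiagonal.card = n.divisors.card := by
  rw [← Nat.map_div_right_divisors, Finset.card_map]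

theorem Int.card_divisorsAntidiag (z : ℤ) : z.divisorsAntidiag.card = 2 * z.natAbs.divisors.card := by
  cases z <;>
    simp only [Int.divisorsAntidiag, Finset.card_disjUnion, Finset.card_map, Nat.card_divisorsAntidiagonal', two_mul,
      Int.ofNat_eq_natCast, Int.natAbs_natCast, Int.natAbs_negSucc, Nat.succ_eq_add_one]

theorem exists_sum_abs_mul_rpow_le {ε : ℝ} (hε : 0 < ε) : ∃ K > 0, ∀ (M : ℕ) (B : ℤ), 2 * |B| < M →
    ∀ s : Finset (ℤ × ℤ), (∀ v ∈ s, v.1 * v.2 ≡ B [ZMOD M] ∧ v.1 * v.2 ≠ B) →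
    ∑ v ∈ s, |((v.1 * v.2 : ℤ) : ℝ)| ^ (-(1 + 2 * ε)) ≤ K / M := by
  classical
  obtain ⟨D, hD, hDb⟩ := card_divisors_le_rpow hε
  set S := ∑' t : ℤ, |(t : ℝ)| ^ (-(1 + ε)) with hS
  have hsum := Real.summable_abs_int_rpow (b := 1 + ε) (by linarith)
  have hS0 : 0 ≤ S := tsum_nonneg fun t => by positivity
  refine ⟨2 * D * 2 ^ (1 + ε) * S + 1, by positivity, fun M B hB s hs => ?_⟩
  have hM1 : (1 : ℝ) ≤ M := by
    have : (0 : ℤ) < M := (by positivity : (0 : ℤ) ≤ 2 * |B|).trans_lt hB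
    exact_mod_cast this
  have hM : (0 : ℝ) < M := by linarith
  have hBr : 2 * |(B : ℝ)| < M := by exact_mod_cast hB
  have hkey : ∀ N : ℤ, N ∈ s.image (fun v => v.1 * v.2) → ∃ t : ℤ, N = B + M * t ∧ t ≠ 0 ∧
      M / 2 * |(t : ℝ)| ≤ |(N : ℝ)| := by
    intro N hN
    obtain ⟨v, hv, rfl⟩ := Finset.mem_image.1 hN
    obtain ⟨t, ht⟩ := (hs v hv).1.symm.dvd
    have ht0 : t ≠ 0 := by
      rintro rfl
      rw [mul_zero, sub_eq_zero] at ht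
      exact (hs v hv).2 ht
    have e : v.1 * v.2 = B + M * t := by linarith
    refine ⟨t, e, ht0, ?_⟩
    rw [e]
    push_cast
    have h1 : (1 : ℝ) ≤ |(t : ℝ)| := by exact_mod_cast Int.one_le_abs ht0
    have h2 : |(M * t : ℝ)| ≤ |(B + M * t : ℝ)| + |(B : ℝ)| := by
      have := abs_sub (B + M * t : ℝ) B
      rwa [add_sub_cancel_left] at this
    rw [abs_mul, abs_of_pos hM] at h2
    nlinarith
  choose! T hT1 hT2 hT3 using hkey
  have hterm : ∀ N : ℤ, N ∈ s.image (fun v => v.1 * v.2) →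
      ({v ∈ s | v.1 * v.2 = N}.card : ℝ) * |(N : ℝ)| ^ (-(1 + 2 * ε)) ≤
      2 * D * (M / 2) ^ (-(1 + ε)) * |(T N : ℝ)| ^ (-(1 + ε)) := by
    intro N hN
    have ht1 : (0 : ℝ) < |(T N : ℝ)| := by
      have := hT2 N hN
      positivity
    have hN0 : 0 < |(N : ℝ)| := (by positivity : 0 < M / 2 * |(T N : ℝ)|).trans_le (hT3 N hN)
    have hN0' : N ≠ 0 := by rintro rfl; simp at hN0
    have h1 : ({v ∈ s | v.1 * v.2 = N}.card : ℝ) ≤ 2 * (D * |(N : ℝ)| ^ ε) := by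
      have h2 : {v ∈ s | v.1 * v.2 = N}.card ≤ 2 * N.natAbs.divisors.card := by
        rw [← Int.card_divisorsAntidiag]
        refine Finset.card_le_card fun v hv => ?_
        exact Int.mem_divisorsAntidiag.2 ⟨(Finset.mem_filter.1 hv).2, hN0'⟩
      have h3 := hDb N.natAbs (Int.natAbs_ne_zero.2 hN0')
      rw [Nat.cast_natAbs, Int.cast_abs] at h3
      calc ({v ∈ s | v.1 * v.2 = N}.card : ℝ) ≤ (2 * N.natAbs.divisors.card : ℕ) := by exact_mod_cast h2
        _ = 2 * (N.natAbs.divisors.card : ℝ) := by push_cast; rfl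
        _ ≤ _ := by linarith
    calc _ ≤ 2 * (D * |(N : ℝ)| ^ ε) * |(N : ℝ)| ^ (-(1 + 2 * ε)) := by gcongr
      _ = 2 * D * |(N : ℝ)| ^ (-(1 + ε)) := by
        rw [show -(1 + ε) = ε + -(1 + 2 * ε) by ring, Real.rpow_add hN0]
        ring
      _ ≤ 2 * D * (M / 2 * |(T N : ℝ)|) ^ (-(1 + ε)) := by
        refine mul_le_mul_of_nonneg_left ?_ (by positivity)
        exact Real.rpow_le_rpow_of_nonpos (by positivity) (hT3 N hN) (by linarith)
      _ = _ := by
        rw [Real.mul_rpow (by positivity) ht1.le]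
        ring
  have hinj : Set.InjOn T (s.image (fun v => v.1 * v.2)) := by
    intro x hx y hy hxy
    rw [hT1 x hx, hT1 y hy, hxy]
  have hMle : ((M : ℝ) / 2) ^ (-(1 + ε)) ≤ 2 ^ (1 + ε) / M := by
    rw [Real.div_rpow hM.le zero_le_two, Real.rpow_neg zero_le_two, div_inv_eq_mul, mul_comm, div_eq_mul_inv]
    gcongr
    rw [← Real.rpow_neg_one]
    exact Real.rpow_le_rpow_of_exponent_le hM1 (by linarith)
  rw [Finset.sum_comp (s := s) (fun N : ℤ => |(N : ℝ)| ^ (-(1 + 2 * ε))) (fun v : ℤ × ℤ => v.1 * v.2)]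
  simp only [nsmul_eq_mul]
  calc _ ≤ ∑ N ∈ s.image (fun v : ℤ × ℤ => v.1 * v.2), 2 * D * (M / 2) ^ (-(1 + ε)) * |(T N : ℝ)| ^ (-(1 + ε)) :=
        Finset.sum_le_sum hterm
    _ = 2 * D * (M / 2) ^ (-(1 + ε)) * ∑ t ∈ (s.image (fun v => v.1 * v.2)).image T, |(t : ℝ)| ^ (-(1 + ε)) := by
        rw [← Finset.mul_sum, Finset.sum_image hinj]
    _ ≤ 2 * D * (2 ^ (1 + ε) / M) * S := by
        gcongr
        exact hsum.sum_le_tsum _ fun t _ => by positivity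
    _ ≤ _ := by
        rw [add_div, mul_div_assoc', div_mul_eq_mul_div]
        have : 0 ≤ 1 / (M : ℝ) := by positivity
        linarith

theorem pairWeight_le_rpow {ε : ℝ} (hε : 0 < ε) : ∃ K > 0, ∀ (N : ℕ) [NeZero N] (z : ℝ × ℝ) (v : ℤ × ℤ),
    v.1 ≠ 0 → v.2 ≠ 0 → pairWeight N z v ≤ K * (N : ℝ) ^ (1 + 3 * ε) * Real.exp (-(1 + 3 * ε) * z.1) *
      Real.exp (-ε * z.2) * |((v.1 * v.2 : ℤ) : ℝ)| ^ (-(1 + 2 * ε)) := by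
  obtain ⟨α, hα⟩ : ∃ α, α = 1 / 2 + 2 * ε := ⟨_, rfl⟩
  obtain ⟨β, hβ⟩ : ∃ β, β = 1 / 2 + ε := ⟨_, rfl⟩
  have hα0 : 0 < α := by rw [hα]; positivity
  have hβ0 : 0 < β := by rw [hβ]; positivity
  refine ⟨α ^ α * β ^ β, by positivity, fun N _ z v h1 h2 => ?_⟩
  have hN : (0 : ℝ) < N := by exact_mod_cast NeZero.pos N
  have h1a : (1 : ℝ) ≤ |(v.1 : ℝ)| := by exact_mod_cast Int.one_le_abs h1
  have h2a : (1 : ℝ) ≤ |(v.2 : ℝ)| := by exact_mod_cast Int.one_le_abs h2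
  have key (κ y : ℝ) (hκ : 0 < κ) (m : ℝ) (hm : 1 ≤ |m|) :
      Real.exp (-Real.pi * (Real.exp y / N) * m ^ 2) ≤
        κ ^ κ * (N ^ κ * Real.exp (-κ * y) * |m| ^ (-(2 * κ))) := by
    have hm0 : 0 < |m| := by linarith
    have e1 : Real.exp (-Real.pi * (Real.exp y / N) * m ^ 2) ≤ Real.exp (-(Real.exp y / N * |m| ^ 2)) := by
      rw [Real.exp_le_exp, sq_abs]
      have : 0 ≤ Real.exp y / N * m ^ 2 := by positivity
      nlinarith [Real.pi_gt_three]
    refine e1.trans ((exp_neg_le_mul_rpow hκ (by positivity)).trans (le_of_eq ?_))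
    congr 1
    rw [Real.mul_rpow (by positivity) (by positivity), Real.div_rpow (Real.exp_pos _).le hN.le, ← Real.exp_mul,
      ← Real.rpow_natCast, ← Real.rpow_mul hm0.le, Real.rpow_neg hN.le, div_inv_eq_mul]
    push_cast
    rw [mul_comm (N ^ κ : ℝ)]
    ring_nf
  have ha := key α (z.1 + z.2) hα0 v.1 h1a
  have hb := key β (z.1 - z.2) hβ0 v.2 h2a
  have hv : |(v.1 : ℝ)| ^ (-(2 * α)) * |(v.2 : ℝ)| ^ (-(2 * β)) ≤ |((v.1 * v.2 : ℤ) : ℝ)| ^ (-(1 + 2 * ε)) := by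
    rw [Int.cast_mul, abs_mul, Real.mul_rpow (by positivity) (by positivity)]
    gcongr
    · rw [hα]; linarith
    · rw [hβ]; linarith
  calc pairWeight N z v ≤ _ := mul_le_mul ha hb (Real.exp_pos _).le (by positivity)
    _ = α ^ α * β ^ β * (N : ℝ) ^ (α + β) * Real.exp (-α * (z.1 + z.2) + -β * (z.1 - z.2)) *
        (|(v.1 : ℝ)| ^ (-(2 * α)) * |(v.2 : ℝ)| ^ (-(2 * β))) := by
      rw [Real.rpow_add hN, Real.exp_add]; ring
    _ ≤ α ^ α * β ^ β * (N : ℝ) ^ (α + β) * Real.exp (-α * (z.1 + z.2) + -β * (z.1 - z.2)) *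
        |((v.1 * v.2 : ℤ) : ℝ)| ^ (-(1 + 2 * ε)) := by gcongr
    _ = _ := by
      rw [show -α * (z.1 + z.2) + -β * (z.1 - z.2) = -(1 + 3 * ε) * z.1 + -ε * z.2 by rw [hα, hβ]; ring,
        Real.exp_add, show α + β = 1 + 3 * ε by rw [hα, hβ]; ring]
      ring

theorem exists_norm_tsum_dual_sub_le {ε : ℝ} (hε : 0 < ε) : ∃ K > 0, ∀ (p j k : ℕ) [NeZero (p ^ k)] (a c B : ℤ),
    B ≡ -a [ZMOD (p ^ j : ℕ)] → 2 * |B| < (p ^ j : ℕ) → B ≠ 0 → ∀ z : ℝ × ℝ,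
    ‖∑' v : ℤ × ℤ, dualCoeff p j k a c (v.1 * v.2) * pairWeight (p ^ k) z v -
      dualCoeff p j k a c B * (∑ v ∈ B.divisorsAntidiag, pairWeight (p ^ k) z v : ℝ)‖ ≤
    K * (((p : ℝ) ^ k) ^ (1 + 3 * ε) / (p : ℝ) ^ j) * Real.exp (-(1 + 3 * ε) * z.1) * Real.exp (-ε * z.2) := by
  classical
  obtain ⟨K₁, hK₁, h₁⟩ := exists_sum_abs_mul_rpow_le hε
  obtain ⟨K₂, hK₂, h₂⟩ := pairWeight_le_rpow hε
  refine ⟨K₂ * K₁, by positivity, fun p j k _ a c B hBa hB hB0 z => ?_⟩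
  set f : ℤ × ℤ → ℂ := fun v => dualCoeff p j k a c (v.1 * v.2) * pairWeight (p ^ k) z v with hf
  have hfs : Summable f := summable_dualCoeff_mul_pairWeight p j k a c z
  set S := B.divisorsAntidiag with hS
  have hfin : dualCoeff p j k a c B * (∑ v ∈ S, pairWeight (p ^ k) z v : ℝ) = ∑ v ∈ S, f v := by
    rw [ofReal_sum, Finset.mul_sum]
    refine Finset.sum_congr rfl fun v hv => ?_
    simp only [hf, (Int.mem_divisorsAntidiag.1 hv).1]
  set g : ℤ × ℤ → ℂ := fun v => if v ∈ S then 0 else f v with hg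
  have hgs : Summable fun v => ‖g v‖ := by
    refine Summable.of_nonneg_of_le (fun _ => norm_nonneg _) (fun v => ?_) hfs.norm
    simp only [hg]
    split_ifs
    · simp
    · exact le_rfl
  have hsplit : ∑' v, f v - ∑ v ∈ S, f v = ∑' v, g v := by
    have e : ∑ v ∈ S, f v = ∑' v, if v ∈ S then f v else 0 := by
      rw [tsum_eq_sum (s := S) (fun v hv => if_neg hv)]
      exact Finset.sum_congr rfl fun v hv => (if_pos hv).symm
    rw [e, ← hfs.tsum_sub (summable_of_ne_finset_zero (s := S) fun v hv => if_neg hv)]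
    refine tsum_congr fun v => ?_
    simp only [hg]
    split_ifs <;> simp
  set W : ℝ := K₂ * ((p ^ k : ℕ) : ℝ) ^ (1 + 3 * ε) * Real.exp (-(1 + 3 * ε) * z.1) * Real.exp (-ε * z.2) with hW
  have hW0 : 0 ≤ W := by positivity
  rw [hfin, hsplit]
  refine (norm_tsum_le_tsum_norm hgs).trans (hgs.tsum_le_of_sum_le fun s => ?_)
  have hne : ∀ v : ℤ × ℤ, g v ≠ 0 → v.1 * v.2 ≡ B [ZMOD (p ^ j : ℕ)] ∧ v.1 * v.2 ≠ B := by
    intro v hv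
    have hvS : v ∉ S := fun h => hv (if_pos h)
    simp only [hg, if_neg hvS] at hv
    have hd : ((p ^ j : ℕ) : ℤ) ∣ a + v.1 * v.2 := by
      by_contra h
      exact hv (by simp only [hf, dualCoeff, if_neg h, zero_mul])
    refine ⟨?_, fun h => hvS (Int.mem_divisorsAntidiag.2 ⟨h, hB0⟩)⟩
    refine Int.ModEq.trans ?_ hBa.symm
    exact (Int.modEq_iff_dvd.2 (by rwa [show v.1 * v.2 - -a = a + v.1 * v.2 by ring])).symm
  have hle : ∀ v ∈ s.filter (fun v => g v ≠ 0), ‖g v‖ ≤ W * |((v.1 * v.2 : ℤ) : ℝ)| ^ (-(1 + 2 * ε)) := by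
    intro v hv
    obtain ⟨h1, h2⟩ := hne v (Finset.mem_filter.1 hv).2
    have hv0 : v.1 * v.2 ≠ 0 := by
      intro h0
      rw [h0] at h1
      refine hB0 (Int.eq_zero_of_abs_lt_dvd (Int.modEq_zero_iff_dvd.1 h1.symm) ?_)
      have := abs_nonneg B
      linarith
    refine le_trans ?_ (h₂ (p ^ k) z v (left_ne_zero_of_mul hv0) (right_ne_zero_of_mul hv0))
    have h0 := pairWeight_pos (p ^ k) z v
    simp only [hg, hf]
    split_ifs
    · simpa using h0.le
    · rw [norm_mul, norm_real, Real.norm_of_nonneg h0.le]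
      exact mul_le_of_le_one_left h0.le (norm_dualCoeff_le _ _ _ _ _ _)
  have hfilt : ∑ v ∈ s, ‖g v‖ = ∑ v ∈ s.filter (fun v => g v ≠ 0), ‖g v‖ := by
    rw [Finset.sum_filter_of_ne]
    intro v _ hv h
    exact hv (by rw [h, norm_zero])
  rw [hfilt]
  refine (Finset.sum_le_sum hle).trans ?_
  rw [← Finset.mul_sum]
  refine (mul_le_mul_of_nonneg_left (h₁ (p ^ j) B hB _ fun v hv => hne v (Finset.mem_filter.1 hv).2) hW0).trans
    (le_of_eq ?_)
  rw [hW]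
  push_cast
  ring

theorem exists_norm_integral_dual_sub_le {ε : ℝ} (hε : 0 < ε) : ∃ K > 0, ∀ (p j k : ℕ) [NeZero (p ^ k)] (a c B : ℤ)
    (σ : ℂ), ‖σ‖ ≤ 1 → B ≡ -a [ZMOD (p ^ j : ℕ)] → 2 * |B| < (p ^ j : ℕ) → B ≠ 0 → ∀ r : ℝ,
    ‖∫ z in Set.Ioi 0 ×ˢ Set.Iic r, σ * ((Real.exp (-z.2 / 2) : ℂ) *
      (∑' v : ℤ × ℤ, dualCoeff p j k a c (v.1 * v.2) * pairWeight (p ^ k) (-z.2, z.1) v -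
      dualCoeff p j k a c B * (∑ v ∈ B.divisorsAntidiag, pairWeight (p ^ k) (-z.2, z.1) v : ℝ)))‖ ≤
    K * (((p : ℝ) ^ k) ^ (1 + 3 * ε) / (p : ℝ) ^ j) * Real.exp ((1 / 2 + 3 * ε) * r) := by
  obtain ⟨K, hK, h⟩ := exists_norm_tsum_dual_sub_le hε
  refine ⟨1 / ε * K * (1 / (1 / 2 + 3 * ε)), by positivity, fun p j k _ a c B σ hσ hBa hB hB0 r => ?_⟩
  set W : ℝ := K * (((p : ℝ) ^ k) ^ (1 + 3 * ε) / (p : ℝ) ^ j) with hW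
  have hW0 : 0 ≤ W := by positivity
  have hA := integrableOn_exp_neg_mul_Ioi hε 0
  have hB' := integrableOn_exp_mul_Iic (a := 1 / 2 + 3 * ε) (by positivity) r
  refine (norm_setIntegral_prod_le measurableSet_Ioi measurableSet_Iic
    (A := fun x => Real.exp (-ε * x)) (B := fun y => W * Real.exp ((1 / 2 + 3 * ε) * y)) hA (hB'.const_mul W)
    (integral_nonneg fun x => (Real.exp_pos _).le) (integral_nonneg fun x => by positivity)
    (le_of_eq (integral_exp_neg_mul_Ioi hε 0))
    (le_of_eq (by rw [integral_const_mul, integral_exp_mul_Iic (by positivity)])) fun x _ y _ => ?_).trans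
    (le_of_eq ?_)
  · rw [norm_mul, norm_mul, norm_real, Real.norm_of_nonneg (Real.exp_pos _).le]
    calc _ ≤ 1 * (Real.exp (-y / 2) * (W * Real.exp (-(1 + 3 * ε) * -y) * Real.exp (-ε * x))) := by
          gcongr
          exact h p j k a c B hBa hB hB0 (-y, x)
      _ = Real.exp (-ε * x) * (W * (Real.exp (-y / 2) * Real.exp (-(1 + 3 * ε) * -y))) := by ring
      _ = _ := by
        rw [← Real.exp_add]
        ring_nf
  · rw [mul_zero, Real.exp_zero, hW]
    ring

/-! ### The main dual term -/

/-- The rotation `(x, y) ↦ (-y, x)` of the plane. -/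
def planeRotation : ℝ × ℝ ≃ᵐ ℝ × ℝ :=
  MeasurableEquiv.prodComm.trans ((MeasurableEquiv.neg ℝ).prodCongr (MeasurableEquiv.refl ℝ))

theorem planeRotation_apply (z : ℝ × ℝ) : planeRotation z = (-z.2, z.1) := rfl

theorem measurePreserving_planeRotation : MeasurePreserving planeRotation (volume : Measure (ℝ × ℝ)) volume := by
  have h := ((Measure.measurePreserving_neg (volume : Measure ℝ)).prod (MeasurePreserving.id volume)).comp
    (Measure.measurePreserving_swap (μ := (volume : Measure ℝ)) (ν := (volume : Measure ℝ)))
  exact h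

theorem integrable_pairWeight_rotate {q : ℕ} [NeZero q] {v : ℤ × ℤ} (h1 : v.1 ≠ 0) (h2 : v.2 ≠ 0) :
    Integrable (fun z : ℝ × ℝ => Real.exp (-z.2 / 2) * pairWeight q (-z.2, z.1) v) ∧
    ∫ z : ℝ × ℝ, Real.exp (-z.2 / 2) * pairWeight q (-z.2, z.1) v =
      1 / 2 * (√(q / Real.pi) * Real.Gamma (1 / 4) ^ 2) / √|((v.1 * v.2 : ℤ) : ℝ)| := by
  have hq : (0 : ℝ) < q := by exact_mod_cast NeZero.pos q
  have h1' : (0 : ℝ) < |(v.1 : ℝ)| := by positivity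
  have h2' : (0 : ℝ) < |(v.2 : ℝ)| := by positivity
  have hc : 0 < Real.pi * (v.1 : ℝ) ^ 2 / q := by positivity
  have hd : 0 < Real.pi * (v.2 : ℝ) ^ 2 / q := by positivity
  obtain ⟨hi, hv⟩ := integral_exp_two_exp (s := 1 / 2) (by norm_num) hc hd
  set F : ℝ × ℝ → ℝ := fun z => Real.exp (1 / 2 * z.1) * Real.exp (-(Real.pi * (v.1 : ℝ) ^ 2 / q * Real.exp (z.1 + z.2) +
    Real.pi * (v.2 : ℝ) ^ 2 / q * Real.exp (z.1 - z.2))) with hF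
  have e (z : ℝ × ℝ) : Real.exp (-z.2 / 2) * pairWeight q (-z.2, z.1) v = F (planeRotation z) := by
    rw [planeRotation_apply, hF, pairWeight, ← Real.exp_add]
    ring_nf
  simp only [e]
  refine ⟨(measurePreserving_planeRotation.integrable_comp_emb planeRotation.measurableEmbedding).2 hi, ?_⟩
  rw [measurePreserving_planeRotation.integral_comp' F, hv]
  have e1 : Real.pi * (v.1 : ℝ) ^ 2 / q * (Real.pi * (v.2 : ℝ) ^ 2 / q) =
      ((q / Real.pi) / |((v.1 * v.2 : ℤ) : ℝ)|) ^ (-2 : ℝ) := by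
    rw [Real.rpow_neg (by positivity), Real.rpow_two, div_pow, div_pow, sq_abs]
    push_cast
    field_simp
  rw [e1, ← Real.rpow_mul (by positivity), show (-2 : ℝ) * -(1 / 2 / 2) = 1 / 2 by norm_num,
    ← Real.sqrt_eq_rpow, Real.sqrt_div (by positivity), show (1 / 2 / 2 : ℝ) = 1 / 4 by norm_num]
  ring

theorem pairWeight_swap (q : ℕ) (x y : ℝ) (v : ℤ × ℤ) :
    pairWeight q (x, -y) v.swap = pairWeight q (x, y) v := by
  simp only [pairWeight, Prod.fst_swap, Prod.snd_swap, sub_neg_eq_add, ← sub_eq_add_neg]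
  rw [mul_comm]

/-- The total weight of the factorizations of `B`. -/
noncomputable def divisorWeight (q : ℕ) (B : ℤ) (z : ℝ × ℝ) : ℝ :=
  Real.exp (-z.2 / 2) * ∑ v ∈ B.divisorsAntidiag, pairWeight q (-z.2, z.1) v

theorem divisorWeight_neg (q : ℕ) (B : ℤ) (x y : ℝ) : divisorWeight q B (-x, y) = divisorWeight q B (x, y) := by
  rw [divisorWeight, divisorWeight]
  congr 1
  refine Finset.sum_nbij' Prod.swap Prod.swap ?_ ?_ (fun _ _ => rfl) (fun _ _ => rfl) ?_
  · intro v hv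
    rw [Int.mem_divisorsAntidiag] at hv ⊢
    exact ⟨(mul_comm _ _).trans hv.1, hv.2⟩
  · intro v hv
    rw [Int.mem_divisorsAntidiag] at hv ⊢
    exact ⟨(mul_comm _ _).trans hv.1, hv.2⟩
  · intro v _
    rw [← pairWeight_swap]
    simp

theorem integrable_divisorWeight (q : ℕ) [NeZero q] (B : ℤ) : Integrable (divisorWeight q B) := by
  have e : divisorWeight q B = fun z => ∑ v ∈ B.divisorsAntidiag, Real.exp (-z.2 / 2) * pairWeight q (-z.2, z.1) v := by
    ext z
    rw [divisorWeight, Finset.mul_sum]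
  rw [e]
  refine integrable_finsetSum _ fun v hv => ?_
  obtain ⟨h1, h2⟩ := Int.mem_divisorsAntidiag.1 hv
  rw [← h1] at h2
  exact (integrable_pairWeight_rotate (left_ne_zero_of_mul h2) (right_ne_zero_of_mul h2)).1

theorem integral_divisorWeight (q : ℕ) [NeZero q] (B : ℤ) :
    ∫ z, divisorWeight q B z =
      √(q / Real.pi) * Real.Gamma (1 / 4) ^ 2 * (B.natAbs.divisors.card / √B.natAbs) := by
  simp only [divisorWeight, Finset.mul_sum]
  have hne : ∀ v ∈ B.divisorsAntidiag, v.1 ≠ 0 ∧ v.2 ≠ 0 := by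
    intro v hv
    obtain ⟨h1, h2⟩ := Int.mem_divisorsAntidiag.1 hv
    rw [← h1] at h2
    exact ⟨left_ne_zero_of_mul h2, right_ne_zero_of_mul h2⟩
  rw [integral_finsetSum _ fun v hv => (integrable_pairWeight_rotate (hne v hv).1 (hne v hv).2).1]
  have h : ∀ v ∈ B.divisorsAntidiag, ∫ z : ℝ × ℝ, Real.exp (-z.2 / 2) * pairWeight q (-z.2, z.1) v =
      1 / 2 * (√(q / Real.pi) * Real.Gamma (1 / 4) ^ 2) / √|(B : ℝ)| := by
    intro v hv
    rw [(integrable_pairWeight_rotate (hne v hv).1 (hne v hv).2).2, (Int.mem_divisorsAntidiag.1 hv).1]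
  rw [Finset.sum_congr rfl h, Finset.sum_const, Int.card_divisorsAntidiag, nsmul_eq_mul, Nat.cast_natAbs, Int.cast_abs]
  push_cast
  ring

theorem exists_abs_integral_divisorWeight_sub_le {κ : ℝ} (hκ : 0 < κ) (hκ' : κ < 1 / 2) : ∃ K > 0, ∀ (q : ℕ) [NeZero q]
    (B : ℤ) (r : ℝ),
    |(∫ z in Set.Ioi 0 ×ˢ Set.Iic r, divisorWeight q B z) -
      1 / 2 * (√(q / Real.pi) * Real.Gamma (1 / 4) ^ 2 * (B.natAbs.divisors.card / √B.natAbs))| ≤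
    K * B.natAbs.divisors.card * (q : ℝ) ^ κ * Real.exp (-(1 / 2 - κ) * r) := by
  refine ⟨1 / κ * (κ ^ κ * 2) * (1 / (1 / 2 - κ)), ?_, fun q _ B r => ?_⟩
  · have : 0 < 1 / 2 - κ := by linarith
    positivity
  have hq : (0 : ℝ) < q := by exact_mod_cast NeZero.pos q
  have hI := integrable_divisorWeight q B
  have h1 : 1 / 2 * (√(q / Real.pi) * Real.Gamma (1 / 4) ^ 2 * (B.natAbs.divisors.card / √B.natAbs)) =
      ∫ z in Set.Ioi 0 ×ˢ Set.univ, divisorWeight q B z := by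
    have e := integral_eq_two_mul_of_even_fst hI.ofReal fun x y => by rw [divisorWeight_neg]
    simp only [coe_algebraMap, integral_complex_ofReal] at e
    rw [← integral_divisorWeight]
    have e' : ∫ z, divisorWeight q B z = 2 * ∫ z in Set.Ioi 0 ×ˢ Set.univ, divisorWeight q B z := by exact_mod_cast e
    rw [e']
    ring
  have h2 : ∫ z in Set.Ioi 0 ×ˢ Set.univ, divisorWeight q B z =
      (∫ z in Set.Ioi 0 ×ˢ Set.Iic r, divisorWeight q B z) + ∫ z in Set.Ioi 0 ×ˢ Set.Ioi r, divisorWeight q B z := by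
    rw [← setIntegral_union _ (measurableSet_Ioi.prod measurableSet_Ioi) hI.integrableOn hI.integrableOn,
      ← Set.prod_union, Set.Iic_union_Ioi]
    exact Set.disjoint_prod.2 (Or.inr (Set.Iic_disjoint_Ioi le_rfl))
  rw [h1, h2, sub_add_cancel_left, abs_neg, ← Real.norm_eq_abs]
  set W : ℝ := κ ^ κ * 2 * B.natAbs.divisors.card * (q : ℝ) ^ κ with hW
  have hW0 : 0 ≤ W := by positivity
  have hp : 0 < 1 / 2 - κ := by linarith
  refine (norm_setIntegral_prod_le measurableSet_Ioi measurableSet_Ioi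
    (A := fun x => Real.exp (-κ * x)) (B := fun y => W * Real.exp (-(1 / 2 - κ) * y))
    (integrableOn_exp_neg_mul_Ioi hκ 0) ((integrableOn_exp_neg_mul_Ioi hp r).const_mul W)
    (integral_nonneg fun x => (Real.exp_pos _).le) (integral_nonneg fun x => by positivity)
    (le_of_eq (integral_exp_neg_mul_Ioi hκ 0))
    (le_of_eq (by rw [integral_const_mul, integral_exp_neg_mul_Ioi hp])) fun x _ y _ => ?_).trans
    (le_of_eq ?_)
  · have hw : ∀ v ∈ B.divisorsAntidiag, pairWeight q (-y, x) v ≤ κ ^ κ * ((q : ℝ) ^ κ * Real.exp (-κ * (x - y))) := by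
      intro v hv
      obtain ⟨e1, e2⟩ := Int.mem_divisorsAntidiag.1 hv
      rw [← e1] at e2
      have hv1 : (1 : ℝ) ≤ (v.1 : ℝ) ^ 2 := by
        have := Int.one_le_abs (left_ne_zero_of_mul e2)
        rw [one_le_sq_iff_one_le_abs]
        exact_mod_cast this
      have e3 : pairWeight q (-y, x) v ≤ Real.exp (-(Real.exp (x - y) / q)) := by
        rw [pairWeight, ← Real.exp_add, Real.exp_le_exp, show -y + x = x - y by ring]
        have t1 : 0 < Real.exp (x - y) / q := by positivity
        have t2 : 0 ≤ Real.pi * (Real.exp (-y - x) / q) * (v.2 : ℝ) ^ 2 := by positivity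
        have t3 : 1 ≤ Real.pi * (v.1 : ℝ) ^ 2 := by nlinarith [Real.pi_gt_three]
        nlinarith
      refine e3.trans ((exp_neg_le_mul_rpow hκ (by positivity)).trans (le_of_eq ?_))
      rw [Real.div_rpow (Real.exp_pos _).le hq.le, ← Real.exp_mul, Real.rpow_neg hq.le, div_inv_eq_mul]
      ring_nf
    rw [divisorWeight, Real.norm_of_nonneg (mul_nonneg (Real.exp_pos _).le
      (Finset.sum_nonneg fun v _ => (pairWeight_pos _ _ _).le))]
    calc _ ≤ Real.exp (-y / 2) * (B.divisorsAntidiag.card • (κ ^ κ * ((q : ℝ) ^ κ * Real.exp (-κ * (x - y))))) := by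
          gcongr
          exact Finset.sum_le_card_nsmul _ _ _ hw
      _ = W * (Real.exp (-y / 2) * Real.exp (-κ * (x - y))) := by
          rw [Int.card_divisorsAntidiag, nsmul_eq_mul, hW]
          push_cast
          ring
      _ = _ := by
          rw [← Real.exp_add, mul_left_comm, ← Real.exp_add]
          ring_nf
  · rw [mul_zero, Real.exp_zero, hW]
    ring

theorem re_dualSign_mul_eN {p j k : ℕ} (hp : p.Prime) (hp2 : p ≠ 2) (hj : 0 < j) (hjk : 2 * j ≤ k) {a b c : ℤ}
    (hb : 2 * b ≡ 1 [ZMOD (p ^ (k - j) : ℕ)]) (hc : 2 * a * c ≡ 1 [ZMOD (p ^ k : ℕ)]) (X : ℤ) :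
    (dualSign p j k a b * eN (p ^ k) X).re = (jacobiSym (2 * a) (p ^ k) : ℝ) *
      (if p ^ k % 4 = 1 then Real.cos (2 * Real.pi * X / (p : ℝ) ^ k) else Real.sin (2 * Real.pi * X / (p : ℝ) ^ k)) := by
  have : Fact p.Prime := ⟨hp⟩
  have hodd : Odd p := hp.odd_of_ne_two hp2
  have hbp : 2 * b ≡ 1 [ZMOD p] := hb.of_dvd (Int.natCast_dvd_natCast.2 (dvd_pow_self p (by omega)))
  have hcp : 2 * a * c ≡ 1 [ZMOD p] := hc.of_dvd (Int.natCast_dvd_natCast.2 (dvd_pow_self p (by omega)))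
  have hsq {x y : ℤ} (h : x * y ≡ 1 [ZMOD p]) : jacobiSym x p ^ 2 = 1 := by
    have h1 : jacobiSym (x * y) p = 1 := by
      rw [jacobiSym.mod_left, h, ← jacobiSym.mod_left, jacobiSym.one_left]
    rw [jacobiSym.mul_left] at h1
    rcases jacobiSym.trichotomy x p with h2 | h2 | h2 <;> rw [h2] at h1 ⊢ <;> simp at h1 ⊢
  have hmod : p ^ k % 4 = p ^ (k - 2 * j) % 4 := by
    have h1 : (p ^ (2 * j)) % 4 = 1 := by
      obtain ⟨m, hm⟩ := hodd.pow (n := j)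
      rw [mul_comm, pow_mul, hm, show (2 * m + 1) ^ 2 = 4 * (m ^ 2 + m) + 1 by ring]
      omega
    conv_lhs => rw [show k = 2 * j + (k - 2 * j) by omega, pow_add, Nat.mul_mod, h1, one_mul, Nat.mod_mod]
  have hjac : jacobiSym (-(a * b)) (p ^ (k - 2 * j)) = jacobiSym (-1) (p ^ k) * jacobiSym (2 * a) (p ^ k) := by
    have h1 : jacobiSym (-(a * b)) p = jacobiSym (-1 * (2 * a)) p := by
      have h2 := hsq (x := 2) (y := b) hbp
      have h3 : jacobiSym (2 ^ 2 * -(a * b)) p = jacobiSym (-(a * b)) p := by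
        rw [jacobiSym.mul_left, jacobiSym.pow_left, h2, one_mul]
      rw [← h3, jacobiSym.mod_left, jacobiSym.mod_left (-1 * (2 * a))]
      congr 1
      have := hbp.mul_left (-(2 * a))
      have e : -(2 * a) * (2 * b) = 2 ^ 2 * -(a * b) := by ring
      have e2 : -(2 * a) * 1 = -1 * (2 * a) := by ring
      rwa [e, e2] at this
    have h2 : jacobiSym (-1 * (2 * a)) p ^ 2 = 1 := hsq (y := -c) (by
      have e : -1 * (2 * a) * -c = 2 * a * c := by ring
      rwa [e])
    rw [← jacobiSym.mul_left, jacobiSym.pow_right, jacobiSym.pow_right, h1]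
    conv_rhs => rw [show k = 2 * j + (k - 2 * j) by omega, pow_add, pow_mul, h2, one_pow, one_mul]
  have hoddq : Odd (p ^ k) := hodd.pow
  have heN : eN (p ^ k) X = Real.cos (2 * Real.pi * X / (p : ℝ) ^ k) + Real.sin (2 * Real.pi * X / (p : ℝ) ^ k) * I := by
    rw [eN, ofReal_cos, ofReal_sin, ← exp_mul_I]
    congr 1
    push_cast
    ring
  rw [dualSign, hjac, ← hmod, jacobiSym.at_neg_one hoddq, heN]
  split_ifs with h
  · rw [ZMod.χ₄_nat_one_mod_four h, one_mul, mul_one, ← ofReal_intCast, re_ofReal_mul, add_re, ofReal_re,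
      re_ofReal_mul, I_re, mul_zero, add_zero]
  · have h3 : p ^ k % 4 = 3 := by
      have := Nat.odd_iff.1 hoddq
      omega
    rw [ZMod.χ₄_nat_three_mod_four h3]
    have e : (((-1 * jacobiSym (2 * a) (p ^ k) : ℤ) : ℂ) * I *
        (Real.cos (2 * Real.pi * X / (p : ℝ) ^ k) + Real.sin (2 * Real.pi * X / (p : ℝ) ^ k) * I)) =
        ((jacobiSym (2 * a) (p ^ k) * Real.sin (2 * Real.pi * X / (p : ℝ) ^ k) : ℝ) : ℂ) +
        ((-jacobiSym (2 * a) (p ^ k) * Real.cos (2 * Real.pi * X / (p : ℝ) ^ k) : ℝ) : ℂ) * I := by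
      push_cast
      linear_combination (-(jacobiSym (2 * a) (p ^ k) : ℂ) * Complex.sin (2 * Real.pi * X / (p : ℂ) ^ k)) * I_sq
    rw [e, add_re, re_ofReal_mul, I_re, mul_zero, add_zero, ofReal_re]

theorem norm_eN_sub_one_le (q : ℕ) (x : ℤ) : ‖eN q x - 1‖ ≤ 2 * Real.pi * |(x : ℝ)| / q := by
  have e : eN q x = cexp (I * ((2 * Real.pi * x / q : ℝ) : ℂ)) := by
    rw [eN]
    congr 1
    push_cast
    ring
  rw [e]
  refine (Real.norm_exp_I_mul_ofReal_sub_one_le).trans (le_of_eq ?_)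
  rw [Real.norm_eq_abs, abs_div, abs_mul, abs_of_pos Real.two_pi_pos, Nat.abs_cast]

set_option maxHeartbeats 800000 in
theorem exists_abs_re_integral_cosetTheta_sub_le {ε : ℝ} (hε : 0 < ε) (hε' : ε < 1 / 2) : ∃ K > 0, ∀ (p j k : ℕ),
    p.Prime → p ≠ 2 → 0 < j → 2 * j ≤ k → ∀ (χ : DirichletCharacter ℂ (p ^ k)), χ.IsPrimitive → ∀ a b β c : ℤ,
    (∀ x : ℤ, χ ((1 + p ^ j * x : ℤ) : ZMod (p ^ k)) = eN (p ^ (k - j)) (a * (x - b * p ^ j * x ^ 2))) →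
    2 * b ≡ 1 [ZMOD (p ^ (k - j) : ℕ)] → 2 * a * c ≡ 1 [ZMOD (p ^ k : ℕ)] → β ≡ a [ZMOD (p ^ j : ℕ)] →
    2 * |β| < (p ^ j : ℕ) → β ≠ 0 → ∀ r : ℝ,
    |2 * (∫ z in Set.Ioi (0 : ℝ) ×ˢ Set.Iic r, (Real.exp (z.1 / 2) : ℂ) * cosetTheta χ (p ^ j) z).re -
      √((p ^ k : ℕ) / Real.pi) * Real.Gamma (1 / 4) ^ 2 * (β.natAbs.divisors.card / √β.natAbs) *
      ((jacobiSym (2 * a) (p ^ k) : ℝ) * (if p ^ k % 4 = 1 then Real.cos (2 * Real.pi * c * (a - β) ^ 2 / (p : ℝ) ^ k)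
        else Real.sin (2 * Real.pi * c * (a - β) ^ 2 / (p : ℝ) ^ k)))| ≤
    K * (((p : ℝ) ^ k) ^ (1 + 3 * ε) / (p : ℝ) ^ j * Real.exp ((1 / 2 + 3 * ε) * r) +
      β.natAbs.divisors.card * ((p : ℝ) ^ k) ^ ε * Real.exp (-(1 / 2 - ε) * r) +
      √((p : ℝ) ^ k) * (β.natAbs.divisors.card / √β.natAbs) * (|(β : ℝ)| / (p : ℝ) ^ k)) := by
  obtain ⟨K₁, hK₁, h₁⟩ := exists_norm_integral_dual_sub_le hε
  obtain ⟨K₂, hK₂, h₂⟩ := exists_abs_integral_divisorWeight_sub_le hε hε'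
  set G := Real.Gamma (1 / 4) ^ 2 with hG
  have hG0 : 0 < G := pow_pos (Real.Gamma_pos_of_pos (by norm_num)) 2
  refine ⟨2 * K₁ + 2 * K₂ + G * (2 * Real.pi), by have := Real.pi_pos; positivity,
    fun p j k hp hp2 hj hjk χ hχp a b β c hχ hb hc hβ hβj hβ0 r => ?_⟩
  have : NeZero (p ^ k) := ⟨pow_ne_zero k hp.ne_zero⟩
  have hq : (0 : ℝ) < (p : ℝ) ^ k := pow_pos (by exact_mod_cast hp.pos) k
  set σ := dualSign p j k a b with hσ
  have hσ1 : ‖σ‖ ≤ 1 := norm_dualSign_le _ _ _ _ _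
  set E := dualCoeff p j k a c (-β) with hE
  have hE1 : ‖E‖ ≤ 1 := norm_dualCoeff_le _ _ _ _ _ _
  set N := √((p ^ k : ℕ) / Real.pi) * G with hN
  have hN0 : 0 ≤ N := by positivity
  set d : ℝ := (β.natAbs.divisors.card : ℝ) with hd
  set s : ℝ := √(β.natAbs : ℝ) with hs
  have h1 := h₁ p j k a c (-β) σ hσ1 hβ.neg (by rwa [abs_neg]) (neg_ne_zero.2 hβ0) r
  have h2 := h₂ (p ^ k) (-β) r
  rw [Int.natAbs_neg, ← hN, ← hd, ← hs, Nat.cast_pow] at h2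
  set J := ∫ z in Set.Ioi (0 : ℝ) ×ˢ Set.Iic r, divisorWeight (p ^ k) (-β) z with hJ
  set T := ∫ z in Set.Ioi (0 : ℝ) ×ˢ Set.Iic r, (Real.exp (z.1 / 2) : ℂ) * cosetTheta χ (p ^ j) z with hT
  have hTJ : T - σ * E * J = ∫ z in Set.Ioi 0 ×ˢ Set.Iic r, σ * ((Real.exp (-z.2 / 2) : ℂ) *
      (∑' v : ℤ × ℤ, dualCoeff p j k a c (v.1 * v.2) * pairWeight (p ^ k) (-z.2, z.1) v -
      dualCoeff p j k a c (-β) * (∑ v ∈ (-β).divisorsAntidiag, pairWeight (p ^ k) (-z.2, z.1) v : ℝ))) := by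
    have e1 : σ * E * J = ∫ z in Set.Ioi (0 : ℝ) ×ˢ Set.Iic r, σ * E * (divisorWeight (p ^ k) (-β) z : ℂ) := by
      rw [integral_const_mul, hJ, integral_complex_ofReal]
    have i1 : IntegrableOn (fun z : ℝ × ℝ => (Real.exp (z.1 / 2) : ℂ) * cosetTheta χ (p ^ j) z)
        (Set.Ioi (0 : ℝ) ×ˢ Set.Iic r) := (integrable_cosetTheta hp (by omega) hχp).integrableOn
    have i2 : IntegrableOn (fun z : ℝ × ℝ => σ * E * (divisorWeight (p ^ k) (-β) z : ℂ))
        (Set.Ioi (0 : ℝ) ×ˢ Set.Iic r) := ((integrable_divisorWeight (p ^ k) (-β)).ofReal.const_mul _).integrableOn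
    rw [e1, hT, ← integral_sub i1 i2]
    refine integral_congr_ae (Filter.Eventually.of_forall fun z => ?_)
    simp only [cosetTheta_eq_dual hp hp2 hj hjk hχ hb hc z, divisorWeight]
    push_cast
    ring
  rw [← hTJ] at h1
  have hdvd : ((p ^ j : ℕ) : ℤ) ∣ a + -β := by
    have := hβ.dvd
    rwa [sub_eq_add_neg] at this
  have hEe : E = eN (p ^ k) (-β) * eN (p ^ k) (c * (a + -β) ^ 2) := by rw [hE, dualCoeff, if_pos hdvd]
  have hphase := re_dualSign_mul_eN hp hp2 hj hjk hb hc (c * (a + -β) ^ 2)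
  have hX : 2 * Real.pi * ((c * (a + -β) ^ 2 : ℤ) : ℝ) = 2 * Real.pi * c * (a - β) ^ 2 := by
    push_cast
    ring
  rw [hX] at hphase
  rw [← hphase, ← hσ]
  set e := eN (p ^ k) (c * (a + -β) ^ 2) with he
  have hEe' : ‖σ * E - σ * e‖ ≤ 2 * Real.pi * |(β : ℝ)| / (p : ℝ) ^ k := by
    rw [hEe, show σ * (eN (p ^ k) (-β) * e) - σ * e = σ * (eN (p ^ k) (-β) - 1) * e by ring, norm_mul, norm_mul, he,
      norm_eN, mul_one]
    have := norm_eN_sub_one_le (p ^ k) (-β)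
    rw [Int.cast_neg, abs_neg, Nat.cast_pow] at this
    exact (mul_le_of_le_one_left (norm_nonneg _) hσ1).trans this
  have hsplit : (2 * T - N * (d / s) * (σ * e) : ℂ) =
      2 * (T - σ * E * J) + 2 * (σ * E) * ((J - 1 / 2 * (N * (d / s)) : ℝ) : ℂ) + (N * (d / s) : ℝ) * (σ * E - σ * e) := by
    push_cast
    ring
  have hre : 2 * T.re - N * (d / s) * (σ * e).re = (2 * T - N * (d / s) * (σ * e) : ℂ).re := by
    have e1 : (N * (d / s) * (σ * e) : ℂ) = ((N * (d / s) : ℝ) : ℂ) * (σ * e) := by push_cast; rfl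
    rw [sub_re, e1, re_ofReal_mul, show (2 : ℂ) = ((2 : ℝ) : ℂ) by norm_num, re_ofReal_mul]
  have hNq : N ≤ √((p : ℝ) ^ k) * G := by
    rw [hN]
    gcongr
    rw [Nat.cast_pow]
    exact div_le_self hq.le (by linarith [Real.pi_gt_three])
  have hds : 0 ≤ d / s := by positivity
  rw [hre]
  refine (abs_re_le_norm _).trans ?_
  rw [hsplit]
  refine (norm_add₃_le).trans ?_
  rw [norm_mul, norm_mul, norm_mul, norm_mul, norm_mul, norm_real, norm_real, Real.norm_eq_abs, Real.norm_of_nonneg (mul_nonneg hN0 hds),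
    Complex.norm_two]
  have hσE : ‖σ‖ * ‖E‖ ≤ 1 := mul_le_one₀ hσ1 (norm_nonneg _) hE1
  set U := ((p : ℝ) ^ k) ^ (1 + 3 * ε) / (p : ℝ) ^ j * Real.exp ((1 / 2 + 3 * ε) * r) with hU
  set V := d * ((p : ℝ) ^ k) ^ ε * Real.exp (-(1 / 2 - ε) * r) with hV
  set W := √((p : ℝ) ^ k) * (d / s) * (|(β : ℝ)| / (p : ℝ) ^ k) with hW
  have hU0 : 0 ≤ U := by positivity
  have hV0 : 0 ≤ V := by positivity
  have hW0 : 0 ≤ W := by positivity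
  have hπ := Real.pi_pos
  calc _ ≤ 2 * (K₁ * U) + 2 * 1 * (K₂ * V) + (√((p : ℝ) ^ k) * G) * (d / s) * (2 * Real.pi * |(β : ℝ)| / (p : ℝ) ^ k) := by
        gcongr
        · exact h1.trans (le_of_eq (by rw [hU]; ring))
        · exact h2.trans (le_of_eq (by rw [hV]; ring))
    _ = 2 * K₁ * U + 2 * K₂ * V + G * (2 * Real.pi) * W := by rw [hW]; ring
    _ ≤ _ := by
        have : 0 ≤ 2 * K₁ * (V + W) + 2 * K₂ * (U + W) + G * (2 * Real.pi) * (U + V) := by positivity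
        linarith

/-! ### Assembly -/

theorem rpow_mul_rpow_le_of_sq_le {X Q α β τ θ : ℝ} (hX : 1 ≤ X) (hXQ : X ^ 2 ≤ Q) (hτ : 0 ≤ τ)
    (hβ : β ≤ 2 * τ - 5 / 4) (hα : α + τ ≤ θ) : Q ^ α * X ^ β ≤ X ^ (-(5 / 4) : ℝ) * Q ^ θ := by
  have hX0 : 0 < X := by linarith
  have hQ : 1 ≤ Q := by nlinarith
  have hQ0 : 0 < Q := by linarith
  calc Q ^ α * X ^ β ≤ Q ^ α * X ^ (2 * τ - 5 / 4) := by gcongr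
    _ = Q ^ α * ((X ^ 2) ^ τ * X ^ (-(5 / 4) : ℝ)) := by
        rw [← Real.rpow_natCast, ← Real.rpow_mul hX0.le, ← Real.rpow_add hX0]
        push_cast
        ring_nf
    _ ≤ Q ^ α * (Q ^ τ * X ^ (-(5 / 4) : ℝ)) := by gcongr
    _ = X ^ (-(5 / 4) : ℝ) * Q ^ (α + τ) := by rw [Real.rpow_add hQ0]; ring
    _ ≤ _ := by gcongr

theorem exp_mul_neg_half_log {X : ℝ} (hX : 0 < X) (s : ℝ) : Real.exp (s * (-(1 / 2) * Real.log X)) = X ^ (-s / 2) := by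
  rw [Real.rpow_def_of_pos hX]
  ring_nf

/-- The four contributions to the moment at height `-(log X) / 2` are admissible. -/
theorem moment_error_le {ε δ X Q K₀ s d b : ℝ} (hδ : 0 < δ) (hδε : 3 * δ ≤ ε) (hX : 1 ≤ X) (hXQ : X ^ 2 ≤ Q)
    (hb : 0 < b) (hbX : b ≤ X) (hs : s = √b) (hK₀ : 0 ≤ K₀) (hd : d ≤ K₀ * b ^ δ) :
    Q ^ (1 / 4 : ℝ) ≤ X ^ (-(5 / 4) : ℝ) * Q ^ (1 + ε) ∧
    Q ^ (1 / 2 + δ) * Real.exp ((1 / 2 + δ) * (-(1 / 2) * Real.log X)) ≤ X ^ (-(5 / 4) : ℝ) * Q ^ (1 + ε) ∧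
    √(Q / X) * (X ^ 2 / Q) ^ (-(1 / 2 + δ)) * Real.exp (-(1 / 2 + δ) * (-(1 / 2) * Real.log X)) ≤
      X ^ (-(5 / 4) : ℝ) * Q ^ (1 + ε) ∧
    Q ^ (1 + 3 * δ) / X * Real.exp ((1 / 2 + 3 * δ) * (-(1 / 2) * Real.log X)) +
      d * Q ^ δ * Real.exp (-(1 / 2 - δ) * (-(1 / 2) * Real.log X)) +
      √Q * (d / s) * (b / Q) ≤ (1 + 2 * K₀) * (X ^ (-(5 / 4) : ℝ) * Q ^ (1 + ε)) := by
  have hX0 : 0 < X := by linarith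
  have hQ : 1 ≤ Q := by nlinarith
  have hQ0 : 0 < Q := by linarith
  set B := X ^ (-(5 / 4) : ℝ) * Q ^ (1 + ε) with hB
  have hdX : d ≤ K₀ * X ^ δ := hd.trans (by gcongr)
  refine ⟨?_, ?_, ?_, ?_⟩
  · have := rpow_mul_rpow_le_of_sq_le (α := 1 / 4) (β := 0) (τ := 5 / 8) (θ := 1 + ε) hX hXQ (by norm_num) (by norm_num)
      (by linarith)
    rwa [Real.rpow_zero, mul_one] at this
  · rw [exp_mul_neg_half_log hX0]
    exact rpow_mul_rpow_le_of_sq_le (τ := 1 / 2) hX hXQ (by norm_num) (by linarith) (by linarith)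
  · rw [exp_mul_neg_half_log hX0, Real.sqrt_eq_rpow, Real.div_rpow hQ0.le hX0.le, Real.div_rpow (by positivity) hQ0.le,
      ← Real.rpow_natCast X 2, ← Real.rpow_mul hX0.le]
    have e : Q ^ (1 / 2 : ℝ) / X ^ (1 / 2 : ℝ) * (X ^ (((2 : ℕ) : ℝ) * -(1 / 2 + δ)) / Q ^ (-(1 / 2 + δ))) *
        X ^ (-(-(1 / 2 + δ)) / 2) = Q ^ (1 + δ) * X ^ (-(5 / 4) - 3 / 2 * δ) := by
      rw [show (1 + δ) = 1 / 2 - -(1 / 2 + δ) by ring, Real.rpow_sub hQ0,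
        show -(5 / 4) - 3 / 2 * δ = ((2 : ℕ) : ℝ) * -(1 / 2 + δ) - 1 / 2 + -(-(1 / 2 + δ)) / 2 by push_cast; ring,
        Real.rpow_add hX0, Real.rpow_sub hX0]
      ring
    rw [e]
    exact rpow_mul_rpow_le_of_sq_le (τ := 0) hX hXQ le_rfl (by linarith) (by linarith)
  · rw [exp_mul_neg_half_log hX0, exp_mul_neg_half_log hX0]
    have h1 : Q ^ (1 + 3 * δ) / X * X ^ (-(1 / 2 + 3 * δ) / 2) ≤ B := by
      have e : Q ^ (1 + 3 * δ) / X * X ^ (-(1 / 2 + 3 * δ) / 2) = Q ^ (1 + 3 * δ) * X ^ (-(5 / 4) - 3 / 2 * δ) := by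
        rw [show -(5 / 4) - 3 / 2 * δ = -(1 / 2 + 3 * δ) / 2 - 1 by ring, Real.rpow_sub_one hX0.ne']
        ring
      rw [e]
      exact rpow_mul_rpow_le_of_sq_le (τ := 0) hX hXQ le_rfl (by linarith) (by linarith)
    have h2 : d * Q ^ δ * X ^ (-(-(1 / 2 - δ)) / 2) ≤ K₀ * B := by
      calc _ ≤ K₀ * X ^ δ * Q ^ δ * X ^ (-(-(1 / 2 - δ)) / 2) := by gcongr
        _ = K₀ * (Q ^ δ * X ^ (1 / 4 + δ / 2)) := by
            rw [show 1 / 4 + δ / 2 = δ + -(-(1 / 2 - δ)) / 2 by ring, Real.rpow_add hX0]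
            ring
        _ ≤ _ := by
            gcongr
            exact rpow_mul_rpow_le_of_sq_le (τ := 3 / 4 + δ / 4) hX hXQ (by linarith) (by linarith) (by linarith)
    have h3 : √Q * (d / s) * (b / Q) ≤ K₀ * B := by
      have hss : s ^ 2 = b := by rw [hs, Real.sq_sqrt hb.le]
      have hs0 : 0 < s := by rw [hs]; positivity
      have hsX : s ≤ X ^ (1 / 2 : ℝ) := by rw [hs, ← Real.sqrt_eq_rpow]; gcongr
      have e : √Q * (d / s) * (b / Q) = d * s * Q ^ (-(1 / 2) : ℝ) := by
        rw [← hss, show (-(1 / 2) : ℝ) = 1 / 2 - 1 by norm_num, Real.rpow_sub_one hQ0.ne', ← Real.sqrt_eq_rpow]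
        field_simp
      rw [e]
      calc _ ≤ K₀ * X ^ δ * X ^ (1 / 2 : ℝ) * Q ^ (-(1 / 2) : ℝ) := by gcongr
        _ = K₀ * (Q ^ (-(1 / 2) : ℝ) * X ^ (δ + 1 / 2)) := by rw [Real.rpow_add hX0]; ring
        _ ≤ _ := by
            gcongr
            exact rpow_mul_rpow_le_of_sq_le (τ := 1 + δ) hX hXQ (by linarith) (by linarith) (by linarith)
    linarith

theorem totient_mul_div_le {X Q t M N G B : ℝ} (htX : t ≤ X) (hX : 0 < X) (hQ : 0 < Q) (hG : 0 < G)
    (hN : N = √(Q / Real.pi) * G) (hM : 0 ≤ M) {θ : ℝ} (hB : B = X ^ (-(5 / 4) : ℝ) * Q ^ (1 + θ)) :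
    t * (M * B) / N ≤ √Real.pi / G * M * X ^ (-(1 / 4) : ℝ) * Q ^ (1 / 2 + θ) := by
  have hπ := Real.pi_pos
  have hN0 : 0 < N := by rw [hN]; positivity
  have hB0 : 0 ≤ B := by rw [hB]; positivity
  calc t * (M * B) / N ≤ X * (M * B) / N := by gcongr
    _ = _ := by
      rw [hB, hN, Real.sqrt_div hQ.le, Real.sqrt_eq_rpow Q, show (-(1 / 4) : ℝ) = -(5 / 4) + 1 by norm_num,
        Real.rpow_add_one hX.ne', show 1 / 2 + θ = (1 + θ) - 1 / 2 by ring, Real.rpow_sub hQ]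
      have := Real.rpow_pos_of_pos hQ (1 / 2)
      field_simp

/-- Dividing the split second moment by its normalisation and inserting the bounds for its parts. -/
theorem abs_sub_sub_le_of_split {N S t I I' T O D m e₁ e₂ e₃ e₄ : ℝ} (hN : 0 < N) (ht : 0 ≤ t)
    (h : N * S = t * (I - 2 * I' + 2 * T + 2 * O)) (h₁ : |I - D| ≤ e₁) (h₂ : |I'| ≤ e₂) (h₃ : |O| ≤ e₃)
    (h₄ : |2 * T - N * m| ≤ e₄) : |S - t * D / N - t * m| ≤ t * (e₁ + 2 * e₂ + 2 * e₃ + e₄) / N := by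
  have e : S - t * D / N - t * m = t * ((I - D) - 2 * I' + 2 * O + (2 * T - N * m)) / N := by
    rw [show S = N * S / N by field_simp, h]
    field_simp
    ring
  rw [e, abs_div, abs_mul, abs_of_nonneg ht, abs_of_pos hN]
  gcongr
  rw [abs_le] at *
  constructor <;> linarith [h₁.1, h₁.2, h₂.1, h₂.2, h₃.1, h₃.2, h₄.1, h₄.2]

theorem diagMain_div {p : ℕ} {k : ℕ} (hp : p.Prime) (hk : k ≠ 0) (t : ℝ) :
    t * diagMain p ((p : ℝ) ^ k) / (√((p ^ k : ℕ) / Real.pi) * Real.Gamma (1 / 4) ^ 2) =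
      t / 2 * ((p ^ k).totient / (p ^ k : ℝ)) * (Real.log (p ^ k) + 2 * Real.eulerMascheroniConstant
        + deriv Real.Gamma (1 / 4) / Real.Gamma (1 / 4) - Real.log Real.pi + 2 * Real.log p / (p - 1)) := by
  have hp0 : (0 : ℝ) < p := by exact_mod_cast hp.pos
  have hq : (0 : ℝ) < (p : ℝ) ^ k := pow_pos hp0 k
  have hG : 0 < Real.Gamma (1 / 4) := Real.Gamma_pos_of_pos (by norm_num)
  have hs : 0 < √((p : ℝ) ^ k / Real.pi) := by have := Real.pi_pos; positivity
  have hφ : ((p ^ k).totient : ℝ) / (p ^ k : ℝ) = 1 - 1 / p := by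
    rw [Nat.totient_prime_pow hp (Nat.pos_of_ne_zero hk)]
    obtain ⟨n, rfl⟩ := Nat.exists_eq_succ_of_ne_zero hk
    push_cast [hp.one_le]
    rw [pow_succ]
    field_simp
  rw [hφ, diagMain, ← Real.sqrt_eq_rpow, Real.log_div hq.ne' Real.pi_ne_zero, Nat.cast_pow]
  field_simp
  ring

open Classical in
/-- Second moment asymptotic along a coset, `2j ≤ k ≤ 3j` (Garcia--Young, Theorem 1.2). -/
theorem second_moment_coset_asymptotic_small_j :
    ∀ ε : ℝ, 0 < ε → ∃ C : ℝ, 0 < C ∧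
      ∀ (p j k : ℕ) (hp : p.Prime), 5 ≤ p → ∀ (hj : 0 < j) (h2j : 2 * j ≤ k), k ≤ 3 * j →
      ∀ (χ : DirichletCharacter ℂ (p ^ k)), χ.IsPrimitive → χ.Even →
      ∀ a b bχ c : ℤ,
        |(a : ℝ)| < (p ^ (k - j) : ℝ) / 2 →
        2 * b ≡ 1 [ZMOD (p ^ (k - j) : ℕ)] →
        (∀ x : ℤ, χ ((1 + p ^ j * x : ℤ) : ZMod (p ^ k)) =
          eN (p ^ (k - j)) (a * (x - b * p ^ j * x ^ 2))) →
        |(bχ : ℝ)| < (p ^ j : ℝ) / 2 → bχ ≡ a [ZMOD (p ^ j : ℕ)] →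
        2 * a * c ≡ 1 [ZMOD (p ^ k : ℕ)] →
        haveI : NeZero (p ^ k) := ⟨pow_ne_zero k hp.ne_zero⟩
        ¬ ((p : ℤ) ∣ a) ∧
        |(∑ ψ : DirichletCharacter ℂ (p ^ j),
            if ψ.Even then
              ‖(χ * DirichletCharacter.changeLevel
                  (pow_dvd_pow p (by omega : j ≤ k)) ψ).LFunction (1 / 2)‖ ^ 2
            else 0)
          - ((p ^ j).totient : ℝ) / 2 * ((p ^ k).totient / (p ^ k : ℝ)) *
              (Real.log (p ^ k) + 2 * Real.eulerMascheroniConstant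
                + deriv Real.Gamma (1 / 4) / Real.Gamma (1 / 4)
                - Real.log Real.pi + 2 * Real.log p / (p - 1))
          - (jacobiSym (2 * a) (p ^ k) : ℝ) * ((p ^ j).totient : ℝ) *
              ((bχ.natAbs.divisors.card : ℝ) / Real.sqrt bχ.natAbs) *
              (if p ^ k % 4 = 1 then Real.cos (2 * Real.pi * c * (a - bχ) ^ 2 / (p ^ k))
               else Real.sin (2 * Real.pi * c * (a - bχ) ^ 2 / (p ^ k)))|
        ≤ C * (p ^ j : ℝ) ^ (-(1 / 4 : ℝ)) * (p ^ k : ℝ) ^ (1 / 2 + ε) := by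
  intro ε hε
  set δ := min ε 1 / 4 with hδ
  have hδ0 : 0 < δ := by positivity
  have hδε : 3 * δ ≤ ε := by linarith [min_le_left ε 1]
  have hδ2 : δ < 1 / 2 := by linarith [min_le_right ε 1]
  have hκ : 1 / 2 < 1 / 2 + δ := by linarith
  obtain ⟨K₀, hK₀, H₀⟩ := card_divisors_le_rpow hδ0
  obtain ⟨K₁, hK₁, H₁⟩ := abs_integral_diagTheta_sub_le
  obtain ⟨K₂, hK₂, H₂⟩ := abs_integral_diagTheta_Iic_le hκ
  obtain ⟨K₃, hK₃, H₃⟩ := exists_norm_integral_offTheta_le hκ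
  obtain ⟨K₄, hK₄, H₄⟩ := exists_abs_re_integral_cosetTheta_sub_le hδ0 hδ2
  set G := Real.Gamma (1 / 4) ^ 2 with hG
  have hG0 : 0 < G := pow_pos (Real.Gamma_pos_of_pos (by norm_num)) 2
  set M := K₁ + 2 * K₂ + 2 * K₃ + K₄ * (1 + 2 * K₀) with hM
  have hM0 : 0 < M := by positivity
  refine ⟨√Real.pi / G * M, by have := Real.pi_pos; positivity,
    fun p j k hp hp5 hj h2j _ χ hχp hev a b β c _ hb hχ hβj hβ hc => ?_⟩
  have : NeZero (p ^ k) := ⟨pow_ne_zero k hp.ne_zero⟩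
  have hp2 : p ≠ 2 := by omega
  have hjk : j < k := by omega
  have hpa : ¬ (p : ℤ) ∣ a := fun hd => by
    have h1 := hc.of_dvd (Int.natCast_dvd_natCast.2 (dvd_pow_self p (by omega)))
    have h2 : (p : ℤ) ∣ 1 := (Int.ModEq.dvd_iff h1).1 (Dvd.dvd.mul_right (Dvd.dvd.mul_left hd 2) c)
    exact (Nat.prime_iff_prime_int.1 hp).not_isUnit (isUnit_of_dvd_one h2)
  refine ⟨hpa, ?_⟩
  have hβ0 : β ≠ 0 := by
    rintro rfl
    have h1 := hβ.of_dvd (Int.natCast_dvd_natCast.2 (dvd_pow_self p hj.ne'))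
    exact hpa ((Int.ModEq.dvd_iff h1).1 (dvd_zero _))
  have hp1 : (1 : ℝ) ≤ p := by exact_mod_cast hp.one_le
  set X : ℝ := (p : ℝ) ^ j with hX
  set Q : ℝ := (p : ℝ) ^ k with hQ
  have hX1 : 1 ≤ X := one_le_pow₀ hp1
  have hX0 : 0 < X := by linarith
  have hXQ : X ^ 2 ≤ Q := by
    rw [hX, hQ, ← pow_mul, mul_comm]
    exact pow_le_pow_right₀ hp1 h2j
  have hQ0 : 0 < Q := by nlinarith
  have hβabs : (β.natAbs : ℝ) = |(β : ℝ)| := by rw [Nat.cast_natAbs, Int.cast_abs]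
  have hβ2 : 2 * |β| < (p ^ j : ℕ) := by
    have : 2 * |(β : ℝ)| < X := by linarith
    rw [hX] at this
    exact_mod_cast this
  have hb0 : (0 : ℝ) < β.natAbs := by exact_mod_cast Int.natAbs_pos.2 hβ0
  have hbX : (β.natAbs : ℝ) ≤ X := by
    rw [hβabs]
    linarith [abs_nonneg (β : ℝ)]
  have hr : -(1 / 2) * Real.log X ≤ 0 := by linarith [Real.log_nonneg hX1]
  obtain ⟨E₁, E₂, E₃, E₄⟩ := moment_error_le hδ0 hδε hX1 hXQ hb0 hbX rfl hK₀.le (H₀ _ (Int.natAbs_ne_zero.2 hβ0))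
  set B := X ^ (-(5 / 4) : ℝ) * Q ^ (1 + ε) with hB
  have hsplit := sum_norm_LFunction_eq_split hp hjk hχp hev hr
  have h₁ := (H₁ p Q hp.one_lt hQ0).trans (mul_le_mul_of_nonneg_left E₁ hK₁.le)
  have h₂ := (H₂ p Q _ hQ0 hr).trans (mul_le_mul_of_nonneg_left E₂ hK₂.le)
  have hkj : (p : ℝ) ^ (k - j) = Q / X := by rw [pow_sub₀ _ (by positivity) hjk.le, ← div_eq_mul_inv]
  rw [← hkj] at E₃
  have h₃ := ((abs_re_le_norm _).trans (H₃ p j k hp hp2 hj h2j χ a b hpa hχ _ hr)).trans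
    (mul_le_mul_of_nonneg_left E₃ hK₃.le)
  have h₄ := H₄ p j k hp hp2 hj h2j χ hχp a b β c hχ hb hc hβ hβ2 hβ0 (-(1 / 2) * Real.log X)
  rw [← hβabs] at h₄
  replace h₄ := h₄.trans (mul_le_mul_of_nonneg_left E₄ hK₄.le)
  rw [mul_assoc (√((p ^ k : ℕ) / Real.pi) * G)] at h₄
  set N := √((p ^ k : ℕ) / Real.pi) * G with hN
  have hN0 : 0 < N := by have := Real.pi_pos; positivity
  have ht0 : (0 : ℝ) ≤ (p ^ j).totient := by positivity
  have hmain := abs_sub_sub_le_of_split hN0 ht0 hsplit h₁ h₂ h₃ h₄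
  rw [hN, hG, diagMain_div hp (by omega)] at hmain
  have htX : ((p ^ j).totient : ℝ) ≤ X := by
    rw [hX]
    exact_mod_cast Nat.totient_le (p ^ j)
  have hfin := totient_mul_div_le htX hX0 hQ0 hG0 (N := N) (by rw [hN, hQ, Nat.cast_pow]) hM0.le hB
  refine le_trans (le_of_eq ?_) (hmain.trans (le_trans (le_of_eq ?_) hfin))
  · congr 2
    ring
  · rw [hM]
    ring
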